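/- Let E be a CM field with maximal totally real subfield F and complex conjugation x ↦ x̄, and suppose the class number of E is 1. Let (I,α) and (J,β) be two O_E-lattices of the same signature, i.e. τ(αβ) > 0 for every real embedding τ of F. Then there exists e ∈ E^× with J = eI and α = e·ē·β (i.e. the O_E-lattices are isomorphic) if and only if their discriminant ideals coincide: α·I·Ī·D_E = β·J·J̄·D_E. -/

import Mathlib

set_option synthInstance.maxHeartbeats 1000000
set_option maxHeartbeats 1000000

open NumberField FractionalIdeal
open scoped nonZeroDivisors

section EulerProduct

open UniqueFactorizationMonoid in
/-- Finite geometric products over prime ideals are sums over finite sets of ideals. -/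
theorem prod_geom_eq_sum_ideals {R : Type*} [CommRing R] [IsDedekindDomain R]
    (f : Ideal R →* ℝ) (T : Finset (Ideal R)) (hT : ∀ P ∈ T, Prime P) (n : ℕ) :
    ∃ A : Finset (Ideal R),
      (∀ I, I ∈ A ↔ I ≠ 0 ∧ (∀ P ∈ normalizedFactors I, P ∈ T) ∧
        ∀ P ∈ T, Multiset.count P (normalizedFactors I) < n) ∧
      ∏ P ∈ T, ∑ k ∈ Finset.range n, f P ^ k = ∑ I ∈ A, f I := by
  classical
  let G : (T → ℕ) → Multiset (Ideal R) := fun g ↦ ∑ P : T, Multiset.replicate (g P) P.1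
  have hGmem : ∀ g, ∀ P ∈ G g, P ∈ T := by
    intro g P hP
    simp only [G, Multiset.mem_sum] at hP
    obtain ⟨Q, -, hQ⟩ := hP
    rw [Multiset.eq_of_mem_replicate hQ]
    exact Q.2
  have hGcount : ∀ g, ∀ P : T, Multiset.count P.1 (G g) = g P := by
    intro g P
    simp only [G, Multiset.count_sum', Multiset.count_replicate]
    rw [Finset.sum_eq_single P]
    · simp
    · intro Q _ hQ
      rw [if_neg]
      exact fun h ↦ hQ (Subtype.ext h)
    · simp
  have hnf : ∀ g, normalizedFactors (G g).prod = G g := fun g ↦ by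
    have := normalizedFactors_prod_of_prime (m := G g) (fun P hP ↦ hT P (hGmem g P hP))
    exact this
  have hne : ∀ g, (G g).prod ≠ 0 := fun g ↦ by
    rw [Ne, Multiset.prod_eq_zero_iff]
    exact fun h ↦ (hT _ (hGmem g _ h)).ne_zero rfl
  refine ⟨(Fintype.piFinset fun _ : T ↦ Finset.range n).image fun g ↦ (G g).prod, ?_, ?_⟩
  · intro I
    simp only [Finset.mem_image, Fintype.mem_piFinset, Finset.mem_range]
    constructor
    · rintro ⟨g, hg, rfl⟩
      refine ⟨hne g, ?_, ?_⟩
      · rw [hnf]; exact hGmem g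
      · intro P hP
        rw [hnf, hGcount g ⟨P, hP⟩]
        exact hg _
    · rintro ⟨h0, h1, h2⟩
      refine ⟨fun P ↦ Multiset.count P.1 (normalizedFactors I), fun P ↦ h2 _ P.2, ?_⟩
      have : G (fun P ↦ Multiset.count P.1 (normalizedFactors I)) = normalizedFactors I := by
        ext P
        by_cases hP : P ∈ T
        · exact hGcount _ ⟨P, hP⟩
        · rw [Multiset.count_eq_zero_of_notMem fun h ↦ hP (hGmem _ _ h),
            Multiset.count_eq_zero_of_notMem fun h ↦ hP (h1 _ h)]
      rw [this]
      exact associated_iff_eq.mp (prod_normalizedFactors h0)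
  · rw [Finset.sum_image, ← Finset.prod_coe_sort, Finset.prod_univ_sum]
    · refine Finset.sum_congr rfl fun g _ ↦ ?_
      simp [G, Multiset.prod_sum, map_prod]
    · intro g _ g' _ h
      have : G g = G g' := by
        rw [← hnf g, ← hnf g']
        exact congrArg _ h
      funext P
      rw [← hGcount g P, this, hGcount]

/-- The monoid homomorphism `I ↦ N(I)^(-s)` on ideals. -/
noncomputable def normPow (R : Type*) [CommRing R] [IsDedekindDomain R] [Module.Free ℤ R]
    (s : ℝ) : Ideal R →* ℝ where
  toFun I := (Ideal.absNorm I : ℝ) ^ (-s)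
  map_one' := by simp
  map_mul' I J := by
    rw [map_mul, Nat.cast_mul, Real.mul_rpow (Nat.cast_nonneg _) (Nat.cast_nonneg _)]

variable (L : Type*) [Field L] [NumberField L]

/-- The Dedekind zeta series over real numbers. -/
noncomputable def realZetaTerm (s : ℝ) (n : ℕ) : ℝ :=
  if n = 0 then 0 else (Nat.card {I : Ideal (𝓞 L) // Ideal.absNorm I = n} : ℝ) * (n : ℝ) ^ (-s)

theorem term_eq_realZetaTerm (s : ℝ) (n : ℕ) :
    LSeries.term (fun n ↦ (Nat.card {I : Ideal (𝓞 L) // Ideal.absNorm I = n} : ℂ)) s n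
      = (realZetaTerm L s n : ℂ) := by
  unfold realZetaTerm
  rw [LSeries.term_def]
  split_ifs with h
  · simp
  · push_cast
    rw [Complex.ofReal_cpow (Nat.cast_nonneg _), div_eq_mul_inv]
    push_cast
    rw [Complex.cpow_neg]

theorem realZetaTerm_nonneg (s : ℝ) (n : ℕ) : 0 ≤ realZetaTerm L s n := by
  unfold realZetaTerm
  split_ifs
  · exact le_rfl
  · positivity

theorem tendsto_realZeta :
    Filter.Tendsto (fun s : ℝ ↦ (s - 1) * ∑' n, realZetaTerm L s n) (nhdsWithin 1 (Set.Ioi 1))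
      (nhds (dedekindZeta_residue L)) := by
  have h := tendsto_sub_one_mul_dedekindZeta_nhdsGT L
  have h' := (Complex.continuous_re.tendsto _).comp h
  refine h'.congr fun s ↦ ?_
  have : dedekindZeta L s = ((∑' n, realZetaTerm L s n : ℝ) : ℂ) := by
    unfold dedekindZeta LSeries
    rw [Complex.ofReal_tsum]
    exact tsum_congr fun n ↦ term_eq_realZetaTerm L s n
  simp only [Function.comp]
  rw [this, ← Complex.ofReal_one, ← Complex.ofReal_sub, ← Complex.ofReal_mul, Complex.ofReal_re]

theorem eventually_summable_realZeta :
    ∀ᶠ s in nhdsWithin (1 : ℝ) (Set.Ioi 1), Summable (realZetaTerm L s) := by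
  have h := (tendsto_realZeta L).eventually_ne (dedekindZeta_residue_ne_zero L)
  filter_upwards [h] with s hs
  by_contra hns
  rw [tsum_eq_zero_of_not_summable hns, mul_zero] at hs
  exact hs rfl

theorem sum_normPow_fiber (s : ℝ) (n : ℕ) (hn : n ≠ 0) (A : Finset (Ideal (𝓞 L)))
    (hA : ∀ I, I ∈ A ↔ Ideal.absNorm I = n) :
    ∑ I ∈ A, normPow (𝓞 L) s I = realZetaTerm L s n := by
  rw [realZetaTerm, if_neg hn]
  have : Nat.card {I : Ideal (𝓞 L) // Ideal.absNorm I = n} = A.card := by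
    rw [← Nat.card_eq_finsetCard A]
    exact Nat.card_congr (Equiv.subtypeEquivRight fun I ↦ (hA I).symm)
  rw [this, Finset.sum_congr rfl (g := fun _ ↦ (n : ℝ) ^ (-s)), Finset.sum_const, nsmul_eq_mul]
  intro I hI
  simp [normPow, (hA I).mp hI]

theorem sum_normPow_le (s : ℝ) (hs : Summable (realZetaTerm L s)) (A : Finset (Ideal (𝓞 L)))
    (hA : ∀ I ∈ A, I ≠ 0) :
    ∑ I ∈ A, normPow (𝓞 L) s I ≤ ∑' n, realZetaTerm L s n := by
  classical
  have key : ∑ I ∈ A, normPow (𝓞 L) s I ≤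
      ∑ n ∈ A.image (fun I ↦ Ideal.absNorm I), realZetaTerm L s n := by
    rw [← Finset.sum_fiberwise_of_maps_to (t := A.image (fun I ↦ Ideal.absNorm I))
      (g := fun I ↦ Ideal.absNorm I) (fun I hI ↦ Finset.mem_image_of_mem _ hI)]
    refine Finset.sum_le_sum fun n hn ↦ ?_
    obtain ⟨I, hI, rfl⟩ := Finset.mem_image.mp hn
    have hn0 : Ideal.absNorm I ≠ 0 := fun h ↦ hA I hI (Ideal.absNorm_eq_zero_iff.mp h)
    rw [← sum_normPow_fiber L s _ hn0 (Ideal.finite_setOfPred_absNorm_eq (Ideal.absNorm I)).toFinset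
      (by simp)]
    refine Finset.sum_le_sum_of_subset_of_nonneg ?_ ?_
    · intro J hJ
      simpa using (Finset.mem_filter.mp hJ).2
    · intro J _ _
      simp only [normPow, MonoidHom.coe_mk, OneHom.coe_mk]
      positivity
  exact key.trans (hs.sum_le_tsum _ fun n _ ↦ realZetaTerm_nonneg L s n)

theorem tsum_realZetaTerm_le (s B : ℝ)
    (hB : ∀ A : Finset (Ideal (𝓞 L)), (∀ I ∈ A, I ≠ 0) → ∑ I ∈ A, normPow (𝓞 L) s I ≤ B) :
    ∑' n, realZetaTerm L s n ≤ B := by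
  classical
  refine Real.tsum_le_of_sum_le (realZetaTerm_nonneg L s) fun S ↦ ?_
  let A : ℕ → Finset (Ideal (𝓞 L)) := fun n ↦
    if n = 0 then ∅ else (Ideal.finite_setOfPred_absNorm_eq n).toFinset
  have hA : ∀ n, n ≠ 0 → ∀ I, I ∈ A n ↔ Ideal.absNorm I = n := by
    intro n hn I
    simp [A, hn]
  have h1 : ∑ n ∈ S, realZetaTerm L s n = ∑ I ∈ S.biUnion A, normPow (𝓞 L) s I := by
    rw [Finset.sum_biUnion]
    · refine Finset.sum_congr rfl fun n _ ↦ ?_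
      by_cases hn : n = 0
      · simp [A, hn, realZetaTerm]
      · rw [sum_normPow_fiber L s n hn (A n) (hA n hn)]
    · intro m _ n _ hmn
      refine Finset.disjoint_left.mpr fun I hm hn ↦ hmn ?_
      have hm0 : m ≠ 0 := by rintro rfl; simp [A] at hm
      have hn0 : n ≠ 0 := by rintro rfl; simp [A] at hn
      rw [← (hA m hm0 I).mp hm, (hA n hn0 I).mp hn]
  rw [h1]
  refine hB _ fun I hI h0 ↦ ?_
  obtain ⟨n, -, hn⟩ := Finset.mem_biUnion.mp hI
  have hn0 : n ≠ 0 := by rintro rfl; simp [A] at hn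
  rw [hA n hn0, h0] at hn
  simp at hn
  exact hn0 hn.symm

theorem normPow_nonneg (s : ℝ) (I : Ideal (𝓞 L)) : 0 ≤ normPow (𝓞 L) s I := by
  simp only [normPow, MonoidHom.coe_mk, OneHom.coe_mk]
  positivity

theorem normPow_lt_one {s : ℝ} (hs : 0 < s) {P : Ideal (𝓞 L)} (hP : Prime P) :
    normPow (𝓞 L) s P < 1 := by
  simp only [normPow, MonoidHom.coe_mk, OneHom.coe_mk]
  refine Real.rpow_lt_one_of_one_lt_of_neg ?_ (by linarith)
  have h0 : Ideal.absNorm P ≠ 0 := fun h ↦ hP.ne_zero (Ideal.absNorm_eq_zero_iff.mp h)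
  have h1 : Ideal.absNorm P ≠ 1 := fun h ↦
    hP.not_isUnit (Ideal.isUnit_iff.mpr (Ideal.absNorm_eq_one_iff.mp h))
  exact_mod_cast (by omega : 1 < Ideal.absNorm P)

theorem prod_euler_le {s : ℝ} (hs0 : 0 < s) (hs : Summable (realZetaTerm L s))
    (T : Finset (Ideal (𝓞 L))) (hT : ∀ P ∈ T, Prime P) :
    ∏ P ∈ T, (1 - normPow (𝓞 L) s P)⁻¹ ≤ ∑' n, realZetaTerm L s n := by
  have h : Filter.Tendsto (fun n ↦ ∏ P ∈ T, ∑ k ∈ Finset.range n, normPow (𝓞 L) s P ^ k)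
      Filter.atTop (nhds (∏ P ∈ T, (1 - normPow (𝓞 L) s P)⁻¹)) :=
    tendsto_finsetProd _ fun P hP ↦ (hasSum_geometric_of_lt_one (normPow_nonneg L s P)
      (normPow_lt_one L hs0 (hT P hP))).tendsto_sum_nat
  refine le_of_tendsto' h fun n ↦ ?_
  obtain ⟨A, hA, hsum⟩ := prod_geom_eq_sum_ideals (normPow (𝓞 L) s) T hT n
  rw [hsum]
  exact sum_normPow_le L s hs A fun I hI ↦ ((hA I).mp hI).1

theorem realZeta_le_of_prod_le {s B : ℝ} (hs0 : 0 < s)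
    (hB : ∀ T : Finset (Ideal (𝓞 L)), (∀ P ∈ T, Prime P) →
      ∏ P ∈ T, (1 - normPow (𝓞 L) s P)⁻¹ ≤ B) :
    ∑' n, realZetaTerm L s n ≤ B := by
  classical
  refine tsum_realZetaTerm_le L s B fun A hA ↦ ?_
  let T := A.biUnion fun I ↦ (UniqueFactorizationMonoid.normalizedFactors I).toFinset
  have hT : ∀ P ∈ T, Prime P := by
    intro P hP
    obtain ⟨I, -, hI⟩ := Finset.mem_biUnion.mp hP
    exact UniqueFactorizationMonoid.prime_of_normalized_factor P (Multiset.mem_toFinset.mp hI)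
  let n := ∑ I ∈ A, Multiset.card (UniqueFactorizationMonoid.normalizedFactors I) + 1
  obtain ⟨A', hA', hsum⟩ := prod_geom_eq_sum_ideals (normPow (𝓞 L) s) T hT n
  calc ∑ I ∈ A, normPow (𝓞 L) s I ≤ ∑ I ∈ A', normPow (𝓞 L) s I := by
        refine Finset.sum_le_sum_of_subset_of_nonneg ?_ fun I _ _ ↦ normPow_nonneg L s I
        intro I hI
        rw [hA']
        refine ⟨hA I hI, fun P hP ↦ Finset.mem_biUnion.mpr ⟨I, hI, Multiset.mem_toFinset.mpr hP⟩, ?_⟩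
        intro P _
        refine Nat.lt_succ_of_le ((Multiset.count_le_card _ _).trans ?_)
        exact Finset.single_le_sum (f := fun I ↦
          Multiset.card (UniqueFactorizationMonoid.normalizedFactors I)) (fun _ _ ↦ Nat.zero_le _) hI
    _ = ∏ P ∈ T, ∑ k ∈ Finset.range n, normPow (𝓞 L) s P ^ k := hsum.symm
    _ ≤ ∏ P ∈ T, (1 - normPow (𝓞 L) s P)⁻¹ := by
        refine Finset.prod_le_prod (fun P _ ↦ Finset.sum_nonneg fun k _ ↦
          pow_nonneg (normPow_nonneg L s P) k) fun P hP ↦ ?_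
        have := hasSum_geometric_of_lt_one (normPow_nonneg L s P) (normPow_lt_one L hs0 (hT P hP))
        exact sum_le_hasSum _ (fun k _ ↦ pow_nonneg (normPow_nonneg L s P) k) this
    _ ≤ B := hB T hT

end EulerProduct

section BadPrimes

variable (L : Type*) [Field L] [NumberField L]

theorem exists_nat_prime_under (P : Ideal (𝓞 L)) (hP : Prime P) :
    ∃ p : ℕ, p.Prime ∧ P.LiesOver (Ideal.span {(p : ℤ)}) := by
  have hP' : P.IsPrime := Ideal.isPrime_of_prime hP
  have h1 : (P.under ℤ).IsPrime := inferInstance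
  have h0 : P.under ℤ ≠ ⊥ := by
    intro h
    exact hP.ne_zero (Ideal.eq_bot_of_comap_eq_bot h)
  have h2 := Int.ideal_span_absNorm_eq_self (P.under ℤ)
  refine ⟨Ideal.absNorm (P.under ℤ), ?_, ?_⟩
  · rw [Nat.prime_iff_prime_int, ← Ideal.span_singleton_prime, h2]
    · exact h1
    · simpa [Ideal.absNorm_eq_zero_iff] using h0
  · rw [h2]; infer_instance

/-- The rational prime below a prime ideal. -/
noncomputable def primeBelow (P : Ideal (𝓞 L)) : ℕ := by
  classical
  exact if hP : Prime P then (exists_nat_prime_under L P hP).choose else 0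

theorem primeBelow_spec {P : Ideal (𝓞 L)} (hP : Prime P) :
    (primeBelow L P).Prime ∧ P.LiesOver (Ideal.span {(primeBelow L P : ℤ)}) := by
  rw [primeBelow, dif_pos hP]
  exact (exists_nat_prime_under L P hP).choose_spec

theorem sq_primeBelow_le {P : Ideal (𝓞 L)} (hP : Prime P) (hN : ¬ (Ideal.absNorm P).Prime) :
    primeBelow L P ^ 2 ≤ Ideal.absNorm P := by
  obtain ⟨hp, hl⟩ := primeBelow_spec L hP
  have h := Ideal.absNorm_eq_pow_inertiaDeg' P hp
  have h1 : Ideal.absNorm P ≠ 1 := fun h ↦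
    hP.not_isUnit (Ideal.isUnit_iff.mpr (Ideal.absNorm_eq_one_iff.mp h))
  rw [h] at h1 hN ⊢
  refine Nat.pow_le_pow_right hp.pos ?_
  by_contra hlt
  interval_cases hf : (Ideal.span {(primeBelow L P : ℤ)}).inertiaDeg' P
  · simp at h1
  · simp [hp] at hN

theorem card_primeBelow_fiber_le (T : Finset (Ideal (𝓞 L))) (hT : ∀ P ∈ T, Prime P) (p : ℕ) :
    (T.filter fun P ↦ primeBelow L P = p).card ≤ Module.finrank ℚ L := by
  classical
  by_cases hp : p.Prime
  · have hpp : Prime (p : ℤ) := Nat.prime_iff_prime_int.mp hp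
    have h0 : Ideal.span {(p : ℤ)} ≠ ⊥ := by simpa using hp.ne_zero
    have hprime : (Ideal.span {(p : ℤ)}).IsPrime :=
      (Ideal.span_singleton_prime hpp.ne_zero).mpr hpp
    have : (Ideal.span {(p : ℤ)}).IsMaximal := hprime.isMaximal h0
    refine le_trans (Finset.card_le_card ?_)
      (Ideal.card_primesOverFinset_le_finrank (R := ℤ) (S := 𝓞 L) ℚ L h0)
    intro P hP
    obtain ⟨hPT, rfl⟩ := Finset.mem_filter.mp hP
    rw [IsDedekindDomain.mem_primesOverFinset_iff h0]
    exact ⟨Ideal.isPrime_of_prime (hT P hPT), (primeBelow_spec L (hT P hPT)).2⟩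
  · rw [Finset.card_eq_zero.mpr]
    · exact Nat.zero_le _
    · refine Finset.filter_eq_empty_iff.mpr fun P hP h ↦ hp (h ▸ (primeBelow_spec L (hT P hP)).1)

theorem normPow_le_half {s : ℝ} (hs : 1 ≤ s) {P : Ideal (𝓞 L)} (hP : Prime P) :
    normPow (𝓞 L) s P ≤ 1 / 2 ∧ normPow (𝓞 L) s P ≤ ((Ideal.absNorm P : ℝ))⁻¹ := by
  have h0 : Ideal.absNorm P ≠ 0 := fun h ↦ hP.ne_zero (Ideal.absNorm_eq_zero_iff.mp h)
  have h1 : Ideal.absNorm P ≠ 1 := fun h ↦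
    hP.not_isUnit (Ideal.isUnit_iff.mpr (Ideal.absNorm_eq_one_iff.mp h))
  have h2 : (2 : ℝ) ≤ Ideal.absNorm P := by exact_mod_cast (by omega : 2 ≤ Ideal.absNorm P)
  have h3 : normPow (𝓞 L) s P ≤ ((Ideal.absNorm P : ℝ))⁻¹ := by
    simp only [normPow, MonoidHom.coe_mk, OneHom.coe_mk]
    rw [← Real.rpow_neg_one]
    exact Real.rpow_le_rpow_of_exponent_le (by linarith) (by linarith)
  refine ⟨h3.trans ?_, h3⟩
  rw [one_div]
  exact inv_anti₀ (by norm_num) h2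

theorem exists_bound_bad_primes (S : Finset (Ideal (𝓞 L))) :
    ∃ C : ℝ, ∀ s : ℝ, 1 ≤ s → ∀ T : Finset (Ideal (𝓞 L)),
      (∀ P ∈ T, Prime P ∧ (P ∈ S ∨ ¬ (Ideal.absNorm P).Prime)) →
      ∏ P ∈ T, (1 - normPow (𝓞 L) s P)⁻¹ ≤ C := by
  classical
  have hsum : Summable fun n : ℕ ↦ ((n : ℝ) ^ 2)⁻¹ := Real.summable_nat_pow_inv.mpr one_lt_two
  refine ⟨Real.exp (2 * (S.card + Module.finrank ℚ L * ∑' n : ℕ, ((n : ℝ) ^ 2)⁻¹)), ?_⟩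
  intro s hs T hT
  have hT' : ∀ P ∈ T, Prime P := fun P hP ↦ (hT P hP).1
  have h1 : ∏ P ∈ T, (1 - normPow (𝓞 L) s P)⁻¹ ≤ ∏ P ∈ T, Real.exp (2 * normPow (𝓞 L) s P) := by
    refine Finset.prod_le_prod (fun P hP ↦ ?_) fun P hP ↦ ?_
    · have := (normPow_le_half L hs (hT' P hP)).1
      exact inv_nonneg.mpr (by linarith)
    · have h2 := (normPow_le_half L hs (hT' P hP)).1
      have h3 := normPow_nonneg L s P
      have h4 := Real.add_one_le_exp (2 * normPow (𝓞 L) s P)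
      refine le_trans ?_ h4
      rw [inv_le_iff_one_le_mul₀ (by linarith)]
      nlinarith
  refine h1.trans ?_
  rw [← Real.exp_sum, ← Finset.mul_sum]
  refine Real.exp_le_exp.mpr (mul_le_mul_of_nonneg_left ?_ (by norm_num))
  rw [← Finset.sum_filter_add_sum_filter_not T (fun P ↦ P ∈ S)]
  refine add_le_add ?_ ?_
  · refine (Finset.sum_le_card_nsmul _ _ 1 fun P hP ↦ ?_).trans ?_
    · have := (normPow_le_half L hs (hT' P (Finset.mem_filter.mp hP).1)).1
      linarith
    · rw [nsmul_eq_mul, mul_one]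
      exact_mod_cast Finset.card_le_card fun P hP ↦ (Finset.mem_filter.mp hP).2
  · set T' := T.filter fun P ↦ P ∉ S with hT'def
    have hb : ∀ P ∈ T', Prime P ∧ ¬ (Ideal.absNorm P).Prime := by
      intro P hP
      obtain ⟨h, h'⟩ := Finset.mem_filter.mp hP
      exact ⟨hT' P h, (hT P h).2.resolve_left h'⟩
    calc ∑ P ∈ T', normPow (𝓞 L) s P ≤ ∑ P ∈ T', ((primeBelow L P : ℝ) ^ 2)⁻¹ := by
          refine Finset.sum_le_sum fun P hP ↦ ?_
          refine (normPow_le_half L hs (hb P hP).1).2.trans ?_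
          have hpos : (0 : ℝ) < primeBelow L P :=
            Nat.cast_pos.mpr (primeBelow_spec L (hb P hP).1).1.pos
          refine inv_anti₀ (by positivity) ?_
          exact_mod_cast sq_primeBelow_le L (hb P hP).1 (hb P hP).2
      _ = ∑ n ∈ T'.image (primeBelow L), ∑ P ∈ T'.filter (fun P ↦ primeBelow L P = n),
            ((primeBelow L P : ℝ) ^ 2)⁻¹ :=
          (Finset.sum_fiberwise_of_maps_to (fun P hP ↦ Finset.mem_image_of_mem _ hP) _).symm
      _ ≤ ∑ n ∈ T'.image (primeBelow L), (Module.finrank ℚ L : ℝ) * ((n : ℝ) ^ 2)⁻¹ := by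
          refine Finset.sum_le_sum fun n _ ↦ ?_
          rw [Finset.sum_congr rfl (g := fun _ ↦ ((n : ℝ) ^ 2)⁻¹)
            (fun P hP ↦ by rw [(Finset.mem_filter.mp hP).2]), Finset.sum_const, nsmul_eq_mul]
          refine mul_le_mul_of_nonneg_right ?_ (by positivity)
          exact_mod_cast card_primeBelow_fiber_le L T' (fun P hP ↦ (hb P hP).1) n
      _ ≤ Module.finrank ℚ L * ∑' n : ℕ, ((n : ℝ) ^ 2)⁻¹ := by
          rw [← Finset.mul_sum]
          exact mul_le_mul_of_nonneg_left
            (hsum.sum_le_tsum _ fun n _ ↦ by positivity) (by positivity)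

end BadPrimes

section Split

variable {E K : Type*} [Field E] [NumberField E] [Field K] [NumberField K] [Algebra E K]

theorem exists_two_primes_over (h2 : Module.finrank E K = 2) (δ : 𝓞 E) (w : 𝓞 K)
    (hw : w ^ 2 = algebraMap (𝓞 E) (𝓞 K) δ) (τ : 𝓞 K ≃ₐ[𝓞 E] 𝓞 K) (hτ : τ w = -w)
    (P : Ideal (𝓞 E)) (hP : Prime P) (hδ : δ ∉ P) (hP2 : (2 : 𝓞 E) ∉ P) (r : 𝓞 E)
    (hr : r ^ 2 - δ ∈ P) :
    ∃ Q₁ Q₂ : Ideal (𝓞 K), Q₁ ≠ Q₂ ∧ ∀ Q, Q = Q₁ ∨ Q = Q₂ →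
      Prime Q ∧ Ideal.absNorm Q = Ideal.absNorm P ∧
        Q.comap (algebraMap (𝓞 E) (𝓞 K)) = P := by
  classical
  have hP' : P.IsPrime := Ideal.isPrime_of_prime hP
  have hP0 : P ≠ ⊥ := hP.ne_zero
  have hPm : P.IsMaximal := hP'.isMaximal hP0
  obtain ⟨Q₁, hQ₁m, hQ₁⟩ := Ideal.exists_maximal_ideal_liesOver_of_isIntegral (S := 𝓞 K) P
  have hQ₁p : Q₁.IsPrime := hQ₁m.isPrime
  have hmem : ∀ x : 𝓞 E, algebraMap (𝓞 E) (𝓞 K) x ∈ Q₁ ↔ x ∈ P := fun x ↦ by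
    rw [Ideal.mem_of_liesOver Q₁ P x]
  let Q₂ := Q₁.comap (τ : 𝓞 K →+* 𝓞 K)
  have hQ₂p : Q₂.IsPrime := Ideal.comap_isPrime _ _
  have hQ₂ : Q₂.LiesOver P := by
    constructor
    ext x
    rw [Ideal.under_def, Ideal.mem_comap, Ideal.mem_comap, ← hmem]
    simp
  have hne : Q₁ ≠ Q₂ := by
    intro h
    have hh : ∀ x, x ∈ Q₁ ↔ τ x ∈ Q₁ := fun x ↦ by
      conv_lhs => rw [h]
      exact Ideal.mem_comap
    have h1 : (w - algebraMap _ _ r) * (w + algebraMap _ _ r) ∈ Q₁ := by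
      have : (w - algebraMap _ _ r) * (w + algebraMap _ _ r)
          = - algebraMap (𝓞 E) (𝓞 K) (r ^ 2 - δ) := by
        rw [map_sub, map_pow, ← hw]; ring
      rw [this]
      exact neg_mem ((hmem _).mpr hr)
    have h2r : algebraMap (𝓞 E) (𝓞 K) (2 * r) ∈ Q₁ := by
      rcases hQ₁p.mem_or_mem h1 with h1 | h1
      · have h3 := (hh _).mp h1
        rw [map_sub, hτ, AlgEquiv.commutes] at h3
        have := neg_mem (add_mem h1 h3)
        convert this using 1
        rw [map_mul, map_ofNat]; ring
      · have h3 := (hh _).mp h1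
        rw [map_add, hτ, AlgEquiv.commutes] at h3
        have := add_mem h1 h3
        convert this using 1
        rw [map_mul, map_ofNat]; ring
    rw [hmem] at h2r
    rcases hP'.mem_or_mem h2r with h3 | h3
    · exact hP2 h3
    · exact hδ (by simpa using sub_mem (P.pow_mem_of_mem h3 2 two_pos) hr)
  have hsum := Ideal.sum_ramification_inertia (𝓞 K) E K hP0
  rw [h2] at hsum
  have hm₁ : Q₁ ∈ IsDedekindDomain.primesOverFinset P (𝓞 K) :=
    (IsDedekindDomain.mem_primesOverFinset_iff hP0 _).mpr ⟨hQ₁p, hQ₁⟩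
  have hm₂ : Q₂ ∈ IsDedekindDomain.primesOverFinset P (𝓞 K) :=
    (IsDedekindDomain.mem_primesOverFinset_iff hP0 _).mpr ⟨hQ₂p, hQ₂⟩
  have hle : ∑ Q ∈ {Q₁, Q₂}, P.ramificationIdx' Q * P.inertiaDeg' Q ≤ 2 := by
    rw [← hsum]
    refine Finset.sum_le_sum_of_subset ?_
    intro Q hQ
    rcases Finset.mem_insert.mp hQ with rfl | hQ
    · exact hm₁
    · rw [Finset.mem_singleton.mp hQ]; exact hm₂
  rw [Finset.sum_pair hne] at hle
  have e₁ := Nat.pos_of_ne_zero (Ideal.IsDedekindDomain.ramificationIdx'_ne_zero_of_liesOver Q₁ hP0)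
  have e₂ := Nat.pos_of_ne_zero (Ideal.IsDedekindDomain.ramificationIdx'_ne_zero_of_liesOver Q₂ hP0)
  have f₁ := Nat.pos_of_ne_zero (Ideal.inertiaDeg'_ne_zero P Q₁)
  have f₂ := Nat.pos_of_ne_zero (Ideal.inertiaDeg'_ne_zero P Q₂)
  have n₁ := Ideal.absNorm_eq_pow_inertiaDeg'_of_liesOver Q₁ P hP' hP0
  have n₂ := Ideal.absNorm_eq_pow_inertiaDeg'_of_liesOver Q₂ P hP' hP0
  have g₁ : P.inertiaDeg' Q₁ = 1 := by nlinarith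
  have g₂ : P.inertiaDeg' Q₂ = 1 := by nlinarith
  rw [g₁, pow_one] at n₁
  rw [g₂, pow_one] at n₂
  refine ⟨Q₁, Q₂, hne, ?_⟩
  rintro Q (rfl | rfl)
  · exact ⟨Ideal.prime_of_isPrime (Ideal.ne_bot_of_liesOver_of_ne_bot hP0 _) hQ₁p, n₁,
      hQ₁.over.symm⟩
  · exact ⟨Ideal.prime_of_isPrime (Ideal.ne_bot_of_liesOver_of_ne_bot hP0 _) hQ₂p, n₂,
      hQ₂.over.symm⟩

/-- Adjoining a square root of a nonsquare gives a quadratic number field. -/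
theorem exists_quadratic_extension.{u} (E : Type u) [Field E] [NumberField E] (δ : 𝓞 E)
    (hδ : ¬ IsSquare (δ : E)) :
    ∃ (K : Type u) (_ : Field K) (_ : NumberField K) (_ : Algebra E K)
      (w : 𝓞 K) (τ : 𝓞 K ≃ₐ[𝓞 E] 𝓞 K), Module.finrank E K = 2 ∧
        w ^ 2 = algebraMap (𝓞 E) (𝓞 K) δ ∧ τ w = -w := by
  let f : Polynomial E := Polynomial.X ^ 2 - Polynomial.C (δ : E)
  have hf : Irreducible f := by
    refine X_pow_sub_C_irreducible_of_prime Nat.prime_two fun b hb ↦ hδ ⟨b, ?_⟩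
    rw [← hb, sq]
  have : Fact (Irreducible f) := ⟨hf⟩
  have hmonic : f.Monic := Polynomial.monic_X_pow_sub_C _ two_ne_zero
  have hdeg : f.natDegree = 2 := Polynomial.natDegree_X_pow_sub_C
  let K := AdjoinRoot f
  have hpb := AdjoinRoot.powerBasis hf.ne_zero
  have hfin : FiniteDimensional E K := (AdjoinRoot.powerBasis hf.ne_zero).finite
  have : CharZero K := charZero_of_injective_algebraMap (algebraMap E K).injective
  have : FiniteDimensional ℚ K := FiniteDimensional.trans ℚ E K
  have : NumberField K := ⟨⟩
  have hroot : (AdjoinRoot.root f) ^ 2 = algebraMap E K δ := by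
    have := AdjoinRoot.eval₂_root f
    simp only [f, Polynomial.eval₂_sub, Polynomial.eval₂_X_pow, Polynomial.eval₂_C] at this
    exact sub_eq_zero.mp this
  let φ : K →ₐ[E] K := AdjoinRoot.liftAlgHom f (Algebra.ofId E K) (-AdjoinRoot.root f) (by
    simp only [f, Polynomial.eval₂_sub, Polynomial.eval₂_X_pow, Polynomial.eval₂_C, neg_sq, hroot]
    exact sub_self _)
  have hφ : φ (AdjoinRoot.root f) = -AdjoinRoot.root f := by
    exact AdjoinRoot.liftAlgHom_root _ _ _ _
  let e : K ≃ₐ[E] K := AlgEquiv.ofBijective φ φ.bijective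
  have hint : IsIntegral ℤ (AdjoinRoot.root f) := by
    refine IsIntegral.of_pow (n := 2) two_pos ?_
    rw [hroot]
    exact (RingOfIntegers.isIntegral_coe δ).algebraMap
  refine ⟨K, inferInstance, inferInstance, inferInstance, ⟨AdjoinRoot.root f, hint⟩,
    RingOfIntegers.mapAlgEquiv e, ?_, ?_, ?_⟩
  · rw [(AdjoinRoot.powerBasis hf.ne_zero).finrank, AdjoinRoot.powerBasis_dim, hdeg]
  · refine RingOfIntegers.ext ?_
    exact hroot
  · refine RingOfIntegers.ext ?_
    exact hφ

theorem sq_prod_euler_le (E K : Type*) [Field E] [NumberField E] [Field K] [NumberField K]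
    [Algebra E K] {s : ℝ} (hs0 : 0 < s) (hs : Summable (realZetaTerm K s))
    (T : Finset (Ideal (𝓞 E)))
    (hT2 : ∀ P ∈ T, ∃ Q₁ Q₂ : Ideal (𝓞 K), Q₁ ≠ Q₂ ∧ ∀ Q, Q = Q₁ ∨ Q = Q₂ →
      Prime Q ∧ Ideal.absNorm Q = Ideal.absNorm P ∧
        Q.comap (algebraMap (𝓞 E) (𝓞 K)) = P) :
    (∏ P ∈ T, (1 - normPow (𝓞 E) s P)⁻¹) ^ 2 ≤ ∑' n, realZetaTerm K s n := by
  classical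
  choose! q₁ q₂ hne hq using hT2
  let T' := T.biUnion fun P ↦ {q₁ P, q₂ P}
  have hT' : ∀ Q ∈ T', Prime Q := by
    intro Q hQ
    obtain ⟨P, hP, hQ⟩ := Finset.mem_biUnion.mp hQ
    exact (hq P hP Q (by simpa using hQ)).1
  refine le_trans (le_of_eq ?_) (prod_euler_le K hs0 hs T' hT')
  rw [Finset.prod_biUnion, ← Finset.prod_pow]
  · refine Finset.prod_congr rfl fun P hP ↦ ?_
    rw [Finset.prod_pair (hne P hP), sq]
    have h : ∀ Q, Q = q₁ P ∨ Q = q₂ P → normPow (𝓞 K) s Q = normPow (𝓞 E) s P := by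
      intro Q hQ
      simp only [normPow, MonoidHom.coe_mk, OneHom.coe_mk, (hq P hP Q hQ).2.1]
    rw [h _ (Or.inl rfl), h _ (Or.inr rfl)]
  · intro P hP P' hP' hPP'
    refine Finset.disjoint_left.mpr fun Q h h' ↦ hPP' ?_
    rw [← (hq P hP Q (by simpa using h)).2.2, (hq P' hP' Q (by simpa using h')).2.2]

/-- An integer of a number field which is a square modulo all but finitely many primes of prime
norm is a square. -/
theorem isSquare_of_forall_prime_norm (E : Type*) [Field E] [NumberField E] (δ : 𝓞 E)
    (hδ : δ ≠ 0) (S : Finset (Ideal (𝓞 E)))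
    (h : ∀ P : Ideal (𝓞 E), Prime P → (Ideal.absNorm P).Prime → P ∉ S →
      ∃ r, r ^ 2 - δ ∈ P) : IsSquare (δ : E) := by
  classical
  by_contra hns
  obtain ⟨K, _, _, _, w, τ, h2, hw, hτ⟩ := exists_quadratic_extension E δ hns
  have hfac : ∀ x : 𝓞 E, x ≠ 0 → {P : Ideal (𝓞 E) | Prime P ∧ x ∈ P}.Finite := by
    intro x hx
    refine (UniqueFactorizationMonoid.primeFactors (Ideal.span {x})).finite_toSet.subset ?_
    rintro P ⟨hP, hxP⟩
    have h0 : Ideal.span {x} ≠ 0 := by simpa using hx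
    simp only [Finset.mem_coe, UniqueFactorizationMonoid.mem_primeFactors]
    obtain ⟨q, hq, hPq⟩ := UniqueFactorizationMonoid.exists_mem_normalizedFactors_of_dvd h0
      hP.irreducible (Ideal.dvd_span_singleton.mpr hxP)
    rwa [associated_iff_eq.mp hPq]
  let S' : Finset (Ideal (𝓞 E)) := S ∪ (hfac δ hδ).toFinset ∪ (hfac 2 two_ne_zero).toFinset
  obtain ⟨C, hC⟩ := exists_bound_bad_primes E S'
  have hC0 : 0 ≤ C := by
    have := hC 1 le_rfl ∅ (by simp)
    simp at this
    linarith
  have hmain : ∀ᶠ s in nhdsWithin (1 : ℝ) (Set.Ioi 1),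
      ((s - 1) * ∑' n, realZetaTerm E s n) ^ 2 ≤
        C ^ 2 * (s - 1) * ((s - 1) * ∑' n, realZetaTerm K s n) := by
    filter_upwards [eventually_summable_realZeta K, self_mem_nhdsWithin] with s hsum hs
    have hs1 : (1 : ℝ) < s := hs
    have hs0 : 0 < s := by linarith
    have hK0 : 0 ≤ ∑' n, realZetaTerm K s n := tsum_nonneg (realZetaTerm_nonneg K s)
    have hle : ∑' n, realZetaTerm E s n ≤ C * √(∑' n, realZetaTerm K s n) := by
      refine realZeta_le_of_prod_le E hs0 fun T hT ↦ ?_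
      rw [← Finset.prod_filter_mul_prod_filter_not T
        (fun P ↦ P ∈ S' ∨ ¬ (Ideal.absNorm P).Prime)]
      have hpos : ∀ T' ⊆ T, 0 ≤ ∏ P ∈ T', (1 - normPow (𝓞 E) s P)⁻¹ := fun T' hT' ↦
        Finset.prod_nonneg fun P hP ↦ inv_nonneg.mpr
          (sub_nonneg.mpr (normPow_lt_one E hs0 (hT P (hT' hP))).le)
      refine mul_le_mul (hC s hs1.le _ fun P hP ↦ ?_) ?_ (hpos _ (Finset.filter_subset _ _)) hC0
      · obtain ⟨h1, h2⟩ := Finset.mem_filter.mp hP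
        exact ⟨hT P h1, h2⟩
      · refine Real.le_sqrt_of_sq_le (sq_prod_euler_le E K hs0 hsum _ fun P hP ↦ ?_)
        obtain ⟨h1, h3⟩ := Finset.mem_filter.mp hP
        push Not at h3
        have hPp := hT P h1
        have hPS : P ∉ S ∧ δ ∉ P ∧ (2 : 𝓞 E) ∉ P := by
          have := h3.1
          simp only [S', Finset.mem_union, Set.Finite.mem_toFinset, Set.mem_ofPred_eq, hPp,
            true_and] at this
          tauto
        obtain ⟨r, hr⟩ := h P hPp h3.2 hPS.1
        exact exists_two_primes_over h2 δ w hw τ hτ P hPp hPS.2.1 hPS.2.2 r hr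
    have hE0 : 0 ≤ ∑' n, realZetaTerm E s n := tsum_nonneg (realZetaTerm_nonneg E s)
    calc ((s - 1) * ∑' n, realZetaTerm E s n) ^ 2
        = (s - 1) ^ 2 * (∑' n, realZetaTerm E s n) ^ 2 := by ring
      _ ≤ (s - 1) ^ 2 * (C * √(∑' n, realZetaTerm K s n)) ^ 2 := by gcongr
      _ = C ^ 2 * (s - 1) * ((s - 1) * ∑' n, realZetaTerm K s n) := by
          rw [mul_pow, Real.sq_sqrt hK0]; ring
  have hlim : Filter.Tendsto (fun s : ℝ ↦ C ^ 2 * (s - 1) * ((s - 1) * ∑' n, realZetaTerm K s n))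
      (nhdsWithin 1 (Set.Ioi 1)) (nhds (C ^ 2 * (1 - 1) * dedekindZeta_residue K)) := by
    refine Filter.Tendsto.mul ?_ (tendsto_realZeta K)
    have : Continuous fun s : ℝ ↦ C ^ 2 * (s - 1) := by fun_prop
    exact (this.tendsto 1).mono_left nhdsWithin_le_nhds
  have := le_of_tendsto_of_tendsto ((tendsto_realZeta E).pow 2) hlim hmain
  have hp := dedekindZeta_residue_pos E
  simp only [sub_self, mul_zero, zero_mul] at this
  nlinarith

end Split

section Mean

variable {G G' : Type*} [AddCommGroup G] [AddCommGroup G']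

/-- The group of periods of a function. -/
def periods (f : G → ℂ) : AddSubgroup G where
  carrier := {t | ∀ x, f (x + t) = f x}
  zero_mem' := fun x ↦ by rw [add_zero]
  add_mem' := fun {a b} ha hb x ↦ by rw [← add_assoc, hb, ha]
  neg_mem' := fun {a} ha x ↦ by rw [← ha (x + -a), neg_add_cancel_right]

/-- The average value of a function with a finite-index group of periods. -/
noncomputable def mean (f : G → ℂ) : ℂ :=
  (∑ᶠ q : G ⧸ periods f, f q.out) / (Nat.card (G ⧸ periods f) : ℂ)

/-- A function with a finite-index group of periods. -/
def FinPer (f : G → ℂ) : Prop := (periods f).FiniteIndex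

theorem FinPer.of_le {f : G → ℂ} (P : AddSubgroup G) [P.FiniteIndex]
    (h : ∀ t ∈ P, ∀ x, f (x + t) = f x) : FinPer f :=
  AddSubgroup.finiteIndex_of_le (H := P) fun t ht ↦ h t ht

theorem FinPer.of_surj {H : Type*} [AddCommGroup H] [Finite H] (π : G →+ H) (F : H → ℂ)
    {f : G → ℂ} (hf : ∀ g, f g = F (π g)) : FinPer f :=
  FinPer.of_le π.ker fun t ht x ↦ by rw [hf, hf, map_add, (AddMonoidHom.mem_ker).mp ht, add_zero]

theorem finiteIndex_comap (φ : G →+ G') (P : AddSubgroup G') [P.FiniteIndex] :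
    (P.comap φ).FiniteIndex := by
  have h : P.comap φ = ((QuotientAddGroup.mk' P).comp φ).ker := by
    ext x
    simp [AddMonoidHom.mem_ker]
  rw [h]
  exact AddSubgroup.finiteIndex_ker _

theorem apply_out_eq (f : G → ℂ) (g : G) : f (g : G ⧸ periods f).out = f g := by
  have h : (((g : G ⧸ periods f).out : G) : G ⧸ periods f) = g := QuotientAddGroup.out_eq' _
  have h2 := QuotientAddGroup.eq.mp h.symm
  have := h2 g
  rwa [add_neg_cancel_left] at this

theorem mean_eq_of_surj {H : Type*} [AddCommGroup H] [Fintype H] (π : G →+ H)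
    (hπ : Function.Surjective π) (F : H → ℂ) {f : G → ℂ} (hf : ∀ g, f g = F (π g)) :
    mean f = (∑ h, F h) / (Fintype.card H : ℂ) := by
  classical
  have hfin : (periods f).FiniteIndex := FinPer.of_surj π F hf
  have : Fintype (G ⧸ periods f) := Fintype.ofFinite _
  have h1 : ∑ h : H, ∑ q : G ⧸ periods f, F (h + π q.out)
      = Fintype.card H * ∑ q : G ⧸ periods f, f q.out := by
    rw [Finset.sum_congr rfl (g := fun _ ↦ ∑ q : G ⧸ periods f, f q.out)]
    · simp
    · intro h _
      obtain ⟨g, rfl⟩ := hπ h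
      refine Fintype.sum_equiv (Equiv.addLeft (g : G ⧸ periods f)) _ _ fun q ↦ ?_
      have h3 : (g : G ⧸ periods f) + q = ((g + q.out : G) : G ⧸ periods f) := by
        rw [QuotientAddGroup.mk_add, QuotientAddGroup.out_eq']
      rw [← map_add, ← hf]
      change _ = f ((g : G ⧸ periods f) + q).out
      rw [h3]
      exact (apply_out_eq f _).symm
  have h2 : ∑ h : H, ∑ q : G ⧸ periods f, F (h + π q.out)
      = Fintype.card (G ⧸ periods f) * ∑ h, F h := by
    rw [Finset.sum_comm, Finset.sum_congr rfl (g := fun _ ↦ ∑ h, F h)]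
    · simp
    · intro q _
      exact Fintype.sum_equiv (Equiv.addRight (π q.out)) _ _ fun h ↦ rfl
  rw [mean, finsum_eq_sum_of_fintype, Nat.card_eq_fintype_card, div_eq_div_iff]
  · rw [mul_comm, ← h1, h2, mul_comm]
  · exact_mod_cast Fintype.card_ne_zero
  · exact_mod_cast Fintype.card_ne_zero

theorem mean_comp {f : G' → ℂ} (hf : FinPer f) (φ : G →+ G') (hφ : φ.range ⊔ periods f = ⊤) :
    mean (fun x ↦ f (φ x)) = mean f := by
  have : (periods f).FiniteIndex := hf
  have : Fintype (G' ⧸ periods f) := Fintype.ofFinite _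
  rw [mean_eq_of_surj (QuotientAddGroup.mk' (periods f)) (QuotientAddGroup.mk'_surjective _)
    (fun q ↦ f q.out) (fun g ↦ (apply_out_eq f g).symm),
    mean_eq_of_surj ((QuotientAddGroup.mk' (periods f)).comp φ) ?_
    (fun q ↦ f q.out) (fun g ↦ (apply_out_eq f (φ g)).symm)]
  intro q
  obtain ⟨y, rfl⟩ := QuotientAddGroup.mk'_surjective _ q
  have hy : y ∈ φ.range ⊔ periods f := hφ ▸ AddSubgroup.mem_top y
  obtain ⟨_, ⟨x, rfl⟩, t, ht, rfl⟩ := AddSubgroup.mem_sup.mp hy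
  refine ⟨x, ?_⟩
  simp only [AddMonoidHom.comp_apply, QuotientAddGroup.mk'_apply]
  rw [QuotientAddGroup.eq]
  simpa using ht

theorem FinPer.comp {f : G' → ℂ} (hf : FinPer f) (φ : G →+ G') : FinPer fun x ↦ f (φ x) := by
  have : (periods f).FiniteIndex := hf
  exact FinPer.of_surj ((QuotientAddGroup.mk' (periods f)).comp φ)
    (fun q ↦ f q.out) (fun g ↦ (apply_out_eq f (φ g)).symm)

theorem mean_comp_surj {f : G' → ℂ} (hf : FinPer f) (φ : G →+ G') (hφ : Function.Surjective φ) :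
    mean (fun x ↦ f (φ x)) = mean f :=
  mean_comp hf φ (by rw [AddMonoidHom.range_eq_top.mpr hφ, top_sup_eq])

theorem mean_const (c : ℂ) : mean (fun _ : G ↦ c) = c := by
  rw [mean_eq_of_surj (0 : G →+ Unit) (fun _ ↦ ⟨0, rfl⟩) (fun _ ↦ c) (fun _ ↦ rfl)]
  simp

theorem FinPer.comp_left {f : G → ℂ} (hf : FinPer f) (k : ℂ → ℂ) : FinPer fun x ↦ k (f x) := by
  have : (periods f).FiniteIndex := hf
  exact FinPer.of_le (periods f) fun t ht x ↦ by rw [ht x]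

theorem FinPer.map₂ {f g : G → ℂ} (hf : FinPer f) (hg : FinPer g) (k : ℂ → ℂ → ℂ) :
    FinPer fun x ↦ k (f x) (g x) := by
  have : (periods f).FiniteIndex := hf
  have : (periods g).FiniteIndex := hg
  exact FinPer.of_le (periods f ⊓ periods g) fun t ht x ↦ by rw [ht.1 x, ht.2 x]

theorem FinPer.prod {f : G → ℂ} {g : G' → ℂ} (hf : FinPer f) (hg : FinPer g) :
    FinPer fun x : G × G' ↦ f x.1 * g x.2 :=
  (hf.comp (AddMonoidHom.fst G G')).map₂ (hg.comp (AddMonoidHom.snd G G')) (· * ·)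

theorem mean_const_mul {f : G → ℂ} (hf : FinPer f) (c : ℂ) :
    mean (fun x ↦ c * f x) = c * mean f := by
  have : (periods f).FiniteIndex := hf
  have : Fintype (G ⧸ periods f) := Fintype.ofFinite _
  rw [mean_eq_of_surj (QuotientAddGroup.mk' (periods f)) (QuotientAddGroup.mk'_surjective _)
    (fun q ↦ f q.out) (fun g ↦ (apply_out_eq f g).symm),
    mean_eq_of_surj (QuotientAddGroup.mk' (periods f)) (QuotientAddGroup.mk'_surjective _)
    (fun q ↦ c * f q.out) (fun g ↦ congrArg _ (apply_out_eq f g).symm), ← Finset.mul_sum,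
    mul_div_assoc]

theorem mean_conj {f : G → ℂ} (hf : FinPer f) :
    mean (fun x ↦ (starRingEnd ℂ) (f x)) = (starRingEnd ℂ) (mean f) := by
  have : (periods f).FiniteIndex := hf
  have : Fintype (G ⧸ periods f) := Fintype.ofFinite _
  rw [mean_eq_of_surj (QuotientAddGroup.mk' (periods f)) (QuotientAddGroup.mk'_surjective _)
    (fun q ↦ f q.out) (fun g ↦ (apply_out_eq f g).symm),
    mean_eq_of_surj (QuotientAddGroup.mk' (periods f)) (QuotientAddGroup.mk'_surjective _)
    (fun q ↦ (starRingEnd ℂ) (f q.out)) (fun g ↦ congrArg _ (apply_out_eq f g).symm)]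
  simp

theorem mean_translate {f : G → ℂ} (hf : FinPer f) (t : G) : mean (fun x ↦ f (x + t)) = mean f := by
  have : (periods f).FiniteIndex := hf
  have : Fintype (G ⧸ periods f) := Fintype.ofFinite _
  rw [mean_eq_of_surj (QuotientAddGroup.mk' (periods f)) (QuotientAddGroup.mk'_surjective _)
    (fun q ↦ f q.out) (fun g ↦ (apply_out_eq f g).symm),
    mean_eq_of_surj (QuotientAddGroup.mk' (periods f)) (QuotientAddGroup.mk'_surjective _)
    (fun q ↦ f (q + (t : G ⧸ periods f)).out) (fun g ↦ (apply_out_eq f (g + t)).symm)]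
  congr 1
  exact Fintype.sum_equiv (Equiv.addRight (t : G ⧸ periods f)) _ _ fun h ↦ rfl

theorem mean_eq_zero {f : G → ℂ} (hf : FinPer f) (t : G) (ω : ℂ) (hω : ω ≠ 1)
    (h : ∀ x, f (x + t) = ω * f x) : mean f = 0 := by
  have h1 := mean_translate hf t
  simp only [h] at h1
  rw [mean_const_mul hf] at h1
  have : (ω - 1) * mean f = 0 := by rw [sub_mul, h1]; ring
  exact (mul_eq_zero.mp this).resolve_left (sub_ne_zero.mpr hω)

theorem mean_prod {f : G × G' → ℂ} (hf : FinPer f) :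
    mean f = mean fun x ↦ mean fun y ↦ f (x, y) := by
  have : (periods f).FiniteIndex := hf
  let P := (periods f).comap (AddMonoidHom.inl G G')
  let Q := (periods f).comap (AddMonoidHom.inr G G')
  have : P.FiniteIndex := finiteIndex_comap _ _
  have : Q.FiniteIndex := finiteIndex_comap _ _
  have : Fintype (G ⧸ P) := Fintype.ofFinite _
  have : Fintype (G' ⧸ Q) := Fintype.ofFinite _
  have hP : ∀ t ∈ P, ∀ x y, f (x + t, y) = f (x, y) := fun t ht x y ↦ by
    have h : f ((x, y) + (t, 0)) = f (x, y) := ht (x, y)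
    simpa using h
  have hQ : ∀ t ∈ Q, ∀ x y, f (x, y + t) = f (x, y) := fun t ht x y ↦ by
    have h : f ((x, y) + (0, t)) = f (x, y) := ht (x, y)
    simpa using h
  have kP : ∀ x y, f (x, y) = f ((x : G ⧸ P).out, y) := fun x y ↦ by
    have h : (((x : G ⧸ P).out : G) : G ⧸ P) = x := QuotientAddGroup.out_eq' _
    have := hP _ (QuotientAddGroup.eq.mp h.symm) x y
    rw [add_neg_cancel_left] at this
    exact this.symm
  have kQ : ∀ x y, f (x, y) = f (x, (y : G' ⧸ Q).out) := fun x y ↦ by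
    have h : (((y : G' ⧸ Q).out : G') : G' ⧸ Q) = y := QuotientAddGroup.out_eq' _
    have := hQ _ (QuotientAddGroup.eq.mp h.symm) x y
    rw [add_neg_cancel_left] at this
    exact this.symm
  have h2 : ∀ x, (mean fun y ↦ f (x, y))
      = (∑ q : G' ⧸ Q, f (x, q.out)) / (Fintype.card (G' ⧸ Q) : ℂ) := fun x ↦
    mean_eq_of_surj (QuotientAddGroup.mk' Q) (QuotientAddGroup.mk'_surjective _)
      (fun q ↦ f (x, q.out)) (fun y ↦ kQ x y)
  simp only [h2]
  rw [mean_eq_of_surj (QuotientAddGroup.mk' P) (QuotientAddGroup.mk'_surjective _)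
    (fun p ↦ (∑ q : G' ⧸ Q, f (p.out, q.out)) / (Fintype.card (G' ⧸ Q) : ℂ))
    (fun x ↦ by simp only [kP x]; rfl)]
  rw [mean_eq_of_surj ((QuotientAddGroup.mk' P).prodMap (QuotientAddGroup.mk' Q))
    (by
      rintro ⟨p, q⟩
      obtain ⟨x, rfl⟩ := QuotientAddGroup.mk'_surjective _ p
      obtain ⟨y, rfl⟩ := QuotientAddGroup.mk'_surjective _ q
      exact ⟨(x, y), rfl⟩) (fun r ↦ f (r.1.out, r.2.out))
    (fun r ↦ by rw [← Prod.mk.eta (p := r), kP, kQ]; rfl)]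
  rw [Fintype.sum_prod_type, Fintype.card_prod, ← Finset.sum_div, div_div]
  push_cast
  rw [mul_comm (Fintype.card (G ⧸ P) : ℂ)]

theorem mean_mul_prod {f : G → ℂ} {g : G' → ℂ} (hf : FinPer f) (hg : FinPer g) :
    mean (fun x : G × G' ↦ f x.1 * g x.2) = mean f * mean g := by
  rw [mean_prod (hf.prod hg)]
  simp only [mean_const_mul hg]
  simp_rw [mul_comm _ (mean g)]
  rw [mean_const_mul hf]

/-- Two complex numbers which differ by a positive real factor. -/
def SamePhase (a b : ℂ) : Prop := ∃ c : ℝ, 0 < c ∧ a = c * b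

theorem SamePhase.refl (a : ℂ) : SamePhase a a := ⟨1, one_pos, by simp⟩

theorem SamePhase.symm {a b : ℂ} (h : SamePhase a b) : SamePhase b a := by
  obtain ⟨c, hc, rfl⟩ := h
  refine ⟨c⁻¹, inv_pos.mpr hc, ?_⟩
  rw [← mul_assoc, ← Complex.ofReal_mul, inv_mul_cancel₀ hc.ne', Complex.ofReal_one, one_mul]

theorem SamePhase.trans {a b d : ℂ} (h : SamePhase a b) (h' : SamePhase b d) : SamePhase a d := by
  obtain ⟨c, hc, rfl⟩ := h
  obtain ⟨c', hc', rfl⟩ := h'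
  exact ⟨c * c', mul_pos hc hc', by push_cast; ring⟩

theorem SamePhase.mul {a b a' b' : ℂ} (h : SamePhase a b) (h' : SamePhase a' b') :
    SamePhase (a * a') (b * b') := by
  obtain ⟨c, hc, rfl⟩ := h
  obtain ⟨c', hc', rfl⟩ := h'
  exact ⟨c * c', mul_pos hc hc', by push_cast; ring⟩

theorem SamePhase.conj {a b : ℂ} (h : SamePhase a b) :
    SamePhase (starRingEnd ℂ a) (starRingEnd ℂ b) := by
  obtain ⟨c, hc, rfl⟩ := h
  exact ⟨c, hc, by simp⟩

theorem SamePhase.ne_zero {a b : ℂ} (h : SamePhase a b) (hb : b ≠ 0) : a ≠ 0 := by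
  obtain ⟨c, hc, rfl⟩ := h
  exact mul_ne_zero (by exact_mod_cast hc.ne') hb

theorem SamePhase.mul_conj {a : ℂ} (ha : a ≠ 0) : SamePhase (a * starRingEnd ℂ a) 1 := by
  refine ⟨Complex.normSq a, Complex.normSq_pos.mpr ha, ?_⟩
  rw [Complex.mul_conj, mul_one]

theorem SamePhase.not_neg {a : ℂ} (ha : a ≠ 0) : ¬ SamePhase a (-a) := by
  rintro ⟨c, hc, h⟩
  have : ((1 + c : ℝ) : ℂ) * a = 0 := by
    push_cast
    linear_combination h
  rcases mul_eq_zero.mp this with h | h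
  · have : (1 + c : ℝ) = 0 := by exact_mod_cast h
    linarith
  · exact ha h

theorem mean_subgroup {f : G → ℂ} (hf : FinPer f) (M : AddSubgroup G) [M.FiniteIndex]
    (h0 : ∀ x ∉ M, f x = 0) : SamePhase (mean f) (mean fun x : M ↦ f x) := by
  classical
  have : (periods f).FiniteIndex := hf
  have : (periods f ⊓ M).FiniteIndex := inferInstance
  have : Fintype (G ⧸ (periods f ⊓ M)) := Fintype.ofFinite _
  let π := QuotientAddGroup.mk' (periods f ⊓ M)
  let R := M.map π
  have key : ∀ x : G, f x = f (π x).out := by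
    intro x
    have h : (((x : G ⧸ (periods f ⊓ M)).out : G) : G ⧸ (periods f ⊓ M)) = x :=
      QuotientAddGroup.out_eq' _
    have := (QuotientAddGroup.eq.mp h.symm).1 x
    rw [add_neg_cancel_left] at this
    exact this.symm
  have hR : ∀ x, π x ∈ R ↔ x ∈ M := by
    intro x
    constructor
    · rintro ⟨y, hy, hxy⟩
      have := (QuotientAddGroup.eq.mp hxy).2
      have := M.add_mem hy this
      rwa [add_neg_cancel_left] at this
    · exact fun h ↦ ⟨x, h, rfl⟩
  let π' : M →+ R := (π.comp M.subtype).codRestrict R fun x ↦ (hR _).mpr x.2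
  have hπ' : Function.Surjective π' := by
    rintro ⟨_, x, hx, rfl⟩
    exact ⟨⟨x, hx⟩, rfl⟩
  rw [mean_eq_of_surj π (QuotientAddGroup.mk'_surjective _) (fun q ↦ f q.out) key,
    mean_eq_of_surj π' hπ' (fun q ↦ f q.1.out) (fun x ↦ key x)]
  have hsum : ∑ q : G ⧸ (periods f ⊓ M), f q.out = ∑ q : R, f q.1.out := by
    rw [← Finset.sum_subtype (Finset.univ.filter fun q ↦ q ∈ R) (p := fun q ↦ q ∈ R)
      (by simp) (fun q ↦ f q.out)]
    refine (Finset.sum_subset (Finset.subset_univ _) fun q _ hq ↦ ?_).symm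
    obtain ⟨x, rfl⟩ := QuotientAddGroup.mk'_surjective _ q
    have hx : x ∉ M := fun hx ↦ hq (Finset.mem_filter.mpr ⟨Finset.mem_univ _, (hR x).mpr hx⟩)
    exact (key x).symm.trans (h0 x hx)
  rw [hsum]
  have hc1 : (0 : ℝ) < Fintype.card R := by exact_mod_cast Fintype.card_pos
  have hc2 : (0 : ℝ) < Fintype.card (G ⧸ (periods f ⊓ M)) := by exact_mod_cast Fintype.card_pos
  refine ⟨Fintype.card R / Fintype.card (G ⧸ (periods f ⊓ M)), div_pos hc1 hc2, ?_⟩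
  have hc1' : (Fintype.card R : ℂ) ≠ 0 := by exact_mod_cast hc1.ne'
  have hc2' : (Fintype.card (G ⧸ (periods f ⊓ M)) : ℂ) ≠ 0 := by exact_mod_cast hc2.ne'
  push_cast
  field_simp

/-- Averaging over a subgroup `L` kills the contribution of everything outside `M`. -/
theorem mean_samePhase_of_average {f : G → ℂ} (hf : FinPer f) (L M : AddSubgroup G)
    [M.FiniteIndex] (h1 : ∀ x ∈ M, ∀ l ∈ L, f (x + l) = f x)
    (h0 : ∀ x ∉ M, ∃ t ∈ L, ∃ ω : ℂ, ω ≠ 1 ∧ ∀ l ∈ L, f (x + l + t) = ω * f (x + l)) :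
    SamePhase (mean f) (mean fun x : M ↦ f x) := by
  classical
  let φ : G × L →+ G := (AddMonoidHom.fst G L) + L.subtype.comp (AddMonoidHom.snd G L)
  have hφ : Function.Surjective φ := fun x ↦ ⟨(x, 0), by simp [φ]⟩
  have e1 : mean f = mean fun x ↦ if x ∈ M then f x else 0 := by
    rw [← mean_comp_surj hf φ hφ, mean_prod (hf.comp φ)]
    congr 1
    funext x
    split_ifs with hx
    · have : (fun y : L ↦ f (φ (x, y))) = fun _ ↦ f x := by
        funext y
        exact h1 x hx y y.2
      rw [this, mean_const]
    · obtain ⟨t, ht, ω, hω, h⟩ := h0 x hx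
      have hf' : (periods f).FiniteIndex := hf
      have := finiteIndex_comap L.subtype (periods f)
      refine mean_eq_zero (FinPer.of_le ((periods f).comap L.subtype) fun s hs y ↦ ?_)
        ⟨t, ht⟩ ω hω fun y ↦ ?_
      · have := hs (x + y)
        simpa [φ, add_assoc] using this
      · have := h y y.2
        simpa [φ, add_assoc] using this
  rw [e1]
  have hf' : (periods f).FiniteIndex := hf
  refine (mean_subgroup (f := fun x ↦ if x ∈ M then f x else 0)
    (FinPer.of_le (periods f ⊓ M) fun t ht x ↦ ?_) M fun x hx ↦ if_neg hx).trans ?_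
  · have := ht.1 x
    rw [M.add_mem_cancel_right ht.2, this]
  · have : (fun x : M ↦ if (x : G) ∈ M then f x else 0) = fun x : M ↦ f x := by
      funext x
      rw [if_pos x.2]
    rw [this]
    exact SamePhase.refl _

end Mean

section RankOne

open Filter Topology Complex HurwitzZeta

theorem tendsto_sqrt_mul_evenKernel (N : ℕ) (hN : 0 < N) (r : ℝ) :
    Tendsto (fun y : ℝ ↦ √y * evenKernel (r : UnitAddCircle) (N ^ 2 * y)) (𝓝[>] 0)
      (𝓝 (1 / N)) := by
  have hN' : (0 : ℝ) < N := by exact_mod_cast hN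
  have h1 : Tendsto (cosKernel (r : UnitAddCircle)) atTop (𝓝 1) := by
    obtain ⟨p, hp, h⟩ := isBigO_atTop_cosKernel_sub (r : UnitAddCircle)
    have h2 : Tendsto (fun x : ℝ ↦ Real.exp (-p * x)) atTop (𝓝 0) := by
      refine Real.tendsto_exp_atBot.comp ?_
      exact (tendsto_id.const_mul_atTop_of_neg (by linarith : -p < 0))
    simpa using (h.trans_tendsto h2).add_const 1
  have h3 : Tendsto (fun y : ℝ ↦ 1 / (N ^ 2 * y)) (𝓝[>] 0) atTop := by
    have : Tendsto (fun y : ℝ ↦ (1 / (N : ℝ) ^ 2) * y⁻¹) (𝓝[>] 0) atTop :=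
      tendsto_inv_nhdsGT_zero.const_mul_atTop (by positivity)
    refine this.congr fun y ↦ ?_
    rw [one_div, one_div, mul_inv]
  have h4 := (h1.comp h3).const_mul (1 / (N : ℝ))
  rw [mul_one] at h4
  refine h4.congr' ?_
  filter_upwards [self_mem_nhdsWithin] with y hy
  have hy' : (0 : ℝ) < y := hy
  rw [evenKernel_functional_equation, ← Real.sqrt_eq_rpow, Real.sqrt_mul (by positivity),
    Real.sqrt_sq hN'.le, Function.comp_apply]
  have : √y ≠ 0 := (Real.sqrt_pos.mpr hy').ne'
  field_simp

theorem hasSum_periodic_mul_gaussian {N : ℕ} [NeZero N] (f : ℤ → ℂ)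
    (hf : ∀ n m : ℤ, f (n + N * m) = f n) {y : ℝ} (hy : 0 < y) :
    HasSum (fun n : ℤ ↦ f n * Real.exp (-Real.pi * n ^ 2 * y))
      (∑ r : Fin N, f r * evenKernel (((r : ℕ) / N : ℝ) : UnitAddCircle) (N ^ 2 * y)) := by
  have hN : (0 : ℝ) < N := by exact_mod_cast Nat.pos_of_ne_zero (NeZero.ne N)
  rw [← (Int.divModEquiv N).symm.hasSum_iff, ← (Equiv.prodComm (Fin N) ℤ).hasSum_iff]
  have h1 : ∀ r : Fin N, HasSum (fun m : ℤ ↦ f r *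
      (Real.exp (-Real.pi * (m + (r : ℕ) / N) ^ 2 * (N ^ 2 * y)) : ℂ))
      (f r * evenKernel (((r : ℕ) / N : ℝ) : UnitAddCircle) (N ^ 2 * y)) := fun r ↦ by
    have := (hasSum_int_evenKernel ((r : ℕ) / N : ℝ) (t := N ^ 2 * y) (by positivity))
    exact (Complex.hasSum_ofReal.mpr this).mul_left _
  have h2 : HasSum (fun p : Fin N × ℤ ↦ f p.1 *
      (Real.exp (-Real.pi * (p.2 + (p.1 : ℕ) / N) ^ 2 * (N ^ 2 * y)) : ℂ))
      (∑ r : Fin N, f r * evenKernel (((r : ℕ) / N : ℝ) : UnitAddCircle) (N ^ 2 * y)) := by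
    have hs : Summable (fun p : Fin N × ℤ ↦ f p.1 *
      (Real.exp (-Real.pi * (p.2 + (p.1 : ℕ) / N) ^ 2 * (N ^ 2 * y)) : ℂ)) := by
      refine Summable.of_norm ?_
      rw [summable_prod_of_nonneg fun _ ↦ norm_nonneg _]
      exact ⟨fun r ↦ (h1 r).summable.norm, Summable.of_finite⟩
    have := hs.hasSum
    rwa [(this.prod_fiberwise h1).unique (hasSum_fintype _)] at this
  refine h2.congr_fun ?_
  rintro ⟨r, m⟩
  simp only [Function.comp_apply, Equiv.prodComm_apply, Prod.swap_prod_mk,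
    Int.divModEquiv_symm_apply]
  rw [show m * (N : ℤ) + ((r : ℕ) : ℤ) = (r : ℕ) + N * m by ring, hf]
  congr 3
  push_cast
  field_simp
  ring

theorem mean_int_eq {N : ℕ} [NeZero N] (f : ℤ → ℂ) (hf : ∀ n m : ℤ, f (n + N * m) = f n) :
    FinPer f ∧ mean f = (∑ r : Fin N, f r) / N := by
  have key : ∀ n : ℤ, f n = f ((Int.castAddHom (ZMod N) n).val : ℤ) := fun n ↦ by
    have h := Int.emod_add_mul_ediv n N
    rw [Int.coe_castAddHom, ZMod.val_intCast]
    conv_lhs => rw [← h]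
    exact hf _ _
  have hs : Function.Surjective (Int.castAddHom (ZMod N)) := ZMod.intCast_surjective
  refine ⟨FinPer.of_surj _ (fun z : ZMod N ↦ f (z.val : ℤ)) key, ?_⟩
  rw [mean_eq_of_surj _ hs (fun z : ZMod N ↦ f (z.val : ℤ)) key, ZMod.card]
  congr 1
  cases N with
  | zero => exact (NeZero.ne 0 rfl).elim
  | succ n => rfl

theorem tendsto_sqrt_mul_tsum {N : ℕ} [NeZero N] (f : ℤ → ℂ)
    (hf : ∀ n m : ℤ, f (n + N * m) = f n) :
    Tendsto (fun y : ℝ ↦ (√y : ℂ) * ∑' n : ℤ, f n * Real.exp (-Real.pi * n ^ 2 * y)) (𝓝[>] 0)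
      (𝓝 (mean f)) := by
  rw [(mean_int_eq f hf).2]
  have h1 : Tendsto (fun y : ℝ ↦ ∑ r : Fin N, f r *
      ((√y * evenKernel (((r : ℕ) / N : ℝ) : UnitAddCircle) (N ^ 2 * y) : ℝ) : ℂ)) (𝓝[>] 0)
      (𝓝 (∑ r : Fin N, f r * ((1 / N : ℝ) : ℂ))) := by
    refine tendsto_finsetSum _ fun r _ ↦ Tendsto.const_mul _ ?_
    exact (Complex.continuous_ofReal.tendsto _).comp
      (tendsto_sqrt_mul_evenKernel N (Nat.pos_of_ne_zero (NeZero.ne N)) _)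
  have h2 : (∑ r : Fin N, f r * ((1 / N : ℝ) : ℂ)) = (∑ r : Fin N, f r) / N := by
    rw [Finset.sum_div]
    refine Finset.sum_congr rfl fun r _ ↦ ?_
    push_cast
    ring
  rw [← h2]
  refine h1.congr' ?_
  filter_upwards [self_mem_nhdsWithin] with y hy
  rw [(hasSum_periodic_mul_gaussian f hf hy).tsum_eq, Finset.mul_sum]
  refine Finset.sum_congr rfl fun r _ ↦ ?_
  push_cast
  ring

/-- The additive character `x ↦ exp (2πix)` on `ℚ`. -/
noncomputable def addChar (x : ℚ) : ℂ := cexp (2 * Real.pi * I * x)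

theorem addChar_add (x y : ℚ) : addChar (x + y) = addChar x * addChar y := by
  rw [addChar, addChar, addChar, ← Complex.exp_add]
  congr 1
  push_cast
  ring

theorem addChar_int (n : ℤ) : addChar n = 1 := by
  rw [addChar, ← Complex.exp_int_mul_two_pi_mul_I n]
  congr 1
  push_cast
  ring

theorem addChar_eq_one_iff (x : ℚ) : addChar x = 1 ↔ ∃ n : ℤ, x = n := by
  constructor
  · intro h
    obtain ⟨n, hn⟩ := Complex.exp_eq_one_iff.mp h
    refine ⟨n, ?_⟩
    have h2 : (2 * Real.pi * I : ℂ) ≠ 0 := Complex.two_pi_I_ne_zero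
    have : (x : ℂ) = n := mul_left_cancel₀ h2 (by rw [hn]; ring)
    exact_mod_cast this
  · rintro ⟨n, rfl⟩
    exact addChar_int n

theorem addChar_neg (x : ℚ) : addChar (-x) = starRingEnd ℂ (addChar x) := by
  rw [addChar, addChar, ← Complex.exp_conj]
  have h2 : (starRingEnd ℂ) 2 = 2 := map_ofNat _ 2
  congr 1
  simp [h2]

theorem jacobiTheta_add_two_mul (z τ : ℂ) (n : ℕ) :
    jacobiTheta₂ z (τ + 2 * n) = jacobiTheta₂ z τ := by
  induction n with
  | zero => simp
  | succ n ih =>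
    have h : τ + 2 * ((n + 1 : ℕ) : ℂ) = τ + 2 * n + 2 := by
      push_cast
      ring
    rw [h, jacobiTheta₂_add_right, ih]

theorem ofReal_mul_cpow {r : ℝ} (hr : 0 < r) {x : ℂ} (hx : x ≠ 0) (s : ℂ) :
    ((r : ℂ) * x) ^ s = (r : ℂ) ^ s * x ^ s := by
  have hr' : (r : ℂ) ≠ 0 := by exact_mod_cast hr.ne'
  rw [Complex.cpow_def_of_ne_zero (mul_ne_zero hr' hx), Complex.cpow_def_of_ne_zero hr',
    Complex.cpow_def_of_ne_zero hx, Complex.log_ofReal_mul hr hx, ← Complex.exp_add,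
    Complex.ofReal_log hr.le, add_mul]

theorem ofReal_sqrt_eq_cpow {r : ℝ} (hr : 0 ≤ r) : ((√r : ℝ) : ℂ) = (r : ℂ) ^ (1 / 2 : ℂ) := by
  rw [Real.sqrt_eq_rpow, Complex.ofReal_cpow hr]
  norm_num

theorem tendsto_sqrt_mul_jacobiTheta (a : ℕ) (ha : 0 < a) :
    Tendsto (fun y : ℝ ↦ (√y : ℂ) * jacobiTheta₂ 0 (1 / (2 * a) + I * y)) (𝓝[>] 0)
      (𝓝 (1 / ((1 / (2 * a) : ℝ) * -I) ^ (1 / 2 : ℂ) * (1 / (4 * a ^ 2 : ℂ) ^ (1 / 2 : ℂ)))) := by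
  have ha' : (0 : ℝ) < a := by exact_mod_cast ha
  have hac : (a : ℂ) ≠ 0 := by exact_mod_cast ha'.ne'
  have hy0 : Tendsto (fun y : ℝ ↦ (y : ℂ)) (𝓝[>] 0) (𝓝 0) := by
    have := (Complex.continuous_ofReal.tendsto 0).mono_left (nhdsWithin_le_nhds (s := Set.Ioi 0))
    simpa using this
  have t1 : Tendsto (fun y : ℝ ↦ (-I * (1 / (2 * a) + I * y)) ^ (1 / 2 : ℂ)) (𝓝[>] 0)
      (𝓝 (((1 / (2 * a) : ℝ) * -I) ^ (1 / 2 : ℂ))) := by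
    have hm : (((1 / (2 * a) : ℝ) : ℂ) * -I) ∈ slitPlane := by
      right
      have : (((1 / (2 * a) : ℝ) : ℂ) * -I).im = -(1 / (2 * a)) := by
        rw [Complex.im_ofReal_mul]
        simp
      rw [this]
      exact (neg_lt_zero.mpr (by positivity)).ne
    refine (continuousAt_cpow_const hm).tendsto.comp ?_
    have := ((hy0.const_mul I).const_add (1 / (2 * a : ℂ))).const_mul (-I)
    convert this using 2
    push_cast
    ring
  have t2 : Tendsto (fun y : ℝ ↦ (4 * a ^ 2 / (1 + 2 * a * I * y) : ℂ) ^ (1 / 2 : ℂ)) (𝓝[>] 0)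
      (𝓝 ((4 * a ^ 2 : ℂ) ^ (1 / 2 : ℂ))) := by
    have hm : (4 * a ^ 2 : ℂ) ∈ slitPlane := by
      left
      have : (4 * a ^ 2 : ℂ) = ((4 * a ^ 2 : ℝ) : ℂ) := by push_cast; ring
      rw [this, Complex.ofReal_re]
      positivity
    refine (continuousAt_cpow_const hm).tendsto.comp ?_
    have := ((hy0.const_mul (2 * a * I)).const_add 1)
    rw [mul_zero, add_zero] at this
    have := (tendsto_const_nhds (x := (4 * a ^ 2 : ℂ))).div this one_ne_zero
    rwa [_root_.div_one] at this
  have t3 : Tendsto (fun y : ℝ ↦ jacobiTheta₂ 0 (I / (4 * a ^ 2 * y) - 1 / (2 * a))) (𝓝[>] 0)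
      (𝓝 1) := by
    have him : ∀ y : ℝ, (I / (4 * a ^ 2 * y) - 1 / (2 * a) : ℂ).im = 1 / (4 * a ^ 2) * y⁻¹ := by
      intro y
      have : (I / (4 * a ^ 2 * y) - 1 / (2 * a) : ℂ)
          = ((1 / (4 * a ^ 2) * y⁻¹ : ℝ) : ℂ) * I - ((1 / (2 * a) : ℝ) : ℂ) := by
        push_cast
        rw [div_eq_mul_inv, mul_inv, div_eq_mul_inv 1 (4 * (a : ℂ) ^ 2)]
        ring
      rw [this, Complex.sub_im, Complex.ofReal_im, Complex.im_ofReal_mul]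
      simp
    have ht : Tendsto (fun y : ℝ ↦ (I / (4 * a ^ 2 * y) - 1 / (2 * a) : ℂ)) (𝓝[>] 0)
        (comap im atTop) := by
      rw [tendsto_comap_iff]
      refine (tendsto_inv_nhdsGT_zero.const_mul_atTop
        (by positivity : (0 : ℝ) < 1 / (4 * a ^ 2))).congr fun y ↦ ?_
      exact (him y).symm
    have h0 : Tendsto (fun τ : ℂ ↦ Real.exp (-Real.pi * τ.im)) (comap im atTop) (𝓝 0) := by
      have : Tendsto (fun x : ℝ ↦ Real.exp (-Real.pi * x)) atTop (𝓝 0) :=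
        Real.tendsto_exp_atBot.comp
          (tendsto_id.const_mul_atTop_of_neg (by linarith [Real.pi_pos] : -Real.pi < 0))
      exact this.comp tendsto_comap
    have := ((isBigO_at_im_infty_jacobiTheta_sub_one.trans_tendsto h0).comp ht).add_const 1
    simpa [Function.comp_def, jacobiTheta_eq_jacobiTheta₂] using this
  have := ((tendsto_const_nhds (x := (1 : ℂ))).div t1 ?_).mul
    (((tendsto_const_nhds (x := (1 : ℂ))).div t2 ?_).mul t3)
  · rw [mul_one] at this
    refine this.congr' ?_
    filter_upwards [self_mem_nhdsWithin] with y hy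
    have hy' : (0 : ℝ) < y := hy
    have hyc : (y : ℂ) ≠ 0 := by exact_mod_cast hy'.ne'
    have hden : (1 + 2 * a * I * y : ℂ) ≠ 0 := by
      intro h
      have := congrArg Complex.re h
      simp [Complex.mul_re] at this
    have hτ : (1 / (2 * a) + I * y : ℂ) = (1 + 2 * a * I * y) / (2 * a) := by
      field_simp
    have hs : -1 / (1 / (2 * a) + I * y : ℂ) + 2 * a = 4 * a ^ 2 * I * y / (1 + 2 * a * I * y) := by
      rw [hτ]
      field_simp
      ring
    have hs2 : -I * (4 * a ^ 2 * I * y / (1 + 2 * a * I * y) : ℂ)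
        = y * (4 * a ^ 2 / (1 + 2 * a * I * y)) := by
      rw [mul_div_assoc', mul_div_assoc']
      congr 1
      linear_combination (-4 * a ^ 2 * y : ℂ) * I_sq
    have hs3 : -1 / (4 * a ^ 2 * I * y / (1 + 2 * a * I * y) : ℂ)
        = I / (4 * a ^ 2 * y) - 1 / (2 * a) := by
      field_simp
      linear_combination (-2 : ℂ) * I_sq
    have hsq : (y : ℂ) ^ (1 / 2 : ℂ) ≠ 0 := by
      rw [← ofReal_sqrt_eq_cpow hy'.le]
      exact_mod_cast (Real.sqrt_pos.mpr hy').ne'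
    conv_rhs => rw [jacobiTheta₂_functional_equation, ← jacobiTheta_add_two_mul _ _ a, zero_div,
      hs, jacobiTheta₂_functional_equation 0 (4 * a ^ 2 * I * y / (1 + 2 * a * I * y) : ℂ), hs2, hs3,
      ofReal_mul_cpow hy' (div_ne_zero (by simpa using hac) hden), zero_div,
      ofReal_sqrt_eq_cpow hy'.le]
    simp
    field_simp
  · rw [Complex.cpow_ne_zero_iff]
    left
    simpa using hac
  · rw [Complex.cpow_ne_zero_iff]
    left
    simpa using hac

/-- The phase of a rank one positive definite Gauss sum. -/
noncomputable def gaussPhase : ℂ := 1 / (-I) ^ (1 / 2 : ℂ)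

theorem gaussPhase_ne_zero : gaussPhase ≠ 0 := by
  rw [gaussPhase, one_div]
  refine inv_ne_zero ?_
  rw [Complex.cpow_ne_zero_iff]
  simp

theorem addChar_sq_div_periodic (a : ℤ) (ha : a ≠ 0) (n m : ℤ) :
    addChar ((n + 2 * a * m : ℤ) ^ 2 / (4 * a)) = addChar (n ^ 2 / (4 * a)) := by
  have ha' : (a : ℚ) ≠ 0 := by exact_mod_cast ha
  have : ((n + 2 * a * m : ℤ) ^ 2 / (4 * a) : ℚ) = n ^ 2 / (4 * a) + (n * m + a * m ^ 2 : ℤ) := by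
    push_cast
    field_simp
    ring
  rw [this, addChar_add, addChar_int, mul_one]

theorem mean_gauss_pos (a : ℕ) (ha : 0 < a) :
    SamePhase (mean fun n : ℤ ↦ addChar (n ^ 2 / (4 * (a : ℤ)))) gaussPhase := by
  have : NeZero (2 * a) := ⟨by omega⟩
  have ha' : (0 : ℝ) < a := by exact_mod_cast ha
  have hac : (a : ℂ) ≠ 0 := by exact_mod_cast ha'.ne'
  have h1 := tendsto_sqrt_mul_tsum (N := 2 * a) (fun n : ℤ ↦ addChar (n ^ 2 / (4 * (a : ℤ))))
    fun n m ↦ by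
      have := addChar_sq_div_periodic a (by exact_mod_cast ha.ne') n m
      exact_mod_cast this
  have h2 := tendsto_sqrt_mul_jacobiTheta a ha
  have h3 := tendsto_nhds_unique h1 (h2.congr fun y ↦ ?_)
  swap
  ·
    congr 1
    refine tsum_congr fun n ↦ ?_
    rw [jacobiTheta₂_term, addChar, Complex.ofReal_exp, ← Complex.exp_add]
    congr 1
    push_cast
    field_simp
    linear_combination (8 * n ^ 2 * y * a : ℂ) * I_sq
  rw [h3, gaussPhase, ofReal_mul_cpow (by positivity) (by simp)]
  refine ⟨(1 / √(1 / (2 * a))) * (1 / √(4 * a ^ 2)), by positivity, ?_⟩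
  have h4 : (4 * a ^ 2 : ℂ) = ((4 * a ^ 2 : ℝ) : ℂ) := by push_cast; ring
  rw [h4, ← ofReal_sqrt_eq_cpow (by positivity), ← ofReal_sqrt_eq_cpow (by positivity)]
  push_cast
  field_simp

/-- The phase of a rank one Gauss sum depends only on the sign of its coefficient. -/
theorem mean_gauss (a : ℤ) (ha : a ≠ 0) :
    FinPer (fun n : ℤ ↦ addChar (n ^ 2 / (4 * a))) ∧
    SamePhase (mean fun n : ℤ ↦ addChar (n ^ 2 / (4 * a)))
      (if 0 < a then gaussPhase else starRingEnd ℂ gaussPhase) := by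
  have hfin : ∀ a : ℤ, 0 < a → FinPer (fun n : ℤ ↦ addChar (n ^ 2 / (4 * a))) := by
    intro a ha
    lift a to ℕ using ha.le
    have : NeZero (2 * a) := ⟨by omega⟩
    refine (mean_int_eq (N := 2 * a) _ fun n m ↦ ?_).1
    have := addChar_sq_div_periodic a (by omega) n m
    exact_mod_cast this
  rcases lt_or_gt_of_ne ha with h | h
  · have e : (fun n : ℤ ↦ addChar (n ^ 2 / (4 * a)))
        = fun n : ℤ ↦ starRingEnd ℂ (addChar (n ^ 2 / (4 * (-a : ℤ)))) := by
      funext n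
      rw [← addChar_neg]
      congr 1
      push_cast
      rw [mul_neg, div_neg, neg_neg]
    have hf := hfin (-a) (by omega)
    rw [if_neg (by omega), e]
    refine ⟨hf.comp_left _, ?_⟩
    rw [mean_conj hf]
    have := mean_gauss_pos (-a).toNat (by omega)
    rw [Int.toNat_of_nonneg (by omega)] at this
    exact this.conj
  · rw [if_pos h]
    refine ⟨hfin a h, ?_⟩
    have := mean_gauss_pos a.toNat (by omega)
    rwa [Int.toNat_of_nonneg (by omega)] at this

end RankOne

section Milgram

theorem mean_pi {ι : Type*} [Fintype ι] {G : ι → Type*} [∀ i, AddCommGroup (G i)]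
    (g : ∀ i, G i → ℂ) (hg : ∀ i, FinPer (g i)) :
    FinPer (fun n : ∀ i, G i ↦ ∏ i, g i (n i)) ∧
      mean (fun n : ∀ i, G i ↦ ∏ i, g i (n i)) = ∏ i, mean (g i) := by
  classical
  have h1 : ∀ i, (periods (g i)).FiniteIndex := hg
  have h2 : ∀ i, Fintype (G i ⧸ periods (g i)) := fun i ↦ Fintype.ofFinite _
  let π : (∀ i, G i) →+ (∀ i, G i ⧸ periods (g i)) :=
    { toFun := fun n i ↦ n i
      map_zero' := rfl
      map_add' := fun _ _ ↦ rfl }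
  have hπ : Function.Surjective π := fun q ↦ ⟨fun i ↦ (q i).out, funext fun i ↦
    QuotientAddGroup.out_eq' _⟩
  have key : ∀ n : ∀ i, G i, ∏ i, g i (n i) = ∏ i, g i (π n i).out := fun n ↦
    Finset.prod_congr rfl fun i _ ↦ (apply_out_eq (g i) (n i)).symm
  refine ⟨FinPer.of_surj π (fun q ↦ ∏ i, g i (q i).out) key, ?_⟩
  rw [mean_eq_of_surj π hπ (fun q ↦ ∏ i, g i (q i).out) key]
  rw [← Fintype.prod_sum fun i (q : G i ⧸ periods (g i)) ↦ g i q.out, Fintype.card_pi]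
  push_cast
  rw [← Finset.prod_div_distrib]
  refine Finset.prod_congr rfl fun i _ ↦ ?_
  rw [mean_eq_of_surj (QuotientAddGroup.mk' (periods (g i))) (QuotientAddGroup.mk'_surjective _)
    (fun q ↦ g i q.out) (fun x ↦ (apply_out_eq (g i) x).symm)]

variable {F : Type*} [Field F] [NumberField F]

/-- Embeddings of a totally real field into `ℝ` and into `ℂ` correspond. -/
noncomputable def embeddingEquiv (hF : ∀ τ : F →+* ℂ, ComplexEmbedding.IsReal τ) :
    (F →+* ℝ) ≃ (F →+* ℂ) where
  toFun τ := Complex.ofRealHom.comp τ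
  invFun τ := (hF τ).embedding
  left_inv τ := by
    ext x
    rfl
  right_inv τ := by
    ext x
    simp

theorem trace_eq_sum_real (hF : ∀ τ : F →+* ℂ, ComplexEmbedding.IsReal τ) (x : F) :
    ((Algebra.trace ℚ F x : ℚ) : ℝ) = ∑ τ : F →+* ℝ, τ x := by
  have h1 := trace_eq_sum_embeddings (K := ℚ) (L := F) ℂ (x := x)
  have h2 : ∑ τ : F →ₐ[ℚ] ℂ, τ x = ∑ τ : F →+* ℝ, ((τ x : ℝ) : ℂ) := by
    symm
    exact Fintype.sum_equiv ((embeddingEquiv hF).trans (RingHom.equivRatAlgHom F ℂ)) _ _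
      fun τ ↦ rfl
  rw [h2] at h1
  have h3 : (((Algebra.trace ℚ F x : ℚ) : ℝ) : ℂ) = ((∑ τ : F →+* ℝ, τ x : ℝ) : ℂ) := by
    push_cast
    rw [← h1]
    rfl
  exact_mod_cast h3

theorem card_real_embeddings (hF : ∀ τ : F →+* ℂ, ComplexEmbedding.IsReal τ) :
    Fintype.card (F →+* ℝ) = Module.finrank ℚ F := by
  rw [Fintype.card_congr (embeddingEquiv hF), Embeddings.card]

/-- The form `Tr (α x y)` can be diagonalized. -/
theorem exists_orthogonal (α : F) (hα : α ≠ 0) :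
    ∃ (e : Fin (Module.finrank ℚ F) → F) (a : Fin (Module.finrank ℚ F) → ℤ),
      (∀ i, a i ≠ 0) ∧ (∀ i, Algebra.trace ℚ F (α * e i * e i) = a i) ∧
      (∀ i j, i ≠ j → Algebra.trace ℚ F (α * e i * e j) = 0) ∧
      (∀ x : 𝓞 F, ∃ n : Fin (Module.finrank ℚ F) → ℤ,
        (x : F) = ∑ i, ((n i : ℚ) / (2 * a i) : ℚ) • e i) := by
  classical
  let B : LinearMap.BilinForm ℚ F := (Algebra.traceForm ℚ F).comp (LinearMap.mulLeft ℚ α) .id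
  have hB : ∀ x y, B x y = Algebra.trace ℚ F (α * x * y) := fun x y ↦ rfl
  have hsymm : LinearMap.IsSymm B := ⟨fun x y ↦ by
    simp only [RingHom.id_apply, hB]
    rw [mul_right_comm]⟩
  obtain ⟨v, hv⟩ := LinearMap.BilinForm.exists_orthogonal_basis hsymm
  have hne : ∀ i, B (v i) (v i) ≠ 0 := by
    intro i hi
    have h0 : ∀ y, B (v i) y = 0 := by
      intro y
      rw [← v.sum_repr y, map_sum]
      refine Finset.sum_eq_zero fun j _ ↦ ?_
      rw [map_smul]
      rcases eq_or_ne i j with rfl | hij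
      · rw [hi, smul_zero]
      · have : B (v i) (v j) = 0 := hv hij
        rw [this, smul_zero]
    have h1 := (traceForm_nondegenerate ℚ F).1 (α * v i) fun y ↦ by
      have := h0 y
      rwa [hB] at this
    exact v.ne_zero i ((mul_eq_zero.mp h1).resolve_left hα)
  obtain ⟨N, hN0, hN⟩ := exists_integral_multiples ℤ ℚ
    (Finset.univ.image (fun i ↦ α * v i) ∪
      Finset.univ.image (fun i ↦ algebraMap ℚ F (B (v i) (v i))))
  have hNq : (N : ℚ) ≠ 0 := by exact_mod_cast hN0
  have h1 : ∀ i, IsIntegral ℤ (N • (α * v i)) := fun i ↦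
    hN _ <| Finset.mem_union_left _ <| Finset.mem_image_of_mem _ (Finset.mem_univ i)
  have h2 : ∀ i, ∃ m : ℤ, N * B (v i) (v i) = m := fun i ↦ by
    have h := hN (algebraMap ℚ F (B (v i) (v i))) (by simp)
    have h' : N • algebraMap ℚ F (B (v i) (v i)) = algebraMap ℚ F (N * B (v i) (v i)) := by
      rw [map_mul, zsmul_eq_mul, map_intCast]
    rw [h', isIntegral_algebraMap_iff (algebraMap ℚ F).injective] at h
    obtain ⟨m, hm⟩ := IsIntegrallyClosed.isIntegral_iff.mp h
    exact ⟨m, by rw [← hm]; rfl⟩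
  choose m hm using h2
  have h3 : ∀ (x : 𝓞 F) i, ∃ k : ℤ, N * B (v i) x = k := fun x i ↦ by
    have h := Algebra.isIntegral_trace (R := ℤ) (L := ℚ) ((h1 i).mul (RingOfIntegers.isIntegral_coe x))
    obtain ⟨k, hk⟩ := IsIntegrallyClosed.isIntegral_iff.mp h
    refine ⟨k, ?_⟩
    have : (k : ℚ) = _ := hk
    rw [this, hB, smul_mul_assoc, map_zsmul, zsmul_eq_mul]
  have hs : ∀ i j, Algebra.trace ℚ F (α * ((N : ℚ) • v i) * ((N : ℚ) • v j))
      = N * N * B (v i) (v j) := fun i j ↦ by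
    rw [hB, mul_smul_comm, mul_smul_comm, smul_mul_assoc, map_smul, map_smul, smul_eq_mul,
      smul_eq_mul, ← mul_assoc]
  refine ⟨fun i ↦ (N : ℚ) • v i, fun i ↦ N * m i, fun i ↦ ?_, fun i ↦ ?_, fun i j hij ↦ ?_,
    fun x ↦ ?_⟩
  · refine mul_ne_zero hN0 fun h ↦ ?_
    have := hm i
    rw [h, Int.cast_zero] at this
    exact (mul_ne_zero hNq (hne i)) this
  · rw [hs, mul_assoc, hm]
    push_cast
    rfl
  · have : B (v i) (v j) = 0 := hv hij
    rw [hs, this, mul_zero]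
  · choose k hk using h3 x
    refine ⟨fun i ↦ 2 * k i, ?_⟩
    conv_lhs => rw [← v.sum_repr (x : F)]
    refine Finset.sum_congr rfl fun i _ ↦ ?_
    have h4 : B (v i) x = v.repr (x : F) i * B (v i) (v i) := by
      conv_lhs => rw [← v.sum_repr (x : F), map_sum]
      rw [Finset.sum_eq_single i]
      · rw [map_smul, smul_eq_mul]
      · intro j _ hj
        have : B (v i) (v j) = 0 := hv hj.symm
        rw [map_smul, this, smul_zero]
      · simp
    rw [smul_smul]
    congr 1
    push_cast
    rw [← hm, ← hk, h4]
    have := hne i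
    field_simp

/-- Sylvester's law of inertia for the form `Tr (α x y)`. -/
theorem ncard_pos_eq (hF : ∀ τ : F →+* ℂ, ComplexEmbedding.IsReal τ) (α : F)
    (e : Fin (Module.finrank ℚ F) → F) (a : Fin (Module.finrank ℚ F) → ℤ)
    (ha : ∀ i, a i ≠ 0) (h1 : ∀ i, Algebra.trace ℚ F (α * e i * e i) = a i)
    (h2 : ∀ i j, i ≠ j → Algebra.trace ℚ F (α * e i * e j) = 0) :
    {i | 0 < a i}.ncard = {τ : F →+* ℝ | 0 < τ α}.ncard := by
  classical
  let w₁ : Fin (Module.finrank ℚ F) → ℝ := fun i ↦ a i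
  let w₂ : (F →+* ℝ) → ℝ := fun τ ↦ τ α
  let A : (Fin (Module.finrank ℚ F) → ℝ) →ₗ[ℝ] ((F →+* ℝ) → ℝ) :=
    Matrix.toLin' (Matrix.of fun τ i ↦ τ (e i))
  have hA : ∀ x τ, A x τ = ∑ i, τ (e i) * x i := fun x τ ↦ rfl
  have key : ∀ x i, ∑ τ : F →+* ℝ, τ α * τ (e i) * A x τ = a i * x i := by
    intro x i
    simp only [hA, Finset.mul_sum]
    rw [Finset.sum_comm, Finset.sum_eq_single i]
    · have := trace_eq_sum_real hF (α * e i * e i)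
      rw [h1] at this
      simp only [map_mul] at this
      have h3 : ((a i : ℚ) : ℝ) = a i := by push_cast; rfl
      rw [h3] at this
      rw [this, Finset.sum_mul]
      exact Finset.sum_congr rfl fun τ _ ↦ by ring
    · intro j _ hj
      have := trace_eq_sum_real hF (α * e i * e j)
      rw [h2 i j hj.symm] at this
      simp only [map_mul] at this
      rw [Rat.cast_zero] at this
      have h3 : ∑ τ : F →+* ℝ, τ α * τ (e i) * (τ (e j) * x j)
          = (∑ τ : F →+* ℝ, τ α * τ (e i) * τ (e j)) * x j := by
        rw [Finset.sum_mul]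
        exact Finset.sum_congr rfl fun τ _ ↦ by ring
      rw [h3, ← this, zero_mul]
    · simp
  have hinj : Function.Injective A := by
    rw [← LinearMap.ker_eq_bot, LinearMap.ker_eq_bot']
    intro x hx
    funext i
    have := key x i
    rw [hx] at this
    simp only [Pi.zero_apply, mul_zero, Finset.sum_const_zero] at this
    exact (mul_eq_zero.mp this.symm).resolve_left (by exact_mod_cast ha i)
  let A' := LinearEquiv.ofInjectiveOfFinrankEq A hinj (by
    rw [Module.finrank_fintype_fun_eq_card, Module.finrank_fintype_fun_eq_card, Fintype.card_fin,
      card_real_embeddings hF])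
  have hiso : (QuadraticMap.weightedSumSquares ℝ w₁).Equivalent
      (QuadraticMap.weightedSumSquares ℝ w₂) := by
    refine ⟨⟨A', fun x ↦ ?_⟩⟩
    change (QuadraticMap.weightedSumSquares ℝ w₂) (A x) = _
    rw [QuadraticMap.weightedSumSquares_apply, QuadraticMap.weightedSumSquares_apply]
    simp only [smul_eq_mul, w₁, w₂]
    have h3 : ∀ τ : F →+* ℝ, τ α * (A x τ * A x τ)
        = ∑ i, (τ α * τ (e i) * A x τ) * x i := fun τ ↦ by
      conv_lhs => rw [hA x τ, Finset.sum_mul, Finset.mul_sum]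
      refine Finset.sum_congr rfl fun i _ ↦ ?_
      rw [← hA]
      ring
    rw [Finset.sum_congr rfl fun τ _ ↦ h3 τ, Finset.sum_comm]
    refine Finset.sum_congr rfl fun i _ ↦ ?_
    rw [← Finset.sum_mul, key]
    ring
  have := hiso.sigPos_eq
  rw [QuadraticForm.sigPos_weightedSumSquares, QuadraticForm.sigPos_weightedSumSquares] at this
  simpa [w₁, w₂] using this

/-- The quadratic exponential attached to `α`. -/
noncomputable def gaussF (α : F) (x : F) : ℂ := addChar (Algebra.trace ℚ F (α * x ^ 2))

theorem gaussF_add (α x y : F) :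
    gaussF α (x + y) = gaussF α x * addChar (Algebra.trace ℚ F (2 * α * x * y)) * gaussF α y := by
  rw [gaussF, gaussF, gaussF, ← addChar_add, ← addChar_add, ← map_add, ← map_add]
  congr 2
  ring

theorem addChar_sum {ι : Type*} (s : Finset ι) (g : ι → ℚ) :
    addChar (∑ i ∈ s, g i) = ∏ i ∈ s, addChar (g i) := by
  classical
  induction s using Finset.induction_on with
  | empty => simpa using addChar_int 0
  | insert i s hi ih => rw [Finset.sum_insert hi, Finset.prod_insert hi, addChar_add, ih]

/-- Milgram's formula for the phase of a Gauss sum. -/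
theorem milgram (hF : ∀ τ : F →+* ℂ, ComplexEmbedding.IsReal τ) (α : F) (hα : α ≠ 0)
    (L : AddSubgroup (𝓞 F)) (h1 : ∀ l ∈ L, ∃ n : ℤ, Algebra.trace ℚ F (α * (l : F) ^ 2) = n)
    (h2 : ∀ x : 𝓞 F, ∀ l ∈ L, ∃ n : ℤ, Algebra.trace ℚ F (2 * α * x * l) = n)
    (h3 : ∀ x : F, (∀ l ∈ L, ∃ n : ℤ, Algebra.trace ℚ F (2 * α * x * l) = n) → IsIntegral ℤ x)
    (hfin : FinPer fun x : 𝓞 F ↦ gaussF α (x : F)) :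
    SamePhase (mean fun x : 𝓞 F ↦ gaussF α (x : F))
      (gaussPhase ^ {τ : F →+* ℝ | 0 < τ α}.ncard *
        starRingEnd ℂ gaussPhase ^ (Module.finrank ℚ F - {τ : F →+* ℝ | 0 < τ α}.ncard)) := by
  classical
  obtain ⟨e, a, ha, he, he', hO⟩ := exists_orthogonal α hα
  let Φ : (Fin (Module.finrank ℚ F) → ℤ) →+ F :=
    { toFun := fun n ↦ ∑ i, ((n i : ℚ) / (2 * a i) : ℚ) • e i
      map_zero' := by simp
      map_add' := fun n m ↦ by
        rw [← Finset.sum_add_distrib]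
        refine Finset.sum_congr rfl fun i _ ↦ ?_
        rw [← add_smul, ← add_div]
        push_cast [Pi.add_apply]
        rfl }
  have hΦ : ∀ n, Φ n = ∑ i, ((n i : ℚ) / (2 * a i) : ℚ) • e i := fun n ↦ rfl
  have hg : ∀ n, gaussF α (Φ n) = ∏ i, addChar ((n i : ℚ) ^ 2 / (4 * a i)) := fun n ↦ by
    have hin : ∀ i, Algebra.trace ℚ F (α * e i * Φ n) = n i / 2 := fun i ↦ by
      rw [hΦ, Finset.mul_sum, map_sum, Finset.sum_eq_single i]
      · rw [mul_smul_comm, map_smul, he, smul_eq_mul]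
        have : (a i : ℚ) ≠ 0 := by exact_mod_cast ha i
        field_simp
      · intro j _ hj
        rw [mul_smul_comm, map_smul, he' i j hj.symm, smul_zero]
      · simp
    rw [gaussF, ← addChar_sum]
    congr 1
    have : α * Φ n ^ 2 = ∑ i, ((n i : ℚ) / (2 * a i) : ℚ) • (α * e i * Φ n) := by
      have hy : ∀ y, α * Φ n * y = ∑ i, ((n i : ℚ) / (2 * a i) : ℚ) • (α * e i * y) := fun y ↦ by
        rw [hΦ, Finset.mul_sum, Finset.sum_mul]
        refine Finset.sum_congr rfl fun i _ ↦ ?_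
        rw [mul_smul_comm, smul_mul_assoc]
      rw [pow_two, ← mul_assoc, hy]
    rw [this, map_sum]
    refine Finset.sum_congr rfl fun i _ ↦ ?_
    rw [map_smul, hin, smul_eq_mul]
    have : (a i : ℚ) ≠ 0 := by exact_mod_cast ha i
    field_simp
    ring
  obtain ⟨hfp, hmean⟩ := mean_pi (fun i (n : ℤ) ↦ addChar ((n : ℚ) ^ 2 / (4 * a i)))
    fun i ↦ (mean_gauss (a i) (ha i)).1
  have hpos := ncard_pos_eq hF α e a ha he he'
  have hphase : SamePhase (∏ i, mean (fun n : ℤ ↦ addChar ((n : ℚ) ^ 2 / (4 * a i))))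
      (gaussPhase ^ {τ : F →+* ℝ | 0 < τ α}.ncard *
        starRingEnd ℂ gaussPhase ^ (Module.finrank ℚ F - {τ : F →+* ℝ | 0 < τ α}.ncard)) := by
    have hprod : ∏ i, (if 0 < a i then gaussPhase else starRingEnd ℂ gaussPhase)
        = gaussPhase ^ {τ : F →+* ℝ | 0 < τ α}.ncard *
        starRingEnd ℂ gaussPhase ^ (Module.finrank ℚ F - {τ : F →+* ℝ | 0 < τ α}.ncard) := by
      rw [Finset.prod_ite, Finset.prod_const, Finset.prod_const, ← hpos]
      have c1 : {i | 0 < a i}.ncard = (Finset.univ.filter fun i ↦ 0 < a i).card := by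
        rw [← Set.ncard_coe_finset]
        simp
      have c2 := Finset.card_filter_add_card_filter_not (s := Finset.univ) fun i ↦ 0 < a i
      rw [Finset.card_univ, Fintype.card_fin] at c2
      rw [c1]
      congr 2
      omega
    rw [← hprod]
    have : ∀ s : Finset (Fin (Module.finrank ℚ F)),
        SamePhase (∏ i ∈ s, mean (fun n : ℤ ↦ addChar ((n : ℚ) ^ 2 / (4 * a i))))
        (∏ i ∈ s, (if 0 < a i then gaussPhase else starRingEnd ℂ gaussPhase)) := fun s ↦ by
      induction s using Finset.induction_on with
      | empty => exact SamePhase.refl _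
      | insert i s hi ih =>
        rw [Finset.prod_insert hi, Finset.prod_insert hi]
        exact (mean_gauss (a i) (ha i)).2.mul ih
    exact this _
  rw [← hmean] at hphase
  simp only [← hg] at hphase hfp
  let O := (algebraMap (𝓞 F) F).toAddMonoidHom.range
  let M := O.comap Φ
  let L' := (L.map (algebraMap (𝓞 F) F).toAddMonoidHom).comap Φ
  have : M.FiniteIndex := by
    obtain ⟨D, hD0, hD⟩ := exists_integral_multiples ℤ ℚ
      (Finset.univ.image fun i ↦ ((1 : ℚ) / (2 * a i) : ℚ) • e i)
    have : NeZero D.natAbs := ⟨by simpa using hD0⟩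
    let π : (Fin (Module.finrank ℚ F) → ℤ) →+ (Fin (Module.finrank ℚ F) → ZMod D.natAbs) :=
      (RingHom.pi fun i ↦ (Int.castRingHom (ZMod D.natAbs)).comp
        (Pi.evalRingHom (fun _ ↦ ℤ) i)).toAddMonoidHom
    have hker : (⊥ : AddSubgroup (Fin (Module.finrank ℚ F) → ZMod D.natAbs)).FiniteIndex :=
      inferInstance
    have := finiteIndex_comap π ⊥
    refine AddSubgroup.finiteIndex_of_le (H := (⊥ : AddSubgroup _).comap π) fun n hn ↦ ?_
    have hdvd : ∀ i, D ∣ n i := fun i ↦ by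
      have h : ((n i : ℤ) : ZMod D.natAbs) = 0 := congrFun hn i
      rw [ZMod.intCast_zmod_eq_zero_iff_dvd] at h
      exact Int.natAbs_dvd.mp h
    choose m hm using hdvd
    have hint : IsIntegral ℤ (Φ n) := by
      rw [hΦ]
      refine IsIntegral.sum _ fun i _ ↦ ?_
      have h := (hD _ (Finset.mem_image_of_mem _ (Finset.mem_univ i))).smul (m i)
      have heq : ((n i : ℚ) / (2 * a i) : ℚ) • e i
          = m i • D • ((1 : ℚ) / (2 * a i) : ℚ) • e i := ?_
      · rw [heq]
        exact h
      rw [← Int.cast_smul_eq_zsmul ℚ, ← Int.cast_smul_eq_zsmul ℚ, smul_smul, smul_smul, hm]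
      congr 1
      push_cast
      ring
    exact ⟨⟨_, hint⟩, rfl⟩
  have hΦO : ∀ x : 𝓞 F, ∃ n, Φ n = x := fun x ↦ by
    obtain ⟨n, hn⟩ := hO x
    exact ⟨n, hn.symm⟩
  have hkey := mean_samePhase_of_average hfp L' M ?_ ?_
  · let φ : M →+ 𝓞 F := (AddMonoidHom.ofInjective
      (f := (algebraMap (𝓞 F) F).toAddMonoidHom) RingOfIntegers.coe_injective).symm.toAddMonoidHom.comp
      ((Φ.comp M.subtype).codRestrict O fun n ↦ n.2)
    have hφ : ∀ n, (φ n : F) = Φ n := fun n ↦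
      AddMonoidHom.apply_ofInjective_symm (f := (algebraMap (𝓞 F) F).toAddMonoidHom)
        RingOfIntegers.coe_injective ((Φ.comp M.subtype).codRestrict O (fun n ↦ n.2) n)
    have hφs : Function.Surjective φ := fun x ↦ by
      obtain ⟨n, hn⟩ := hΦO x
      exact ⟨⟨n, x, hn.symm⟩, RingOfIntegers.coe_injective ((hφ _).trans hn)⟩
    have := mean_comp_surj hfin φ hφs
    simp only [hφ] at this
    rw [this] at hkey
    exact hkey.symm.trans hphase
  · rintro n ⟨x, hx⟩ l ⟨y, hy, hl⟩
    have hx' : (x : F) = Φ n := hx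
    have hl' : (y : F) = Φ l := hl
    rw [map_add, gaussF_add, ← hx', ← hl']
    obtain ⟨k, hk⟩ := h2 x y hy
    obtain ⟨k', hk'⟩ := h1 y hy
    rw [hk, addChar_int, gaussF, gaussF, hk', addChar_int, mul_one, mul_one]
  · intro n hn
    have : ¬ ∀ l ∈ L, ∃ k : ℤ, Algebra.trace ℚ F (2 * α * Φ n * l) = k := fun h ↦
      hn ⟨⟨Φ n, h3 _ h⟩, rfl⟩
    push Not at this
    obtain ⟨y, hy, hny⟩ := this
    obtain ⟨t, ht⟩ := hΦO y
    refine ⟨t, ⟨y, hy, ht.symm⟩, addChar (Algebra.trace ℚ F (2 * α * Φ n * y)), ?_, ?_⟩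
    · rw [Ne, addChar_eq_one_iff]
      push Not
      exact hny
    · rintro l ⟨z, hz, hl⟩
      have hl' : (z : F) = Φ l := hl
      rw [map_add, gaussF_add, ht, map_add, ← hl']
      obtain ⟨k, hk⟩ := h2 z y hy
      obtain ⟨k', hk'⟩ := h1 y hy
      rw [mul_add, add_mul, map_add, addChar_add, hk, addChar_int]
      rw [show gaussF α (y : F) = 1 by rw [gaussF, hk', addChar_int]]
      ring

end Milgram

section GaussData

/-- A nondegenerate additive character `x ↦ e(Tr (κ x))` of a number field whose conductor is an
integral ideal prime to `2`. -/
structure GaussData (F : Type*) [Field F] [NumberField F] where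
  /-- The element defining the character. -/
  κ : F
  κ_ne : κ ≠ 0
  /-- The conductor. -/
  modulus : Ideal (𝓞 F)
  modulus_ne : modulus ≠ ⊥
  coprime : modulus ⊔ Ideal.span {2} = ⊤
  trace_int : ∀ z ∈ modulus, ∃ n : ℤ, Algebra.trace ℚ F (κ * z) = n
  dual : ∀ x : F, (∀ z ∈ modulus, ∃ n : ℤ, Algebra.trace ℚ F (κ * (x * z)) = n) → IsIntegral ℤ x

variable {F : Type*} [Field F] [NumberField F]

theorem exists_gaussData : Nonempty (GaussData F) := by
  classical
  set D := differentIdeal ℤ (𝓞 F) with hD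
  have hD0 : D ≠ ⊥ := differentIdeal_ne_bot
  have h2 : (Ideal.span {2} : Ideal (𝓞 F)) ≠ ⊥ := by
    rw [Ne, Ideal.span_singleton_eq_bot]
    exact two_ne_zero
  obtain ⟨k, hk, hk0⟩ : ∃ k, Ideal.span {2} * D ⊔ Ideal.span {k} = D ∧ k ≠ 0 := by
    obtain ⟨k, hk⟩ := IsDedekindDomain.exists_sup_span_eq
      (I := Ideal.span {2} * D) (J := D) Ideal.mul_le_right (mul_ne_zero h2 hD0)
    by_cases hk0 : k = 0
    · rw [hk0, Ideal.span_singleton_zero, sup_bot_eq] at hk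
      obtain ⟨d, hd, hd0⟩ := Submodule.exists_mem_ne_zero_of_ne_bot hD0
      exact ⟨d, by rw [hk, sup_eq_left, Ideal.span_singleton_le_iff_mem]; exact hd, hd0⟩
    · exact ⟨k, hk, hk0⟩
  have hkD : Ideal.span {k} ≤ D := hk ▸ le_sup_right
  obtain ⟨c, hc⟩ := Ideal.dvd_iff_le.mpr hkD
  have hkF : (k : F) ≠ 0 := by simpa using hk0
  have hdual : ∀ x : F, x ∈ FractionalIdeal.dual ℤ ℚ (1 : FractionalIdeal (𝓞 F)⁰ F) ↔
      ∀ y ∈ D, ∃ z : 𝓞 F, (z : F) = x * y := fun x ↦ by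
    have h := coeIdeal_differentIdeal ℤ ℚ F (𝓞 F)
    rw [← inv_inv (FractionalIdeal.dual ℤ ℚ (1 : FractionalIdeal (𝓞 F)⁰ F)), ← h,
      FractionalIdeal.mem_inv_iff (by simpa using hD0)]
    refine ⟨fun h y hy ↦ ?_, fun h y hy ↦ ?_⟩
    · obtain ⟨z, hz⟩ := (FractionalIdeal.mem_one_iff _).mp (h (y : F)
        (FractionalIdeal.mem_coeIdeal_of_mem _ hy))
      exact ⟨z, hz⟩
    · obtain ⟨w, hw, rfl⟩ := (FractionalIdeal.mem_coeIdeal _).mp hy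
      obtain ⟨z, hz⟩ := h w hw
      exact (FractionalIdeal.mem_one_iff _).mpr ⟨z, hz⟩
  have hc0 : c ≠ ⊥ := by
    rintro rfl
    rw [Ideal.mul_bot, Ideal.span_singleton_eq_bot] at hc
    exact hk0 hc
  have hint : ∀ z ∈ c, (z : F) / k ∈ FractionalIdeal.dual ℤ ℚ (1 : FractionalIdeal (𝓞 F)⁰ F) := by
    intro z hz
    rw [hdual]
    intro y hy
    have h : y * z ∈ Ideal.span {k} := hc ▸ Ideal.mul_mem_mul hy hz
    obtain ⟨w, hw⟩ := Ideal.mem_span_singleton'.mp h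
    refine ⟨w, ?_⟩
    have hw' : (w : F) * k = y * z := by exact_mod_cast congrArg (algebraMap (𝓞 F) F) hw
    field_simp
    rw [hw', mul_comm]
  have hint' : ∀ x ∈ FractionalIdeal.dual ℤ ℚ (1 : FractionalIdeal (𝓞 F)⁰ F), ∃ z ∈ c,
      x = (z : F) / k := by
    intro x hx
    rw [hdual] at hx
    obtain ⟨z, hz⟩ := hx k (hkD (Ideal.mem_span_singleton_self k))
    refine ⟨z, ?_, by rw [hz]; field_simp⟩
    have h : D * Ideal.span {z} ≤ D * c := by
      rw [← hc, Ideal.mul_le]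
      rintro y hy w hw
      obtain ⟨v, rfl⟩ := Ideal.mem_span_singleton'.mp hw
      obtain ⟨u, hu⟩ := hx y hy
      rw [Ideal.mem_span_singleton']
      refine ⟨u * v, RingOfIntegers.coe_injective ?_⟩
      simp only [map_mul]
      linear_combination (v : F) * k * hu - (y : F) * v * hz
    have h' : Ideal.span {z} ≤ c := by
      rw [← Ideal.dvd_iff_le] at h ⊢
      exact (mul_dvd_mul_iff_left hD0).mp h
    exact h' (Ideal.mem_span_singleton_self z)
  refine ⟨⟨(k : F)⁻¹, inv_ne_zero hkF, c, hc0, ?_, fun z hz ↦ ?_, fun x hx ↦ ?_⟩⟩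
  · have : D * (c ⊔ Ideal.span {2}) = D * ⊤ := by
      rw [Ideal.mul_sup, ← hc, sup_comm, mul_comm, hk, Ideal.mul_top]
    exact mul_left_cancel₀ hD0 this
  · have h := hint z hz
    rw [FractionalIdeal.mem_dual (one_ne_zero' (FractionalIdeal (𝓞 F)⁰ F))] at h
    obtain ⟨n, hn⟩ := h 1 (FractionalIdeal.one_mem_one _)
    refine ⟨n, ?_⟩
    have hn' : (n : ℚ) = _ := hn
    rw [hn', Algebra.traceForm_apply, mul_one, div_eq_inv_mul]
  · have h : x ∈ FractionalIdeal.dual ℤ ℚ (FractionalIdeal.dual ℤ ℚ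
        (1 : FractionalIdeal (𝓞 F)⁰ F)) := by
      rw [FractionalIdeal.mem_dual (by simp)]
      intro y hy
      obtain ⟨z, hz, rfl⟩ := hint' y hy
      obtain ⟨n, hn⟩ := hx z hz
      refine ⟨n, ?_⟩
      rw [Algebra.traceForm_apply, mul_div_assoc', div_eq_inv_mul, hn]
      rfl
    rw [FractionalIdeal.dual_dual, FractionalIdeal.mem_one_iff] at h
    obtain ⟨y, rfl⟩ := h
    exact RingOfIntegers.isIntegral_coe y

end GaussData

section GaussSums

variable {F : Type*} [Field F] [NumberField F]

theorem finiteIndex_toAddSubgroup (I : Ideal (𝓞 F)) (hI : I ≠ ⊥) :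
    (Submodule.toAddSubgroup I).FiniteIndex := by
  have : Finite (𝓞 F ⧸ I) := Ideal.finiteQuotientOfFreeOfNeBot I hI
  have h : Submodule.toAddSubgroup I = (Ideal.Quotient.mk I).toAddMonoidHom.ker := by
    ext x
    rw [AddMonoidHom.mem_ker]
    exact Ideal.Quotient.eq_zero_iff_mem.symm
  rw [h]
  exact AddSubgroup.finiteIndex_ker _

namespace GaussData

variable (d : GaussData F)

/-- The additive character attached to Gauss data. -/
noncomputable def psi (x : F) : ℂ := addChar (Algebra.trace ℚ F (d.κ * x))

theorem psi_add (x y : F) : d.psi (x + y) = d.psi x * d.psi y := by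
  rw [psi, mul_add, map_add, addChar_add, psi, psi]

theorem psi_neg (x : F) : d.psi (-x) = starRingEnd ℂ (d.psi x) := by
  rw [psi, mul_neg, map_neg, addChar_neg, psi]

theorem psi_of_mem {z : 𝓞 F} (hz : z ∈ d.modulus) : d.psi z = 1 := by
  obtain ⟨n, hn⟩ := d.trace_int z hz
  rw [psi, hn, addChar_int]

theorem psi_congr {x y : F} {z : 𝓞 F} (hz : z ∈ d.modulus) (h : x = y + z) :
    d.psi x = d.psi y := by
  rw [h, psi_add, d.psi_of_mem hz, mul_one]

theorem exists_coe_eq {x : F} (h : ∀ z ∈ d.modulus, d.psi (x * z) = 1) : ∃ y : 𝓞 F, (y : F) = x :=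
  ⟨⟨x, d.dual x fun z hz ↦ (addChar_eq_one_iff _).mp (h z hz)⟩, rfl⟩

theorem finPer_psi (q : F) : FinPer fun b : 𝓞 F ↦ d.psi (q * b ^ 2) := by
  obtain ⟨⟨n, m⟩, hq⟩ := IsLocalization.surj (𝓞 F)⁰ q
  have hq' : q * ((m : 𝓞 F) : F) = (n : F) := hq
  have := finiteIndex_toAddSubgroup (Ideal.span {(m : 𝓞 F)} * d.modulus)
    (mul_ne_zero (by simp) d.modulus_ne)
  refine FinPer.of_le (Submodule.toAddSubgroup (Ideal.span {(m : 𝓞 F)} * d.modulus))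
    fun t ht x ↦ ?_
  obtain ⟨z, hz, rfl⟩ := Ideal.mem_span_singleton_mul.mp ht
  refine d.psi_congr (z := n * (2 * x + m * z) * z) (d.modulus.mul_mem_left _ hz) ?_
  simp only [map_mul, map_add, map_ofNat]
  linear_combination (2 * (x : F) * z + ((m : 𝓞 F) : F) * (z : F) ^ 2) * hq'

/-- The normalized quadratic Gauss sum. -/
noncomputable def gs (q : F) : ℂ := mean fun b : 𝓞 F ↦ d.psi (q * b ^ 2)

theorem gs_milgram (hF : ∀ τ : F →+* ℂ, ComplexEmbedding.IsReal τ) (w : (𝓞 F)ˣ) {c : 𝓞 F}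
    (hc : c ≠ 0) : SamePhase (d.gs ((w : 𝓞 F) / (4 * c)))
      (gaussPhase ^ {τ : F →+* ℝ | 0 < τ (d.κ * ((w : 𝓞 F) / (4 * c)))}.ncard *
        starRingEnd ℂ gaussPhase ^ (Module.finrank ℚ F -
          {τ : F →+* ℝ | 0 < τ (d.κ * ((w : 𝓞 F) / (4 * c)))}.ncard)) := by
  have hcF : (c : F) ≠ 0 := by simpa using hc
  have hwF : ((w : 𝓞 F) : F) ≠ 0 := by simp
  have hα : d.κ * ((w : 𝓞 F) / (4 * c)) ≠ 0 := by
    have := d.κ_ne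
    exact mul_ne_zero this (div_ne_zero hwF (mul_ne_zero (by norm_num) hcF))
  have hg : ∀ x : 𝓞 F, gaussF (d.κ * ((w : 𝓞 F) / (4 * c))) (x : F)
      = d.psi ((w : 𝓞 F) / (4 * c) * x ^ 2) := fun x ↦ by
    rw [gaussF, psi, mul_assoc]
  have := milgram hF _ hα (Submodule.toAddSubgroup (Ideal.span {2 * c} * d.modulus)) ?_ ?_ ?_ ?_
  · simp only [hg] at this
    exact this
  · intro l hl
    obtain ⟨z, hz, rfl⟩ := Ideal.mem_span_singleton_mul.mp hl
    obtain ⟨n, hn⟩ := d.trace_int (w * c * z * z) (d.modulus.mul_mem_left _ hz)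
    refine ⟨n, hn ▸ congrArg _ ?_⟩
    simp only [map_mul, map_ofNat]
    field_simp
    ring
  · intro x l hl
    obtain ⟨z, hz, rfl⟩ := Ideal.mem_span_singleton_mul.mp hl
    obtain ⟨n, hn⟩ := d.trace_int (w * x * z) (d.modulus.mul_mem_left _ hz)
    refine ⟨n, hn ▸ congrArg _ ?_⟩
    simp only [map_mul, map_ofNat]
    field_simp
    ring
  · intro x hx
    have h : IsIntegral ℤ (((w : 𝓞 F) : F) * x) := by
      refine d.dual _ fun z hz ↦ ?_
      obtain ⟨n, hn⟩ := hx (2 * c * z) (Ideal.mem_span_singleton_mul.mpr ⟨z, hz, rfl⟩)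
      refine ⟨n, hn ▸ congrArg _ ?_⟩
      simp only [map_mul, map_ofNat]
      field_simp
      ring
    have h2 := (RingOfIntegers.isIntegral_coe ((w⁻¹ : (𝓞 F)ˣ) : 𝓞 F)).mul h
    have h3 : (((w⁻¹ : (𝓞 F)ˣ) : 𝓞 F) : F) * ((w : 𝓞 F) : F) = 1 := by
      rw [← map_mul, Units.inv_mul, map_one]
    rwa [← mul_assoc, h3, one_mul] at h2
  · simpa only [hg] using d.finPer_psi _

theorem gs_ne_zero (hF : ∀ τ : F →+* ℂ, ComplexEmbedding.IsReal τ) (w : (𝓞 F)ˣ) {c : 𝓞 F}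
    (hc : c ≠ 0) : d.gs ((w : 𝓞 F) / (4 * c)) ≠ 0 := by
  refine (d.gs_milgram hF w hc).ne_zero (mul_ne_zero (pow_ne_zero _ gaussPhase_ne_zero)
    (pow_ne_zero _ ?_))
  rw [Ne, map_eq_zero]
  exact gaussPhase_ne_zero

theorem gs_samePhase (hF : ∀ τ : F →+* ℂ, ComplexEmbedding.IsReal τ) (w w' : (𝓞 F)ˣ) {c c' : 𝓞 F}
    (hc : c ≠ 0) (hc' : c' ≠ 0)
    (h : ∀ τ : F →+* ℝ, 0 < τ ((w : 𝓞 F) * c * ((w' : 𝓞 F) * c'))) :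
    SamePhase (d.gs ((w : 𝓞 F) / (4 * c))) (d.gs ((w' : 𝓞 F) / (4 * c'))) := by
  have hset : {τ : F →+* ℝ | 0 < τ (d.κ * ((w : 𝓞 F) / (4 * c)))}
      = {τ : F →+* ℝ | 0 < τ (d.κ * ((w' : 𝓞 F) / (4 * c')))} := by
    ext τ
    have h1 := h τ
    have hcF : τ (c : F) ≠ 0 := by simpa using hc
    have hcF' : τ (c' : F) ≠ 0 := by simpa using hc'
    have hw : τ ((w : 𝓞 F) : F) ≠ 0 := by simp
    have hw' : τ ((w' : 𝓞 F) : F) ≠ 0 := by simp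
    simp only [Set.mem_ofPred_eq, map_mul, map_div₀, map_ofNat] at h1 ⊢
    have e1 : τ d.κ * (τ ((w : 𝓞 F) : F) / (4 * τ c))
        = τ d.κ * (τ ((w' : 𝓞 F) : F) / (4 * τ c')) *
        (τ ((w : 𝓞 F) : F) * τ c * (τ ((w' : 𝓞 F) : F) * τ c') /
          (τ ((w' : 𝓞 F) : F) * τ c) ^ 2) := by
      field_simp
    rw [e1]
    exact mul_pos_iff_of_pos_right (by positivity)
  have h1 := d.gs_milgram hF w hc
  rw [hset] at h1
  exact h1.trans (d.gs_milgram hF w' hc').symm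

theorem gs_decomp (w : 𝓞 F) {c t : 𝓞 F} (hc : c ≠ 0) (hc2 : IsCoprime c 2)
    (ht : t ∈ d.modulus) (htc : c ∣ t - 1) :
    d.gs (w / (4 * c)) = d.gs (w * c / 4) * d.gs (w * t ^ 2 / c) := by
  have hcF : (c : F) ≠ 0 := by simpa using hc
  let φ : 𝓞 F × 𝓞 F →+ 𝓞 F := (AddMonoidHom.mulLeft c).coprod (AddMonoidHom.mulLeft (2 * t))
  have hφ : ∀ x, φ x = c * x.1 + 2 * t * x.2 := fun x ↦ rfl
  have hcop : IsCoprime c (2 * t) := by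
    refine hc2.mul_right ?_
    obtain ⟨y, hy⟩ := htc
    exact ⟨-y, 1, by linear_combination hy⟩
  have hs : Function.Surjective φ := fun x ↦ by
    obtain ⟨a, b, hab⟩ := hcop
    exact ⟨(a * x, b * x), by rw [hφ]; linear_combination x * hab⟩
  rw [gs, ← mean_comp_surj (d.finPer_psi _) φ hs, gs, gs,
    ← mean_mul_prod (d.finPer_psi _) (d.finPer_psi _)]
  congr 1
  funext x
  rw [← psi_add]
  refine d.psi_congr (z := w * x.1 * x.2 * t) (d.modulus.mul_mem_left _ ht) ?_
  rw [hφ]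
  simp only [map_mul, map_add, map_ofNat]
  field_simp
  ring

theorem gs_eq_of_sq {u w s c t : 𝓞 F} (hc : c ≠ 0) (ht : t ∈ d.modulus) (h : c ∣ u - w * s ^ 2)
    (hs : IsCoprime s c) : d.gs (u * t ^ 2 / c) = d.gs (w * t ^ 2 / c) := by
  have hcF : (c : F) ≠ 0 := by simpa using hc
  rw [gs, gs, ← mean_comp (d.finPer_psi ((w : F) * t ^ 2 / c)) (AddMonoidHom.mulLeft s) ?_]
  · congr 1
    funext b
    obtain ⟨y, hy⟩ := h
    have hy' : (u : F) - w * s ^ 2 = c * y := by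
      exact_mod_cast congrArg (algebraMap (𝓞 F) F) hy
    refine d.psi_congr (z := y * t * b ^ 2 * t) (d.modulus.mul_mem_left _ ht) ?_
    change _ = (w : F) * t ^ 2 / c * ((s * b : 𝓞 F) : F) ^ 2 + _
    simp only [map_mul, map_pow]
    field_simp
    linear_combination (t : F) ^ 2 * b ^ 2 * hy'
  · rw [eq_top_iff]
    intro b _
    obtain ⟨p, q, hpq⟩ := hs
    have hb : b = s * (p * b) + c * (q * b) := by linear_combination -b * hpq
    rw [hb]
    refine AddSubgroup.add_mem_sup ⟨p * b, rfl⟩ fun x ↦ ?_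
    refine d.psi_congr (z := w * t * (2 * x + c * (q * b)) * (q * b) * t)
      (d.modulus.mul_mem_left _ ht) ?_
    simp only [map_mul, map_add, map_ofNat]
    field_simp
    ring

end GaussData
end GaussSums

section BinaryForms

open Polynomial in
theorem exists_sq_sub_mul_sq_field {k : Type*} [Field k] [Finite k] (h2 : (2 : k) ≠ 0) {v : k}
    (hv : v ≠ 0) (n : k) : ∃ x y : k, x ^ 2 - v * y ^ 2 = n := by
  have := Fintype.ofFinite k
  have hchar : ringChar k ≠ 2 := fun h ↦ h2 (by
    have := ringChar.Nat.cast_ringChar (R := k)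
    rw [h] at this
    exact_mod_cast this)
  obtain ⟨a, b, hab⟩ := FiniteField.exists_root_sum_quadratic (R := k) (f := X ^ 2 - C n)
    (g := C (-v) * X ^ 2) (degree_X_pow_sub_C two_pos n) (degree_C_mul_X_pow 2 (neg_ne_zero.mpr hv))
    (FiniteField.odd_card_of_char_ne_two hchar)
  refine ⟨a, b, ?_⟩
  simp only [eval_sub, eval_pow, eval_X, eval_C, eval_mul] at hab
  linear_combination hab

theorem exists_sq_eq_one_add {R : Type*} [CommRing R] (h2 : IsUnit (2 : R)) {μ : R}
    (hμ : IsNilpotent μ) : ∃ s : R, s ^ 2 = 1 + μ := by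
  obtain ⟨r, ⟨-, hr⟩, -⟩ := Polynomial.existsUnique_nilpotent_sub_and_aeval_eq_zero
    (P := (Polynomial.X ^ 2 - Polynomial.C (1 + μ) : Polynomial R)) (x := (1 : R))
    (by simpa using hμ) (by simpa [one_add_one_eq_two] using h2)
  refine ⟨r, ?_⟩
  simp only [map_sub, map_pow, Polynomial.aeval_X, Polynomial.aeval_C] at hr
  exact sub_eq_zero.mp hr

theorem exists_sq_sub_mul_sq {R : Type*} [CommRing R] [Finite R] (h2 : IsUnit (2 : R)) {v n : R}
    (hv : IsUnit v) (hn : IsUnit n) : ∃ x y : R, x ^ 2 - v * y ^ 2 = n := by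
  classical
  let N := nilradical R
  have hred : ∃ x y : R ⧸ N, x ^ 2 - Ideal.Quotient.mk N v * y ^ 2 = Ideal.Quotient.mk N n := by
    have : IsReduced (R ⧸ N) := (Ideal.isRadical_iff_quotient_reduced N).mp
      (Ideal.radical_isRadical _)
    let e := IsArtinianRing.equivPi (R ⧸ N)
    have h : ∀ m : MaximalSpectrum (R ⧸ N), ∃ x y : (R ⧸ N) ⧸ m.asIdeal,
        x ^ 2 - e (Ideal.Quotient.mk N v) m * y ^ 2 = e (Ideal.Quotient.mk N n) m := fun m ↦ by
      have := m.isMaximal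
      let := Ideal.Quotient.field m.asIdeal
      have : Finite (R ⧸ N) := Quotient.finite _
      have : Finite ((R ⧸ N) ⧸ m.asIdeal) := Quotient.finite _
      refine exists_sq_sub_mul_sq_field ?_ ?_ _
      · have h := h2.map (Ideal.Quotient.mk N)
        have h := (h.map (Ideal.Quotient.mk m.asIdeal)).ne_zero
        rwa [map_ofNat, map_ofNat] at h
      · have h := hv.map (Ideal.Quotient.mk N)
        exact (h.map (Ideal.Quotient.mk m.asIdeal)).ne_zero
    choose x y hxy using h
    refine ⟨e.symm x, e.symm y, e.injective (funext fun m ↦ ?_)⟩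
    have hx : e (e.symm x) = x := e.apply_symm_apply x
    have hy : e (e.symm y) = y := e.apply_symm_apply y
    rw [map_sub, map_mul, map_pow, map_pow, hx, hy]
    exact hxy m
  obtain ⟨x, y, hxy⟩ := hred
  obtain ⟨x, rfl⟩ := Ideal.Quotient.mk_surjective x
  obtain ⟨y, rfl⟩ := Ideal.Quotient.mk_surjective y
  rw [← map_pow, ← map_pow, ← map_mul, ← map_sub, Ideal.Quotient.eq] at hxy
  have hν : IsNilpotent (x ^ 2 - v * y ^ 2 - n) := hxy
  have hu : IsUnit (x ^ 2 - v * y ^ 2) := by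
    have := hν.isUnit_add_left_of_commute hn (Commute.all _ _)
    simpa using this
  obtain ⟨u, hu⟩ := hu
  obtain ⟨s, hs⟩ := exists_sq_eq_one_add h2 (μ := -((u⁻¹ : Rˣ) : R) * (x ^ 2 - v * y ^ 2 - n))
    (Commute.isNilpotent_mul_left (Commute.all _ _) hν)
  refine ⟨s * x, s * y, ?_⟩
  have hi : (u : R) * ((u⁻¹ : Rˣ) : R) = 1 := u.mul_inv
  rw [hu] at hi
  linear_combination (x ^ 2 - v * y ^ 2) * hs - (x ^ 2 - v * y ^ 2 - n) * hi

theorem sum_nonsquare_add_sum_square {k : Type*} [Field k] [Fintype k] (h2 : (2 : k) ≠ 0) {u : k}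
    (hu : ¬ IsSquare u) (h : k → ℂ) :
    ∑ x, h (u * x ^ 2) + ∑ x, h (1 * x ^ 2) = 2 * ∑ x, h x := by
  classical
  have hchar : ringChar k ≠ 2 := fun h ↦ h2 (by
    have := ringChar.Nat.cast_ringChar (R := k)
    rw [h] at this
    exact_mod_cast this)
  have hu0 : u ≠ 0 := fun h ↦ hu (h ▸ IsSquare.zero)
  have key : ∀ f : k → ℂ, ∑ x, f (x ^ 2) = ∑ a, ((quadraticChar k a : ℤ) + 1 : ℂ) * f a := by
    intro f
    rw [← Finset.sum_fiberwise' Finset.univ (fun x : k ↦ x ^ 2) f]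
    refine Finset.sum_congr rfl fun a _ ↦ ?_
    rw [Finset.sum_const, nsmul_eq_mul]
    congr 1
    have := quadraticChar_card_sqrts hchar a
    have h3 : (Finset.univ.filter fun x : k ↦ x ^ 2 = a) = {x : k | x ^ 2 = a}.toFinset := by
      ext x
      simp
    rw [h3]
    exact_mod_cast congrArg (Int.cast : ℤ → ℂ) this
  have h1 : ∑ x, h (u * x ^ 2) = ∑ a, (1 - (quadraticChar k a : ℤ) : ℂ) * h a := by
    rw [key fun x ↦ h (u * x)]
    refine Fintype.sum_equiv (Equiv.mulLeft₀ u hu0) _ _ fun a ↦ ?_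
    have : quadraticChar k u = -1 := quadraticChar_neg_one_iff_not_isSquare.mpr hu
    rw [show Equiv.mulLeft₀ u hu0 a = u * a from rfl, map_mul, this]
    push_cast
    ring
  simp only [one_mul]
  rw [h1, key, ← Finset.sum_add_distrib, Finset.mul_sum]
  exact Finset.sum_congr rfl fun a _ ↦ by ring

end BinaryForms

section GaussSumIdentities

variable {F : Type*} [Field F] [NumberField F]

namespace GaussData

variable (d : GaussData F)

theorem mul_sq_sub_sq_mem {c t z : 𝓞 F} (htc : c ∣ t - 1) (hz : z ∈ d.modulus) :
    ∃ y ∈ d.modulus, z = t ^ 2 * z + c * y := by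
  obtain ⟨y, hy⟩ := htc
  exact ⟨-(y * (t + 1)) * z, d.modulus.mul_mem_left _ hz, by linear_combination -z * (t + 1) * hy⟩

theorem gs_nonsquare {u c t : 𝓞 F} (hc : Prime c) (hc2 : IsCoprime c 2) (ht : t ∈ d.modulus)
    (htc : c ∣ t - 1) (hu : ¬ ∃ r, c ∣ r ^ 2 - u) :
    d.gs (u * t ^ 2 / c) = - d.gs ((1 : 𝓞 F) * t ^ 2 / c) := by
  classical
  have hcF : (c : F) ≠ 0 := by simpa using hc.ne_zero
  have hcb : Ideal.span {c} ≠ ⊥ := by simpa using hc.ne_zero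
  have hmax : (Ideal.span {c}).IsMaximal :=
    ((Ideal.span_singleton_prime hc.ne_zero).mpr hc).isMaximal hcb
  let π := Ideal.Quotient.mk (Ideal.span {c})
  have hπ : ∀ x y, π x = π y ↔ c ∣ x - y := fun x y ↦ by
    rw [Ideal.Quotient.eq, Ideal.mem_span_singleton]
  let := Ideal.Quotient.field (Ideal.span {c})
  have : Finite (𝓞 F ⧸ Ideal.span {c}) := Ideal.finiteQuotientOfFreeOfNeBot _ hcb
  have := Fintype.ofFinite (𝓞 F ⧸ Ideal.span {c})
  let h : 𝓞 F ⧸ Ideal.span {c} → ℂ := fun q ↦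
    d.psi ((t : F) ^ 2 * (q.out : 𝓞 F) / c)
  have hh : ∀ b : 𝓞 F, d.psi ((t : F) ^ 2 * b / c) = h (π b) := fun b ↦ by
    have : π (Quotient.out (π b)) = π b := Quotient.out_eq' (π b)
    obtain ⟨y, hy⟩ := (hπ _ _).mp this
    have hy' : ((Quotient.out (π b) : 𝓞 F) : F) - b = c * y := by
      exact_mod_cast congrArg (algebraMap (𝓞 F) F) hy
    refine d.psi_congr (z := -(t * y) * t) (d.modulus.mul_mem_left _ ht) ?_
    simp only [map_mul, map_neg]
    field_simp
    linear_combination -(t : F) ^ 2 * hy'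
  have hfin : FinPer fun b : 𝓞 F ↦ d.psi ((t : F) ^ 2 * b / c) :=
    FinPer.of_surj π.toAddMonoidHom h hh
  have hsum : ∑ q, h q = 0 := by
    have h1 := mean_eq_of_surj π.toAddMonoidHom Ideal.Quotient.mk_surjective h hh
    have h0 : mean (fun b : 𝓞 F ↦ d.psi ((t : F) ^ 2 * b / c)) = 0 := by
      obtain ⟨z, hz⟩ : ∃ z : 𝓞 F, d.psi ((t : F) ^ 2 * z / c) ≠ 1 := by
        by_contra! hall
        obtain ⟨y, hy⟩ := d.exists_coe_eq (x := (c : F)⁻¹) fun z hz ↦ by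
          obtain ⟨y, hy, hzy⟩ := d.mul_sq_sub_sq_mem htc hz
          rw [← hall z]
          refine d.psi_congr hy ?_
          have hzy' : (z : F) = t ^ 2 * z + c * y := by
            exact_mod_cast congrArg (algebraMap (𝓞 F) F) hzy
          field_simp
          linear_combination hzy'
        refine hc.not_isUnit (.of_mul_eq_one y (RingOfIntegers.coe_injective ?_))
        have hy' : algebraMap (𝓞 F) F y = (c : F)⁻¹ := hy
        rw [map_mul, hy', map_one]
        exact mul_inv_cancel₀ hcF
      refine mean_eq_zero hfin z _ hz fun x ↦ ?_
      rw [← psi_add]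
      congr 1
      simp only [map_add]
      ring
    rw [h0, eq_comm, div_eq_zero_iff] at h1
    exact h1.resolve_right (by simp)
  have hq : ∀ w : 𝓞 F, d.gs (w * t ^ 2 / c)
      = (∑ x, h (π w * x ^ 2)) / Fintype.card (𝓞 F ⧸ Ideal.span {c}) := fun w ↦ by
    refine mean_eq_of_surj π.toAddMonoidHom Ideal.Quotient.mk_surjective
      (fun x ↦ h (π w * x ^ 2)) fun b ↦ ?_
    have hb : h (π (w * b ^ 2)) = h (π w * π b ^ 2) := by rw [map_mul, map_pow]
    refine Eq.trans ?_ hb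
    rw [← hh]
    congr 1
    simp only [map_mul, map_pow]
    ring
  have h2 : (2 : 𝓞 F ⧸ Ideal.span {c}) ≠ 0 := fun h0 ↦ by
    have h3 : c ∣ 2 := Ideal.mem_span_singleton.mp (Ideal.Quotient.eq_zero_iff_mem.mp h0)
    exact hc.not_isUnit (hc2.isUnit_of_dvd' dvd_rfl h3)
  have hu' : ¬ IsSquare (π u) := fun ⟨r, hr⟩ ↦ by
    obtain ⟨r, rfl⟩ := Ideal.Quotient.mk_surjective r
    refine hu ⟨r, (hπ _ _).mp ?_⟩
    rw [map_pow, pow_two]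
    exact hr.symm
  have h5 := sum_nonsquare_add_sum_square h2 hu' h
  rw [hsum, mul_zero] at h5
  rw [hq, hq, eq_neg_iff_add_eq_zero, ← add_div, map_one, h5, zero_div]

theorem gs_of_square_ideal {w c t : 𝓞 F} {b : Ideal (𝓞 F)} (hc : c ≠ 0)
    (hb : Ideal.span {c} = b ^ 2) (hc2 : IsCoprime c 2) (hw : IsCoprime w c)
    (ht : t ∈ d.modulus) (htc : c ∣ t - 1) : SamePhase (d.gs (w * t ^ 2 / c)) 1 := by
  have hcF : (c : F) ≠ 0 := by simpa using hc
  have hb0 : b ≠ ⊥ := by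
    rintro rfl
    rw [← Ideal.zero_eq_bot, zero_pow two_ne_zero, Ideal.zero_eq_bot,
      Ideal.span_singleton_eq_bot] at hb
    exact hc hb
  have := finiteIndex_toAddSubgroup b hb0
  have hdvd : ∀ {x y}, x ∈ b → y ∈ b → ∃ z, x * y = c * z := fun {x y} hx hy ↦ by
    have : x * y ∈ Ideal.span {c} := hb ▸ pow_two b ▸ Ideal.mul_mem_mul hx hy
    exact Ideal.mem_span_singleton.mp this
  have hmean := mean_samePhase_of_average (d.finPer_psi ((w : F) * t ^ 2 / c))
    (Submodule.toAddSubgroup b) (Submodule.toAddSubgroup b) ?_ ?_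
  · refine hmean.trans ?_
    have : (fun x : Submodule.toAddSubgroup b ↦ d.psi ((w : F) * t ^ 2 / c * ((x : 𝓞 F) : F) ^ 2))
        = fun _ ↦ 1 := by
      funext ⟨x, hx⟩
      obtain ⟨z, hz⟩ := hdvd hx hx
      have hz' : (x : F) * x = c * z := by exact_mod_cast congrArg (algebraMap (𝓞 F) F) hz
      have h1 : (w : F) * t ^ 2 / c * (x : F) ^ 2 = ((w * z * t * t : 𝓞 F) : F) := by
        simp only [map_mul]
        field_simp
        linear_combination (w : F) * t ^ 2 * hz'
      simp only [h1]
      exact d.psi_of_mem (d.modulus.mul_mem_left _ ht)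
    rw [this, mean_const]
    exact SamePhase.refl 1
  · intro x hx l hl
    obtain ⟨z, hz⟩ := hdvd (b.add_mem (b.add_mem hx hx) hl) hl
    have hz' : ((x : F) + x + l) * l = c * z := by
      exact_mod_cast congrArg (algebraMap (𝓞 F) F) hz
    refine d.psi_congr (z := w * t * z * t) (d.modulus.mul_mem_left _ ht) ?_
    simp only [map_mul, map_add]
    field_simp
    linear_combination (w : F) * t ^ 2 * hz'
  · intro x hx
    obtain ⟨τ, hτ, hne⟩ : ∃ τ ∈ b, d.psi ((w : F) * t ^ 2 / c * (2 * x * τ)) ≠ 1 := by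
      by_contra! hall
      refine hx ?_
      have hmem : ∀ τ ∈ b, c ∣ 2 * w * x * τ := fun τ hτ ↦ by
        obtain ⟨y, hy⟩ := d.exists_coe_eq (x := (2 * w * x * τ : F) / c) fun z hz ↦ by
          obtain ⟨y, hy, hzy⟩ := d.mul_sq_sub_sq_mem htc hz
          rw [← hall (τ * z) (b.mul_mem_right _ hτ)]
          refine d.psi_congr (z := 2 * w * x * τ * y) (d.modulus.mul_mem_left _ hy) ?_
          have hzy' : (z : F) = t ^ 2 * z + c * y := by
            exact_mod_cast congrArg (algebraMap (𝓞 F) F) hzy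
          simp only [map_mul, map_ofNat]
          field_simp
          linear_combination (w : F) * x * τ * hzy'
        refine ⟨y, RingOfIntegers.coe_injective ?_⟩
        have hy' : algebraMap (𝓞 F) F y = (2 * w * x * τ : F) / c := hy
        simp only [map_mul, map_ofNat]
        rw [hy']
        field_simp
      have hle : Ideal.span {2 * w * x} * b ≤ b * b := by
        rw [← pow_two, ← hb, Ideal.span_singleton_mul_le_iff]
        intro τ hτ
        exact Ideal.mem_span_singleton.mpr (hmem τ hτ)
      have hle' : Ideal.span {2 * w * x} ≤ b := by
        rw [← Ideal.dvd_iff_le] at hle ⊢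
        exact (mul_dvd_mul_iff_right hb0).mp hle
      have hxb : 2 * w * x ∈ b := hle' (Ideal.mem_span_singleton_self _)
      obtain ⟨p, q, hpq⟩ : IsCoprime (2 * w) c := hc2.symm.mul_left hw
      have hcb : c ∈ b := by
        have : c ∈ b ^ 2 := hb ▸ Ideal.mem_span_singleton_self c
        exact Ideal.pow_le_self two_ne_zero this
      have : x = p * (2 * w * x) + q * x * c := by linear_combination -x * hpq
      rw [this]
      exact b.add_mem (b.mul_mem_left _ hxb) (b.mul_mem_left _ hcb)
    refine ⟨τ, hτ, _, hne, fun l hl ↦ ?_⟩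
    rw [← psi_add]
    obtain ⟨z, hz⟩ := hdvd (b.add_mem (b.add_mem hl hl) hτ) hτ
    have hz' : ((l : F) + l + τ) * τ = c * z := by
      exact_mod_cast congrArg (algebraMap (𝓞 F) F) hz
    refine d.psi_congr (z := w * t * z * t) (d.modulus.mul_mem_left _ ht) ?_
    simp only [map_mul, map_add]
    field_simp
    linear_combination (w : F) * t ^ 2 * hz'

theorem gs_mul {c z t : 𝓞 F} (hc : c ≠ 0) (hz : z ≠ 0) (hcz : IsCoprime c z) (ht : t ∈ d.modulus) :
    d.gs ((1 : 𝓞 F) * t ^ 2 / (c * z : 𝓞 F)) = d.gs (c * t ^ 2 / z) * d.gs (z * t ^ 2 / c) := by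
  have hcF : (c : F) ≠ 0 := by simpa using hc
  have hzF : (z : F) ≠ 0 := by simpa using hz
  let φ : 𝓞 F × 𝓞 F →+ 𝓞 F := (AddMonoidHom.mulLeft c).coprod (AddMonoidHom.mulLeft z)
  have hφ : ∀ x, φ x = c * x.1 + z * x.2 := fun x ↦ rfl
  have hs : Function.Surjective φ := fun x ↦ by
    obtain ⟨a, b, hab⟩ := hcz
    exact ⟨(a * x, b * x), by rw [hφ]; linear_combination x * hab⟩
  rw [gs, ← mean_comp_surj (d.finPer_psi _) φ hs, gs, gs,
    ← mean_mul_prod (d.finPer_psi _) (d.finPer_psi _)]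
  congr 1
  funext x
  rw [← psi_add]
  refine d.psi_congr (z := 2 * x.1 * x.2 * t * t) (d.modulus.mul_mem_left _ ht) ?_
  rw [hφ]
  simp only [map_mul, map_add, map_ofNat, map_one]
  field_simp
  ring

theorem gs_neg (q : F) : d.gs (-q) = starRingEnd ℂ (d.gs q) := by
  rw [gs, gs, ← mean_conj (d.finPer_psi q)]
  congr 1
  funext b
  rw [← psi_neg, neg_mul]

/-- Multiplication by norms from `F(√v)` does not change `A(w) * conj A(v w)`. -/
theorem gs_mul_conj_eq {w w' v x y z p : 𝓞 F} (hz : z ∈ d.modulus)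
    (h : w' - w * (x ^ 2 - v * y ^ 2) = 4 * z)
    (hp : p * (x ^ 2 - v * y ^ 2) - 1 ∈ Ideal.span {4} * d.modulus) :
    d.gs (w' / 4) * starRingEnd ℂ (d.gs (v * w' / 4))
      = d.gs (w / 4) * starRingEnd ℂ (d.gs (v * w / 4)) := by
  rw [← gs_neg, ← gs_neg, gs, gs, gs, gs, ← mean_mul_prod (d.finPer_psi _) (d.finPer_psi _),
    ← mean_mul_prod (d.finPer_psi _) (d.finPer_psi _)]
  let φ : 𝓞 F × 𝓞 F →+ 𝓞 F × 𝓞 F :=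
    ((AddMonoidHom.mulLeft x).coprod (AddMonoidHom.mulLeft (v * y))).prod
      ((AddMonoidHom.mulLeft y).coprod (AddMonoidHom.mulLeft x))
  have hφ : ∀ a, φ a = (x * a.1 + v * y * a.2, y * a.1 + x * a.2) := fun a ↦ rfl
  rw [← mean_comp ((d.finPer_psi ((w : F) / 4)).prod (d.finPer_psi (-((v : F) * w / 4)))) φ ?_]
  · congr 1
    funext a
    rw [← psi_add, ← psi_add]
    refine d.psi_congr (z := (a.1 ^ 2 - v * a.2 ^ 2) * z) (d.modulus.mul_mem_left _ hz) ?_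
    have h' : (w' : F) - w * (x ^ 2 - v * y ^ 2) = 4 * z := by
      have := congrArg (algebraMap (𝓞 F) F) h
      simpa only [map_sub, map_mul, map_pow, map_ofNat] using this
    rw [hφ]
    simp only [map_sub, map_mul, map_pow, map_add]
    linear_combination ((a.1 : F) ^ 2 - v * (a.2 : F) ^ 2) / 4 * h'
  · rw [eq_top_iff]
    rintro a -
    obtain ⟨q, hq, hpq⟩ := Ideal.mem_span_singleton_mul.mp hp
    have ha : a = φ (p * (x * a.1 - v * y * a.2), p * (-(y * a.1) + x * a.2))
        + (4 * (-q * a.1), 4 * (-q * a.2)) := by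
      rw [hφ]
      ext1
      · change a.1 = _ + _
        linear_combination a.1 * hpq
      · change a.2 = _ + _
        linear_combination a.2 * hpq
    rw [ha]
    refine AddSubgroup.add_mem_sup ⟨_, rfl⟩ fun b ↦ ?_
    have e1 : ∀ r s m n : 𝓞 F, d.psi ((r : F) / 4 * ((m + 4 * (-q * n) : 𝓞 F) : F) ^ 2)
        = d.psi ((r : F) / 4 * (m : F) ^ 2) := fun r s m n ↦ by
      refine d.psi_congr (z := r * (-2 * m * n + 4 * n ^ 2 * q) * q) (d.modulus.mul_mem_left _ hq) ?_
      simp only [map_mul, map_pow, map_add, map_neg, map_ofNat]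
      ring
    have e2 : -((v : F) * w / 4) = ((-(v * w) : 𝓞 F) : F) / 4 := by
      simp only [map_neg, map_mul]
      ring
    change d.psi _ * d.psi _ = _
    rw [e2]
    exact congrArg₂ (· * ·) (e1 w 0 b.1 a.1) (e1 (-(v * w)) 0 b.2 a.2)

end GaussData
end GaussSumIdentities

section Reciprocity

variable {F : Type*} [Field F] [NumberField F]

theorem SamePhase.mul_conj_of_mul {a b g g' : ℂ} (hb : b ≠ 0) (hg : g ≠ 0)
    (h : SamePhase (a * g) (b * g')) :
    SamePhase (a * starRingEnd ℂ b) (g' * starRingEnd ℂ g) := by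
  obtain ⟨r, hr, h⟩ := h
  refine ⟨r * Complex.normSq b / Complex.normSq g, div_pos (mul_pos hr
    (Complex.normSq_pos.mpr hb)) (Complex.normSq_pos.mpr hg), ?_⟩
  have hg' : (Complex.normSq g : ℂ) ≠ 0 := by exact_mod_cast (Complex.normSq_pos.mpr hg).ne'
  push_cast
  rw [div_mul_eq_mul_div, eq_div_iff hg', Complex.normSq_eq_conj_mul_self,
    Complex.normSq_eq_conj_mul_self]
  linear_combination starRingEnd ℂ b * starRingEnd ℂ g * h

namespace GaussData

variable (d : GaussData F)

/-- The level of the Gauss sums `gs (w / 4)`. -/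
def level : Ideal (𝓞 F) := Ideal.span {4} * d.modulus

/-- Being coprime to the level. -/
def Cop (w : 𝓞 F) : Prop := IsUnit (Ideal.Quotient.mk d.level w)

variable {d}

theorem cop_iff {w : 𝓞 F} : d.Cop w ↔ ∃ p, p * w - 1 ∈ d.level := by
  rw [Cop, isUnit_iff_exists_inv']
  constructor
  · rintro ⟨b, hb⟩
    obtain ⟨b, rfl⟩ := Ideal.Quotient.mk_surjective b
    exact ⟨b, by rwa [← map_mul, ← map_one (Ideal.Quotient.mk d.level), Ideal.Quotient.eq] at hb⟩
  · rintro ⟨p, hp⟩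
    exact ⟨Ideal.Quotient.mk _ p, by
      rwa [← map_mul, ← map_one (Ideal.Quotient.mk d.level), Ideal.Quotient.eq]⟩

theorem Cop.mul {w z : 𝓞 F} (hw : d.Cop w) (hz : d.Cop z) : d.Cop (w * z) := by
  rw [Cop, map_mul]
  exact IsUnit.mul hw hz

theorem cop_unit (u : (𝓞 F)ˣ) : d.Cop (u : 𝓞 F) := u.isUnit.map _

theorem cop_one : d.Cop 1 := cop_unit 1

theorem level_le_modulus : d.level ≤ d.modulus := Ideal.mul_le_right

theorem level_le_four : d.level ≤ Ideal.span {4} := Ideal.mul_le_left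

theorem level_ne : d.level ≠ ⊥ := mul_ne_zero (by simp) d.modulus_ne

theorem Cop.isCoprime_two {w : 𝓞 F} (hw : d.Cop w) : IsCoprime w 2 := by
  obtain ⟨p, hp⟩ := cop_iff.mp hw
  obtain ⟨y, hy⟩ := Ideal.mem_span_singleton.mp (level_le_four hp)
  exact ⟨p, -2 * y, by linear_combination hy⟩

theorem Cop.exists_mem {w : 𝓞 F} (hw : d.Cop w) : ∃ t ∈ d.modulus, w ∣ t - 1 := by
  obtain ⟨p, hp⟩ := cop_iff.mp hw
  exact ⟨_, d.modulus.neg_mem (level_le_modulus hp), -p, by ring⟩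

theorem Cop.isUnit_mk {w : 𝓞 F} (hw : d.Cop w) {I : Ideal (𝓞 F)} (h : d.level ≤ I) :
    IsUnit (Ideal.Quotient.mk I w) := by
  have := IsUnit.map (Ideal.Quotient.factor h) hw
  rwa [Ideal.Quotient.factor_mk] at this

theorem isUnit_two : IsUnit (2 : 𝓞 F ⧸ d.modulus) := by
  obtain ⟨a, ha, b, hb, hab⟩ := Submodule.mem_sup.mp (d.coprime ▸ Submodule.mem_top :
    (1 : 𝓞 F) ∈ d.modulus ⊔ Ideal.span {2})
  obtain ⟨c, rfl⟩ := Ideal.mem_span_singleton.mp hb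
  refine IsUnit.of_mul_eq_one (Ideal.Quotient.mk _ c) ?_
  rw [← map_ofNat (Ideal.Quotient.mk d.modulus) 2, ← map_mul,
    ← map_one (Ideal.Quotient.mk d.modulus), Ideal.Quotient.eq]
  rw [← hab]
  simpa using ha

theorem isCoprime_four : IsCoprime (Ideal.span {(4 : 𝓞 F)}) d.modulus := by
  have h : IsCoprime (Ideal.span {(2 : 𝓞 F)}) d.modulus := by
    rw [Ideal.isCoprime_iff_sup_eq, sup_comm]
    exact d.coprime
  have h4 : Ideal.span {(4 : 𝓞 F)} = Ideal.span {2} * Ideal.span {2} := by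
    rw [Ideal.span_singleton_mul_span_singleton]
    norm_num
  rw [h4]
  exact h.mul_left h

theorem gs_mul_conj_eq_of_sq {w w' v s : 𝓞 F} (hw : d.Cop w) (hw' : d.Cop w') (hv : d.Cop v)
    (h : w' - w * s ^ 2 ∈ Ideal.span {4}) :
    d.gs (w' / 4) * starRingEnd ℂ (d.gs (v * w' / 4))
      = d.gs (w / 4) * starRingEnd ℂ (d.gs (v * w / 4)) := by
  have : Finite (𝓞 F ⧸ d.modulus) := Ideal.finiteQuotientOfFreeOfNeBot _ d.modulus_ne
  obtain ⟨p, hp⟩ := cop_iff.mp hw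
  obtain ⟨p', hp'⟩ := cop_iff.mp hw'
  have hpc : d.Cop p := cop_iff.mpr ⟨w, by rwa [mul_comm]⟩
  obtain ⟨x, y, hxy⟩ := exists_sq_sub_mul_sq (isUnit_two (d := d))
    (hv.isUnit_mk level_le_modulus) ((hw'.mul hpc).isUnit_mk level_le_modulus)
  obtain ⟨x, rfl⟩ := Ideal.Quotient.mk_surjective x
  obtain ⟨y, rfl⟩ := Ideal.Quotient.mk_surjective y
  obtain ⟨e, he, f, hf, hef⟩ := Ideal.isCoprime_iff_exists.mp (isCoprime_four (d := d))
  have h1 : x ^ 2 - v * y ^ 2 - w' * p ∈ d.modulus := by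
    rw [← Ideal.Quotient.eq]
    simpa only [map_sub, map_mul, map_pow] using hxy
  have hlev : w' - w * ((x * e + s * f) ^ 2 - v * (y * e) ^ 2) ∈ d.level := by
    rw [level, Ideal.mul_eq_inf_of_isCoprime isCoprime_four]
    constructor
    · have : w' - w * ((x * e + s * f) ^ 2 - v * (y * e) ^ 2)
          = (w' - w * s ^ 2) + (w * s ^ 2 * (1 + f)
            - w * (x ^ 2 * e + 2 * x * s * f - v * y ^ 2 * e)) * e := by
        linear_combination -w * s ^ 2 * (1 + f) * hef
      rw [this]
      exact Ideal.add_mem _ h (Ideal.mul_mem_left _ _ he)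
    · have : w' - w * ((x * e + s * f) ^ 2 - v * (y * e) ^ 2)
          = -w * (x ^ 2 - v * y ^ 2 - w' * p) - w' * (p * w - 1)
            + (w * (x ^ 2 - v * y ^ 2) * (1 + e) - w * (2 * x * e * s + s ^ 2 * f)) * f := by
        linear_combination -w * (x ^ 2 - v * y ^ 2) * (1 + e) * hef
      rw [this]
      exact d.modulus.add_mem (d.modulus.sub_mem (d.modulus.mul_mem_left _ h1)
        (d.modulus.mul_mem_left _ (level_le_modulus hp))) (d.modulus.mul_mem_left _ hf)
  obtain ⟨z, hz, hz4⟩ := Ideal.mem_span_singleton_mul.mp hlev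
  refine d.gs_mul_conj_eq hz hz4.symm (p := p' * w) ?_
  have : p' * w * ((x * e + s * f) ^ 2 - v * (y * e) ^ 2) - 1
      = (p' * w' - 1) - p' * (w' - w * ((x * e + s * f) ^ 2 - v * (y * e) ^ 2)) := by ring
  rw [this]
  exact d.level.sub_mem hp' (d.level.mul_mem_left _ hlev)

section TotallyPositive

variable (hF : ∀ τ : F →+* ℂ, ComplexEmbedding.IsReal τ) {γ : (𝓞 F)ˣ}
  (hγ : ∀ τ : F →+* ℝ, 0 < τ (γ : 𝓞 F))

include hF in
theorem gs_one_ne_zero {c t : 𝓞 F} (hc : c ≠ 0) (hc2 : IsCoprime c 2) (ht : t ∈ d.modulus)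
    (htc : c ∣ t - 1) : d.gs ((1 : 𝓞 F) * t ^ 2 / c) ≠ 0 := by
  have h1 := d.gs_ne_zero hF 1 hc
  rw [Units.val_one, d.gs_decomp 1 hc hc2 ht htc] at h1
  exact right_ne_zero_of_mul h1

include hF hγ in
theorem gs_mul_conj_samePhase {c t : 𝓞 F} (hc : c ≠ 0) (hc2 : IsCoprime c 2) (ht : t ∈ d.modulus)
    (htc : c ∣ t - 1) : SamePhase (d.gs (c / 4) * starRingEnd ℂ (d.gs ((γ : 𝓞 F) * c / 4)))
      (d.gs ((γ : 𝓞 F) * t ^ 2 / c) * starRingEnd ℂ (d.gs ((1 : 𝓞 F) * t ^ 2 / c))) := by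
  have h := d.gs_samePhase hF 1 γ hc hc fun τ ↦ by
    have hcF : τ (c : F) ≠ 0 := by simpa using hc
    have := hγ τ
    have e : ((1 : (𝓞 F)ˣ) : 𝓞 F) * (c : F) * ((γ : 𝓞 F) * c) = (γ : 𝓞 F) * c ^ 2 := by
      simp only [Units.val_one, map_one]
      ring
    rw [e, map_mul, map_pow]
    positivity
  have h0 := d.gs_ne_zero hF γ hc
  have h1 := gs_one_ne_zero hF hc hc2 ht htc
  rw [Units.val_one, d.gs_decomp 1 hc hc2 ht htc, d.gs_decomp γ hc hc2 ht htc] at h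
  rw [d.gs_decomp γ hc hc2 ht htc] at h0
  have := h.mul_conj_of_mul (left_ne_zero_of_mul h0) h1
  simp only [map_one, one_mul] at this ⊢
  exact this

include hF hγ in
theorem gs_mul_conj_of_square {c : 𝓞 F} (hc : Prime c) (hcop : d.Cop c)
    (h : ∃ r, c ∣ r ^ 2 - (γ : 𝓞 F)) :
    SamePhase (d.gs (c / 4) * starRingEnd ℂ (d.gs ((γ : 𝓞 F) * c / 4))) 1 := by
  obtain ⟨t, ht, htc⟩ := hcop.exists_mem
  obtain ⟨r, y, hr⟩ := h
  have h1 := gs_mul_conj_samePhase hF hγ hc.ne_zero hcop.isCoprime_two ht htc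
  rw [d.gs_eq_of_sq (w := 1) (s := r) hc.ne_zero ht ⟨-y, by linear_combination -hr⟩
    ⟨(γ⁻¹ : (𝓞 F)ˣ) * r, -(γ⁻¹ : (𝓞 F)ˣ) * y, by
      linear_combination ((γ⁻¹ : (𝓞 F)ˣ) : 𝓞 F) * hr + γ.inv_mul⟩] at h1
  exact h1.trans (SamePhase.mul_conj (gs_one_ne_zero hF hc.ne_zero hcop.isCoprime_two ht htc))

include hF hγ in
theorem gs_mul_conj_of_nonsquare {c : 𝓞 F} (hc : Prime c) (hcop : d.Cop c)
    (h : ¬ ∃ r, c ∣ r ^ 2 - (γ : 𝓞 F)) :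
    SamePhase (d.gs (c / 4) * starRingEnd ℂ (d.gs ((γ : 𝓞 F) * c / 4))) (-1) := by
  obtain ⟨t, ht, htc⟩ := hcop.exists_mem
  have h1 := gs_mul_conj_samePhase hF hγ hc.ne_zero hcop.isCoprime_two ht htc
  rw [d.gs_nonsquare hc hcop.isCoprime_two ht htc h] at h1
  refine h1.trans ?_
  obtain ⟨r, hr, h2⟩ := SamePhase.mul_conj
    (gs_one_ne_zero hF hc.ne_zero hcop.isCoprime_two ht htc)
  exact ⟨r, hr, by linear_combination -h2⟩

include hF hγ in
theorem gs_mul_conj_of_square_ideal {z : 𝓞 F} {b : Ideal (𝓞 F)} (hz : z ≠ 0)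
    (hb : Ideal.span {z} = b ^ 2) (hcop : d.Cop z) :
    SamePhase (d.gs (z / 4) * starRingEnd ℂ (d.gs ((γ : 𝓞 F) * z / 4))) 1 := by
  obtain ⟨t, ht, htc⟩ := hcop.exists_mem
  refine (gs_mul_conj_samePhase hF hγ hz hcop.isCoprime_two ht htc).trans ?_
  have h1 := (d.gs_of_square_ideal (w := γ) hz hb hcop.isCoprime_two
    (⟨(γ⁻¹ : (𝓞 F)ˣ), 0, by rw [γ.inv_mul]; ring⟩) ht htc).mul
    (d.gs_of_square_ideal hz hb hcop.isCoprime_two isCoprime_one_left ht htc).conj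
  rwa [map_one, mul_one] at h1

include hF hγ in
/-- A totally positive unit is a square modulo every prime element congruent to a square multiple
of a generator of a square ideal. -/
theorem exists_dvd_sq_sub_of_square_ideal {c z s : 𝓞 F} {b : Ideal (𝓞 F)} (hz : z ≠ 0)
    (hb : Ideal.span {z} = b ^ 2) (hzcop : d.Cop z) (hc : Prime c) (hcop : d.Cop c)
    (h : c - z * s ^ 2 ∈ Ideal.span {4}) : ∃ r, c ∣ r ^ 2 - (γ : 𝓞 F) := by
  by_contra hr
  have h1 := gs_mul_conj_of_nonsquare hF hγ hc hcop hr
  rw [gs_mul_conj_eq_of_sq hzcop hcop (cop_unit γ) h] at h1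
  exact SamePhase.not_neg one_ne_zero
    ((gs_mul_conj_of_square_ideal hF hγ hz hb hzcop).symm.trans h1)

include hF hγ in
/-- Whether a totally positive unit is a square modulo a prime element only depends on the class
of this prime element modulo `4`, squares and units. -/
theorem exists_dvd_sq_sub_of_congr {c c' s : 𝓞 F} (η : (𝓞 F)ˣ) (hc : Prime c) (hcop : d.Cop c)
    (hc' : Prime c') (hcop' : d.Cop c') (h : c' - c * η * s ^ 2 ∈ Ideal.span {4})
    (hr : ∃ r, c ∣ r ^ 2 - (γ : 𝓞 F)) : ∃ r, c' ∣ r ^ 2 - (γ : 𝓞 F) := by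
  by_contra hr'
  have hass : Associated c (c * η) := ⟨η, rfl⟩
  have h1 := gs_mul_conj_of_nonsquare hF hγ hc' hcop' hr'
  rw [gs_mul_conj_eq_of_sq (hcop.mul (cop_unit η)) hcop' (cop_unit γ) h] at h1
  obtain ⟨r, hr⟩ := hr
  exact SamePhase.not_neg one_ne_zero ((gs_mul_conj_of_square hF hγ (hass.prime hc)
    (hcop.mul (cop_unit η)) ⟨r, hass.symm.dvd.trans hr⟩).symm.trans h1)

include hF in
/-- A generator of a square ideal which is a square modulo `4` is a square modulo every totally
positive prime element. -/
theorem exists_dvd_sq_sub_of_totallyPositive {c z s : 𝓞 F} {b : Ideal (𝓞 F)} (hz : z ≠ 0)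
    (hb : Ideal.span {z} = b ^ 2) (hzcop : d.Cop z) (hzs : z - s ^ 2 ∈ Ideal.span {4})
    (hc : Prime c) (hcop : d.Cop c) (hpos : ∀ τ : F →+* ℝ, 0 < τ c) (hcz : IsCoprime c z) :
    ∃ r, c ∣ r ^ 2 - z := by
  by_contra hr
  obtain ⟨t, ht, htc⟩ := (hcop.mul hzcop).exists_mem
  have key : ∀ {x : 𝓞 F} {b : Ideal (𝓞 F)}, x ≠ 0 → Ideal.span {x} = b ^ 2 → d.Cop x →
      IsCoprime c x → x ∣ t - 1 → c * x ∣ t - 1 →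
      SamePhase (d.gs (x / 4) * starRingEnd ℂ (d.gs (c * x / 4))) (d.gs (x * t ^ 2 / c)) := by
    intro x b hx hxb hxcop hcx hxt hcxt
    have hcx0 : c * x ≠ 0 := mul_ne_zero hc.ne_zero hx
    have h := d.gs_samePhase hF 1 1 hx hcx0 fun τ ↦ by
      have hxF : τ (x : F) ≠ 0 := by simpa using hx
      have := hpos τ
      have e : ((1 : (𝓞 F)ˣ) : 𝓞 F) * (x : F) * (((1 : (𝓞 F)ˣ) : 𝓞 F) * ((c * x : 𝓞 F) : F))
          = c * x ^ 2 := by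
        simp only [Units.val_one, map_one, map_mul]
        ring
      rw [e, map_mul, map_pow]
      positivity
    have h0 := d.gs_ne_zero hF 1 hcx0
    rw [Units.val_one, d.gs_decomp 1 hcx0 (hcop.mul hxcop).isCoprime_two ht hcxt,
      d.gs_mul hc.ne_zero hx hcx ht] at h h0
    rw [d.gs_decomp 1 hx hxcop.isCoprime_two ht hxt] at h
    have h2 := h.mul_conj_of_mul (left_ne_zero_of_mul h0)
      (gs_one_ne_zero hF hx hxcop.isCoprime_two ht hxt)
    have h3 := ((d.gs_of_square_ideal hx hxb hxcop.isCoprime_two hcx ht hxt).mul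
      (SamePhase.refl (d.gs (x * t ^ 2 / c)))).mul
      (d.gs_of_square_ideal (w := 1) hx hxb hxcop.isCoprime_two isCoprime_one_left ht hxt).conj
    rw [map_one, one_mul, mul_one] at h3
    have h4 := h2.trans h3
    simp only [map_one, one_mul, map_mul] at h4
    exact h4
  have h1 := key hz hb hzcop hcz (dvd_of_mul_left_dvd htc) htc
  have hct : c ∣ t - 1 := dvd_of_mul_right_dvd htc
  have h2 := key one_ne_zero (b := ⊤)
    (by rw [pow_two, Ideal.mul_top, Ideal.span_singleton_one]) cop_one isCoprime_one_right (one_dvd _)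
    (by rwa [mul_one])
  have h3 := gs_mul_conj_eq_of_sq cop_one hzcop hcop (s := s) (by rwa [one_mul])
  rw [h3] at h1
  have h4 := h2.symm.trans h1
  rw [d.gs_nonsquare hc hcop.isCoprime_two ht hct hr] at h4
  exact SamePhase.not_neg (gs_one_ne_zero hF hc.ne_zero hcop.isCoprime_two ht hct) h4

end TotallyPositive

end GaussData
end Reciprocity

section GroupCounting

variable {U G : Type*} [CommGroup U] [CommGroup G] [Finite G] (f : U →* G)

theorem index_range_powMonoidHom_two :
    (powMonoidHom 2 : G →* G).range.index = Nat.card (powMonoidHom 2 : G →* G).ker := by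
  have h1 := (powMonoidHom 2 : G →* G).range.card_mul_index
  have h2 := (powMonoidHom 2 : G →* G).ker.card_mul_index
  rw [Subgroup.index_ker, ← h1, mul_comm] at h2
  exact (Nat.eq_of_mul_eq_mul_left Nat.card_pos h2).symm

theorem exists_eq_sq_or_forall_exists_eq_mul_sq
    (h : Nat.card (powMonoidHom 2 : G →* G).ker ≤ (powMonoidHom 2 : U →* U).range.index) :
    ((∀ g : G, ∃ u s, g = f u * s ^ 2) ∨ ∃ u, (∃ s, f u = s ^ 2) ∧ ¬ ∃ v, u = v ^ 2) ∧
    ((∀ u u', (∃ s, f u = s ^ 2) → (∃ s, f u' = s ^ 2) → (¬ ∃ v, u = v ^ 2) →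
      (¬ ∃ v, u' = v ^ 2) → ∃ v, u * u' = v ^ 2) →
      ∀ g g' : G, (∃ u s, g = f u * s ^ 2) ∨ (∃ u s, g' = f u * s ^ 2) ∨
        ∃ u s, g' = g * f u * s ^ 2) := by
  set S := (powMonoidHom 2 : G →* G).range with hS
  set V := (powMonoidHom 2 : U →* U).range with hV
  let φ : U →* G ⧸ S := (QuotientGroup.mk' S).comp f
  have hmemS : ∀ g : G, (g : G ⧸ S) = 1 ↔ ∃ s, g = s ^ 2 := fun g ↦ by
    rw [QuotientGroup.eq_one_iff]
    exact ⟨fun ⟨s, hs⟩ ↦ ⟨s, hs.symm⟩, fun ⟨s, hs⟩ ↦ ⟨s, hs.symm⟩⟩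
  have hmemV : ∀ u : U, u ∈ V ↔ ∃ v, u = v ^ 2 := fun g ↦
    ⟨fun ⟨s, hs⟩ ↦ ⟨s, hs.symm⟩, fun ⟨s, hs⟩ ↦ ⟨s, hs.symm⟩⟩
  have hker : ∀ u, u ∈ φ.ker ↔ ∃ s, f u = s ^ 2 := fun u ↦ hmemS _
  have hrange : ∀ g : G, (g : G ⧸ S) ∈ φ.range → ∃ u s, g = f u * s ^ 2 := fun g ⟨u, hu⟩ ↦ by
    have : ((g * (f u)⁻¹ : G) : G ⧸ S) = 1 := by
      rw [QuotientGroup.mk_mul, QuotientGroup.mk_inv, mul_inv_eq_one]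
      exact hu.symm
    obtain ⟨s, hs⟩ := (hmemS _).mp this
    exact ⟨u, s, by rw [← hs, mul_comm, inv_mul_cancel_right]⟩
  have hVK : V ≤ φ.ker := by
    rintro _ ⟨v, rfl⟩
    exact (hker _).mpr ⟨f v, by simp⟩
  have hcard : Nat.card φ.range * φ.range.index = S.index := φ.range.card_mul_index
  rw [← index_range_powMonoidHom_two, ← hS, ← hcard] at h
  have hidx := Subgroup.relIndex_mul_index hVK
  rw [Subgroup.index_ker] at hidx
  have hpos : 0 < Nat.card φ.range := Nat.card_pos
  constructor
  · by_cases hR : φ.range = ⊤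
    · exact Or.inl fun g ↦ hrange g (hR ▸ Subgroup.mem_top _)
    · refine Or.inr ?_
      by_contra! hall
      have : V = φ.ker := le_antisymm hVK fun u hu ↦ (hmemV u).mpr (hall u ((hker u).mp hu))
      rw [this, Subgroup.index_ker] at h
      have h2 := Subgroup.one_lt_index_of_ne_top hR
      nlinarith
  · intro hall g g'
    have hrel : V.relIndex φ.ker ∣ 2 := by
      rw [Subgroup.relIndex_dvd_two_iff]
      by_cases hK : φ.ker ≤ V
      · exact ⟨1, one_mem _, fun b hb ↦ Or.inr (hK hb)⟩
      · obtain ⟨a, ha, haV⟩ := SetLike.not_le_iff_exists.mp hK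
        refine ⟨a, ha, fun b hb ↦ or_iff_not_imp_right.mpr fun hbV ↦ ?_⟩
        rw [hmemV] at haV hbV ⊢
        exact hall b a ((hker b).mp hb) ((hker a).mp ha) hbV haV
    have hle := Nat.le_of_dvd two_pos hrel
    have h2 : φ.range.index ≤ 2 := by
      rw [← hidx] at h
      by_contra! h3
      nlinarith
    have h3 : φ.range.index ≠ 0 := Subgroup.FiniteIndex.index_ne_zero
    by_cases hg : (g : G ⧸ S) ∈ φ.range
    · exact Or.inl (hrange g hg)
    by_cases hg' : (g' : G ⧸ S) ∈ φ.range
    · exact Or.inr (Or.inl (hrange g' hg'))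
    refine Or.inr (Or.inr ?_)
    have h4 : φ.range.index = 2 := by
      have : φ.range.index ≠ 1 := fun h1 ↦ hg (Subgroup.index_eq_one.mp h1 ▸ Subgroup.mem_top _)
      omega
    have h5 : ((g' * g⁻¹ : G) : G ⧸ S) ∈ φ.range := by
      rw [QuotientGroup.mk_mul, QuotientGroup.mk_inv, Subgroup.mul_mem_iff_of_index_two h4,
        inv_mem_iff]
      tauto
    obtain ⟨u, s, hus⟩ := hrange _ h5
    exact ⟨u, s, by rw [mul_assoc, ← hus, mul_comm, inv_mul_cancel_right]⟩

end GroupCounting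

section UnitCounting

variable {F : Type*} [Field F] [NumberField F]

theorem two_pow_le_index_sq_units (hF : ∀ τ : F →+* ℂ, ComplexEmbedding.IsReal τ) :
    (powMonoidHom 2 : (𝓞 F)ˣ →* (𝓞 F)ˣ).range.index ≠ 0 ∧
    2 ^ Module.finrank ℚ F ≤ (powMonoidHom 2 : (𝓞 F)ˣ →* (𝓞 F)ˣ).range.index := by
  have : IsTotallyReal F := ⟨fun v ↦ by
    rw [InfinitePlace.isReal_iff]
    exact hF _⟩
  have hrank : Units.rank F + 1 = Module.finrank ℚ F := by
    rw [← InfinitePlace.card_add_two_mul_card_eq_rank, IsTotallyReal.nrComplexPlaces_eq_zero,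
      Units.rank, InfinitePlace.card_eq_nrRealPlaces_add_nrComplexPlaces,
      IsTotallyReal.nrComplexPlaces_eq_zero]
    have := InfinitePlace.card_eq_nrRealPlaces_add_nrComplexPlaces (K := F)
    rw [IsTotallyReal.nrComplexPlaces_eq_zero] at this
    have : 0 < Fintype.card (InfinitePlace F) := Fintype.card_pos
    omega
  set V := (powMonoidHom 2 : (𝓞 F)ˣ →* (𝓞 F)ˣ).range
  have hsq : ∀ u : (𝓞 F)ˣ, u ^ 2 ∈ V := fun u ↦ ⟨u, rfl⟩
  have h0 : V.index ≠ 0 := by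
    have : Group.FG (𝓞 F)ˣ := Group.fg_iff_monoid_fg.mpr inferInstance
    have : Finite ((𝓞 F)ˣ ⧸ V) := by
      refine CommGroup.finite_of_fg_isMulTorsion _ fun x ↦ ?_
      obtain ⟨u, rfl⟩ := QuotientGroup.mk_surjective x
      refine isOfFinOrder_iff_pow_eq_one.mpr ⟨2, two_pos, ?_⟩
      rw [← QuotientGroup.mk_pow, QuotientGroup.eq_one_iff]
      exact hsq u
    exact Subgroup.index_ne_zero_of_finite
  refine ⟨h0, ?_⟩
  let Φ : Additive (𝓞 F)ˣ →+ (Fin (Units.rank F) → ℤ) :=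
    (Units.basisUnitLattice F).equivFun.toAddMonoidHom.comp
      ((Units.logEmbedding F).codRestrict (Units.unitLattice F)
        fun x ↦ Submodule.mem_map_of_mem (Submodule.mem_top (x := x)))
  have hΦ : Function.Surjective Φ := by
    refine (Units.basisUnitLattice F).equivFun.surjective.comp ?_
    rintro ⟨_, x, -, rfl⟩
    exact ⟨x, rfl⟩
  let ψ : (𝓞 F)ˣ →* Multiplicative (Fin (Units.rank F) → ZMod 2) :=
    AddMonoidHom.toMultiplicativeRight
      (((Int.castAddHom (ZMod 2)).compLeft (Fin (Units.rank F))).comp Φ)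
  have hsurj : Function.Surjective ψ := by
    refine Function.Surjective.comp (g := fun f i ↦ ((f i : ℤ) : ZMod 2)) (fun f ↦ ?_) hΦ
    choose g hg using fun i ↦ ZMod.intCast_surjective (f i)
    exact ⟨g, funext hg⟩
  have hidx : ψ.ker.index = 2 ^ Units.rank F := by
    rw [Subgroup.index_ker, MonoidHom.range_eq_top.mpr hsurj, Subgroup.card_top,
      Nat.card_congr Multiplicative.toAdd, Nat.card_fun, Nat.card_zmod, Nat.card_fin]
  have hle : V ≤ ψ.ker := by
    rintro _ ⟨u, rfl⟩
    rw [MonoidHom.mem_ker, powMonoidHom_apply, map_pow]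
    change 2 • Multiplicative.toAdd (ψ u) = 0
    funext i
    rw [two_nsmul]
    exact CharTwo.add_self_eq_zero _
  have hneg : (-1 : (𝓞 F)ˣ) ∈ ψ.ker := by
    have h : (-1 : (𝓞 F)ˣ) ∈ Units.torsion F :=
      isOfFinOrder_iff_pow_eq_one.mpr ⟨2, two_pos, by simp⟩
    have h1 : Φ (Additive.ofMul (-1)) = 0 := by
      change (Units.basisUnitLattice F).equivFun _ = 0
      rw [LinearEquiv.map_eq_zero_iff]
      exact Subtype.ext (Units.dirichletUnitTheorem.logEmbedding_eq_zero_iff.mpr h)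
    rw [MonoidHom.mem_ker]
    change Multiplicative.ofAdd
      (((Int.castAddHom (ZMod 2)).compLeft (Fin (Units.rank F))) (Φ (Additive.ofMul (-1)))) = 1
    rw [h1, map_zero, ofAdd_zero]
  have hneg' : (-1 : (𝓞 F)ˣ) ∉ V := by
    rintro ⟨u, hu⟩
    obtain ⟨v⟩ : Nonempty (InfinitePlace F) := inferInstance
    let τ := InfinitePlace.embedding_of_isReal (IsTotallyReal.isReal v)
    have h1 : τ ((u : 𝓞 F) : F) ^ 2 = -1 := by
      have := congrArg (fun x : (𝓞 F)ˣ ↦ τ ((x : 𝓞 F) : F)) hu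
      simpa using this
    nlinarith [sq_nonneg (τ ((u : 𝓞 F) : F))]
  have hrel := Subgroup.relIndex_mul_index hle
  have h1 : V.relIndex ψ.ker ≠ 0 := fun h ↦ h0 (by rw [← hrel, h, zero_mul])
  have h2 : V.relIndex ψ.ker ≠ 1 := fun h ↦ hneg' (Subgroup.relIndex_eq_one.mp h hneg)
  rw [← hrank, ← hrel, hidx, pow_succ, mul_comm]
  exact Nat.mul_le_mul_right _ (by omega)

theorem mem_span_two_of_sq_sub_one {s : 𝓞 F} (h : s ^ 2 - 1 ∈ Ideal.span {(4 : 𝓞 F)}) :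
    s - 1 ∈ Ideal.span {(2 : 𝓞 F)} := by
  obtain ⟨k, hk⟩ := Ideal.mem_span_singleton.mp h
  have hk' : (s : F) ^ 2 - 1 = 4 * k := by
    have := congrArg (algebraMap (𝓞 F) F) hk
    simpa only [map_sub, map_mul, map_pow, map_ofNat, map_one] using this
  obtain ⟨w, hw⟩ := IsIntegrallyClosed.isIntegral_iff (R := 𝓞 F).mp
    (show IsIntegral (𝓞 F) (((s : F) - 1) / 2) from by
      refine ⟨Polynomial.X ^ 2 + Polynomial.X - Polynomial.C k, by monicity!, ?_⟩
      simp only [Polynomial.eval₂_sub, Polynomial.eval₂_add, Polynomial.eval₂_pow,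
        Polynomial.eval₂_X, Polynomial.eval₂_C]
      linear_combination hk' / 4)
  refine Ideal.mem_span_singleton.mpr ⟨w, RingOfIntegers.coe_injective ?_⟩
  simp only [map_sub, map_one, map_mul, map_ofNat]
  rw [hw]
  ring

theorem card_sq_eq_one_le :
    Nat.card (powMonoidHom 2 : (𝓞 F ⧸ Ideal.span {(4 : 𝓞 F)})ˣ →* _).ker
      ≤ 2 ^ Module.finrank ℚ F := by
  have h2 : Ideal.span {(2 : 𝓞 F)} ≠ ⊥ := by simp
  have hfin : Finite (𝓞 F ⧸ Ideal.span {(2 : 𝓞 F)}) := Ideal.finiteQuotientOfFreeOfNeBot _ h2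
  have hcard : Nat.card (𝓞 F ⧸ Ideal.span {(2 : 𝓞 F)}) = 2 ^ Module.finrank ℚ F := by
    have h := Ideal.absNorm_span_singleton (2 : 𝓞 F)
    have h3 := Algebra.norm_algebraMap (S := 𝓞 F) (2 : ℤ)
    rw [map_ofNat] at h3
    rw [h3, Int.natAbs_pow, RingOfIntegers.rank] at h
    exact h
  rw [← hcard]
  have hchoose : ∀ g : (powMonoidHom 2 : (𝓞 F ⧸ Ideal.span {(4 : 𝓞 F)})ˣ →* _).ker,
      ∃ w : 𝓞 F, ((g : (𝓞 F ⧸ Ideal.span {(4 : 𝓞 F)})ˣ) : 𝓞 F ⧸ Ideal.span {(4 : 𝓞 F)})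
        = Ideal.Quotient.mk _ (1 + 2 * w) := fun ⟨g, hg⟩ ↦ by
    obtain ⟨s, hs⟩ := Ideal.Quotient.mk_surjective (g : 𝓞 F ⧸ Ideal.span {(4 : 𝓞 F)})
    have h1 : s ^ 2 - 1 ∈ Ideal.span {(4 : 𝓞 F)} := by
      rw [← Ideal.Quotient.eq, map_pow, hs, map_one, ← Units.val_pow_eq_pow_val]
      exact congrArg Units.val hg
    obtain ⟨w, hw⟩ := Ideal.mem_span_singleton.mp (mem_span_two_of_sq_sub_one h1)
    exact ⟨w, by rw [← hw, add_sub_cancel, hs]⟩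
  choose w hw using hchoose
  refine Nat.card_le_card_of_injective (fun g ↦ Ideal.Quotient.mk (Ideal.span {(2 : 𝓞 F)}) (w g))
    fun g g' hgg ↦ Subtype.ext (Units.ext ?_)
  obtain ⟨k, hk⟩ := Ideal.mem_span_singleton.mp (Ideal.Quotient.eq.mp hgg)
  rw [hw, hw, Ideal.Quotient.eq, Ideal.mem_span_singleton]
  exact ⟨k, by linear_combination 2 * hk⟩

end UnitCounting

theorem GaussData.cop_of_sup_eq_top {F : Type*} [Field F] [NumberField F] {d : GaussData F}
    {c : 𝓞 F} (h : Ideal.span {c} ⊔ d.level = ⊤) : d.Cop c := by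
  obtain ⟨x, hx, y, hy, hxy⟩ := Submodule.mem_sup.mp ((Ideal.eq_top_iff_one _).mp h)
  obtain ⟨p, rfl⟩ := Ideal.mem_span_singleton'.mp hx
  exact cop_iff.mpr ⟨p, by rw [← hxy, sub_add_cancel_left]; exact neg_mem hy⟩

theorem exists_unit_sq_eq {F : Type*} [Field F] [NumberField F] {u : (𝓞 F)ˣ} {g : F}
    (hg : ((u : 𝓞 F) : F) = g ^ 2) : ∃ v : (𝓞 F)ˣ, u = v ^ 2 := by
  have hint : IsIntegral ℤ g := IsIntegral.of_pow two_pos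
    (hg ▸ RingOfIntegers.isIntegral_coe (u : 𝓞 F))
  obtain ⟨w, hw⟩ := (IsIntegralClosure.isIntegral_iff (A := 𝓞 F)).mp hint
  have hg' : (u : 𝓞 F) = w ^ 2 := RingOfIntegers.coe_injective (by
    rw [map_pow, hw]
    exact hg)
  obtain ⟨v, hv⟩ : IsUnit w := (isUnit_pow_iff two_ne_zero).mp (hg' ▸ u.isUnit)
  exact ⟨v, Units.ext (by rw [hg', Units.val_pow_eq_pow_val, hv])⟩

/-- `σ` is the complex conjugation of the CM field `E` with maximal totally real subfield `F`. -/
structure IsCMConj (F : Type*) {E : Type*} [Field F] [Field E] [Algebra F E]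
    (σ : E ≃+* E) : Prop where
  finrank : Module.finrank F E = 2
  real : ∀ τ : F →+* ℂ, ComplexEmbedding.IsReal τ
  imag : ∀ τ : E →+* ℂ, ¬ ComplexEmbedding.IsReal τ
  invol : ∀ x, σ (σ x) = x
  ne_refl : σ ≠ RingEquiv.refl E
  fixed : ∀ x : E, σ x = x ↔ x ∈ (algebraMap F E).range

namespace IsCMConj

variable {F E : Type*} [Field E] [NumberField E] [Field F] [NumberField F] [Algebra F E]
  {σ : E ≃+* E} (h : IsCMConj F σ)
include h

theorem map_algebraMap (x : F) : σ (algebraMap F E x) = algebraMap F E x :=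
  (h.fixed _).mpr ⟨x, rfl⟩

theorem exists_eq_of_map_eq {x : E} (hx : σ x = x) : ∃ f : F, algebraMap F E f = x :=
  (h.fixed x).mp hx

theorem star_algebraMap (τ : E →+* ℂ) (f : F) :
    (starRingEnd ℂ) (τ (algebraMap F E f)) = τ (algebraMap F E f) :=
  RingHom.congr_fun (ComplexEmbedding.isReal_iff.mp (h.real (τ.comp (algebraMap F E)))) f

theorem embedding_map (τ : E →+* ℂ) (x : E) : τ (σ x) = (starRingEnd ℂ) (τ x) := by
  have hreal : ∀ y, σ y = y → (starRingEnd ℂ) (τ y) = τ y := fun y hy ↦ by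
    obtain ⟨f, rfl⟩ := h.exists_eq_of_map_eq hy
    exact h.star_algebraMap τ f
  obtain ⟨x₀, hx₀⟩ : ∃ x₀, σ x₀ ≠ x₀ := by
    by_contra! hall
    exact h.ne_refl (RingEquiv.ext hall)
  set δ := x₀ - σ x₀ with hδ
  have hδ0 : δ ≠ 0 := fun h0 ↦ hx₀ (sub_eq_zero.mp h0).symm
  have hσδ : σ δ = -δ := by rw [hδ, map_sub, h.invol]; ring
  have h1 : (starRingEnd ℂ) (τ δ) ^ 2 = τ δ ^ 2 := by
    rw [← map_pow, ← map_pow]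
    exact hreal _ (by rw [map_pow, hσδ]; ring)
  have hdec : ∀ y, ∃ a b, σ a = a ∧ σ b = b ∧ y = a + b * δ := fun y ↦ by
    refine ⟨(y + σ y) / 2, (y - σ y) / (2 * δ), ?_, ?_, ?_⟩
    · rw [map_div₀, map_add, h.invol, map_ofNat, add_comm]
    · rw [map_div₀, map_sub, h.invol, map_mul, hσδ, map_ofNat]
      field_simp
      ring
    · field_simp
      ring
  have hconj : (starRingEnd ℂ) (τ δ) = -τ δ := by
    refine (sq_eq_sq_iff_eq_or_eq_neg.mp h1).resolve_left fun h2 ↦ h.imag τ ?_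
    refine ComplexEmbedding.isReal_iff.mpr (RingHom.ext fun y ↦ ?_)
    obtain ⟨a, b, ha, hb, rfl⟩ := hdec y
    rw [ComplexEmbedding.conjugate_coe_eq]
    simp only [map_add, map_mul, hreal a ha, hreal b hb, h2]
  obtain ⟨a, b, ha, hb, rfl⟩ := hdec x
  simp only [map_add, map_mul, hreal a ha, hreal b hb, hconj, ha, hb, hσδ, map_neg]

theorem exists_extension (τ : F →+* ℝ) :
    ∃ τ' : E →+* ℂ, ∀ f : F, τ' (algebraMap F E f) = (τ f : ℂ) := by
  let _ : Algebra F ℂ := (Complex.ofRealHom.comp τ).toAlgebra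
  have : Algebra.IsAlgebraic F E := by
    have : CharZero F := inferInstance
    have : IsScalarTower ℚ F E := IsScalarTower.of_algebraMap_eq fun q ↦ by simp
    exact Algebra.IsAlgebraic.tower_top (K := ℚ) F
  exact ⟨(IsAlgClosed.lift : E →ₐ[F] ℂ), fun f ↦
    (IsAlgClosed.lift : E →ₐ[F] ℂ).commutes f⟩

theorem pos_of_algebraMap_eq_mul {f : F} {x : E} (hx : x ≠ 0)
    (hf : algebraMap F E f = x * σ x) (τ : F →+* ℝ) : 0 < τ f := by
  obtain ⟨τ', hτ'⟩ := h.exists_extension τ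
  have h1 : (τ f : ℂ) = (Complex.normSq (τ' x) : ℂ) := by
    rw [← hτ', hf, map_mul, h.embedding_map, Complex.mul_conj]
  rw [Complex.ofReal_inj.mp h1]
  exact Complex.normSq_pos.mpr ((map_ne_zero τ').mpr hx)

theorem exists_sq_eq_of_isSquare {f : F} (hf : IsSquare (algebraMap F E f))
    (hpos : ∀ τ : F →+* ℝ, 0 < τ f) : ∃ g : F, f = g ^ 2 := by
  obtain ⟨δ, hδ⟩ := hf
  have hsq : (σ δ) ^ 2 = δ ^ 2 := by
    rw [← map_pow, sq, ← hδ, h.map_algebraMap]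
  rcases sq_eq_sq_iff_eq_or_eq_neg.mp hsq with h1 | h1
  · obtain ⟨g, hg⟩ := h.exists_eq_of_map_eq h1
    exact ⟨g, (algebraMap F E).injective (by rw [hδ, map_pow, hg, sq])⟩
  · obtain ⟨v⟩ : Nonempty (InfinitePlace F) := inferInstance
    have hv : v.IsReal := (InfinitePlace.isReal_iff).mpr (h.real _)
    let τ := InfinitePlace.embedding_of_isReal hv
    have hf0 : f ≠ 0 := fun h0 ↦ by simpa [h0] using hpos τ
    have hδ0 : δ ≠ 0 := by
      rintro rfl
      exact hf0 ((map_eq_zero (algebraMap F E)).mp (by simpa using hδ))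
    have h2 := h.pos_of_algebraMap_eq_mul (f := -f) hδ0 (by rw [map_neg, hδ, h1]; ring) τ
    rw [map_neg] at h2
    linarith [hpos τ]

theorem exists_integer_eq {x : 𝓞 E} (hx : σ x = x) : ∃ f : 𝓞 F, algebraMap (𝓞 F) (𝓞 E) f = x := by
  obtain ⟨f, hf⟩ := h.exists_eq_of_map_eq hx
  have hint : IsIntegral ℤ f :=
    (isIntegral_algebraMap_iff (algebraMap F E).injective).mp (hf ▸ x.isIntegral_coe)
  obtain ⟨w, hw⟩ := (IsIntegralClosure.isIntegral_iff (A := 𝓞 F)).mp hint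
  refine ⟨w, RingOfIntegers.coe_injective ?_⟩
  refine Eq.trans ?_ hf
  rw [← hw]
  rfl

theorem norm_eq (x : E) : Algebra.norm ℚ (σ x) = Algebra.norm ℚ x :=
  Algebra.norm_eq_of_algEquiv (AlgEquiv.ofRingEquiv (f := σ) fun q ↦ by simp) x

theorem isSquare_of_forall_totallyPositive (hclass : classNumber E = 1) {M : Ideal (𝓞 F)}
    (hM : M ≠ ⊥) {γ : 𝓞 F} (hγ : γ ≠ 0)
    (hsq : ∀ c : 𝓞 F, Prime c → (∀ τ : F →+* ℝ, 0 < τ c) → Ideal.span {c} ⊔ M = ⊤ →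
      ∃ r, c ∣ r ^ 2 - γ) : IsSquare (algebraMap F E γ) := by
  have hinj : Function.Injective (algebraMap (𝓞 F) (𝓞 E)) := FaithfulSMul.algebraMap_injective _ _
  have hPIR := classNumber_eq_one_iff.mp hclass
  have hmap : M.map (algebraMap (𝓞 F) (𝓞 E)) ≠ ⊥ := by
    rwa [Ne, Ideal.map_eq_bot_iff_of_injective hinj]
  have hfin : {P : Ideal (𝓞 E) | Prime P ∧ M.map (algebraMap (𝓞 F) (𝓞 E)) ≤ P}.Finite := by
    refine ((Ideal.finite_factors hmap).image fun v ↦ v.asIdeal).subset ?_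
    rintro P ⟨hP, hle⟩
    exact ⟨⟨P, Ideal.isPrime_of_prime hP, hP.ne_zero⟩, Ideal.dvd_iff_le.mpr hle, rfl⟩
  refine isSquare_of_forall_prime_norm E (algebraMap (𝓞 F) (𝓞 E) γ)
    ((map_ne_zero_iff _ hinj).mpr hγ) hfin.toFinset fun P hP hnorm hPS ↦ ?_
  obtain ⟨π, rfl⟩ := (IsPrincipalIdealRing.principal P).principal
  rw [Ideal.submodule_span_eq] at hP hnorm hPS ⊢
  have hπ : π ≠ 0 := fun h0 ↦ hP.ne_zero (by simp [h0])
  obtain ⟨c, hc⟩ := h.exists_integer_eq (x := π * RingOfIntegers.mapRingEquiv σ π) (by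
    simp only [map_mul, RingOfIntegers.mapRingEquiv_apply, h.invol]
    rw [mul_comm])
  have hcF : algebraMap F E c = (π : E) * σ π := by
    have := congrArg (algebraMap (𝓞 E) E) hc
    rwa [map_mul] at this
  have hc0 : c ≠ 0 := by
    rintro rfl
    rw [map_zero, eq_comm, mul_eq_zero] at hc
    simp [hπ] at hc
  have hN : (Algebra.norm ℤ c).natAbs = (Algebra.norm ℤ π).natAbs := by
    have h1 : (Algebra.norm ℤ c) ^ 2 = (Algebra.norm ℤ π) ^ 2 := by
      have h2 : ((Algebra.norm ℤ c : ℤ) : ℚ) ^ 2 = (Algebra.norm ℤ π : ℤ) ^ 2 := by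
        rw [Algebra.coe_norm_int, Algebra.coe_norm_int, ← map_pow, ← h.finrank,
          ← Algebra.norm_algebraMap (R := F) (S := E), Algebra.norm_norm, hcF, map_mul,
          h.norm_eq, h.finrank, sq]
      exact_mod_cast h2
    exact Int.natAbs_eq_natAbs_iff.mpr (sq_eq_sq_iff_eq_or_eq_neg.mp h1)
  have hcP : (Ideal.span {c}).IsPrime := by
    refine Ideal.isPrime_of_irreducible_absNorm ?_
    rw [Ideal.absNorm_span_singleton, hN, ← Ideal.absNorm_span_singleton]
    exact hnorm
  have hcmax := hcP.isMaximal (by simpa using hc0)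
  have hcprime : Prime c := (Ideal.span_singleton_prime hc0).mp hcP
  have hcop : Ideal.span {c} ⊔ M = ⊤ := by
    refine ((hcmax.out.not_le_iff_codisjoint).mp fun hle ↦ hPS ?_).eq_top
    simp only [Set.Finite.mem_toFinset]
    refine ⟨hP, (Ideal.map_mono hle).trans ?_⟩
    rw [Ideal.map_span, Set.image_singleton, hc, Ideal.span_singleton_le_span_singleton]
    exact dvd_mul_right _ _
  obtain ⟨r, t, hr⟩ := hsq c hcprime
    (h.pos_of_algebraMap_eq_mul (RingOfIntegers.coe_ne_zero_iff.mpr hπ) hcF) hcop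
  refine ⟨algebraMap _ _ r, Ideal.mem_span_singleton.mpr ?_⟩
  rw [← map_pow, ← map_sub, hr, map_mul, hc]
  exact (dvd_mul_right _ _).mul_right _

theorem isSquare_of_square_ideal (hclass : classNumber E = 1) {d : GaussData F} {z s : 𝓞 F}
    {b : Ideal (𝓞 F)} (hz : z ≠ 0) (hb : Ideal.span {z} = b ^ 2) (hzcop : d.Cop z)
    (hzs : z - s ^ 2 ∈ Ideal.span {(4 : 𝓞 F)}) : IsSquare (algebraMap F E z) := by
  refine h.isSquare_of_forall_totallyPositive hclass (M := d.level * Ideal.span {z})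
    (mul_ne_zero d.level_ne (by simpa using hz)) hz fun c hc hpos hcM ↦ ?_
  refine d.exists_dvd_sq_sub_of_totallyPositive h.real hz hb hzcop hzs hc ?_ hpos ?_
  · exact GaussData.cop_of_sup_eq_top (eq_top_mono (sup_le_sup_left Ideal.mul_le_left _) hcM)
  · rw [← Ideal.isCoprime_span_singleton_iff, Ideal.isCoprime_iff_sup_eq]
    exact eq_top_mono (sup_le_sup_left Ideal.mul_le_right _) hcM

theorem exists_eq_sq_of_forall_dvd (hclass : classNumber E = 1) {d : GaussData F} {γ : (𝓞 F)ˣ}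
    (hγ : ∀ τ : F →+* ℝ, 0 < τ (γ : 𝓞 F))
    (hsq : ∀ c : 𝓞 F, Prime c → d.Cop c → ∃ r, c ∣ r ^ 2 - (γ : 𝓞 F)) :
    ∃ v : (𝓞 F)ˣ, γ = v ^ 2 := by
  obtain ⟨g, hg⟩ := h.exists_sq_eq_of_isSquare
    (h.isSquare_of_forall_totallyPositive hclass d.level_ne γ.ne_zero fun c hc _ hcM ↦
      hsq c hc (GaussData.cop_of_sup_eq_top hcM)) hγ
  exact exists_unit_sq_eq hg

end IsCMConj

section DyadicClasses

variable {F : Type*} [Field F] [NumberField F]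

theorem units_classes_mod_four (hF : ∀ τ : F →+* ℂ, ComplexEmbedding.IsReal τ) :
    ((∀ g : 𝓞 F, IsCoprime g 2 → ∃ (u : (𝓞 F)ˣ) (s : 𝓞 F),
        g - u * s ^ 2 ∈ Ideal.span {(4 : 𝓞 F)}) ∨
      ∃ u : (𝓞 F)ˣ, (∃ s : 𝓞 F, (u : 𝓞 F) - s ^ 2 ∈ Ideal.span {(4 : 𝓞 F)}) ∧
        ¬ ∃ v, u = v ^ 2) ∧
    ((∀ u u' : (𝓞 F)ˣ, (∃ s : 𝓞 F, (u : 𝓞 F) - s ^ 2 ∈ Ideal.span {(4 : 𝓞 F)}) →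
        (∃ s : 𝓞 F, (u' : 𝓞 F) - s ^ 2 ∈ Ideal.span {(4 : 𝓞 F)}) →
        (¬ ∃ v, u = v ^ 2) → (¬ ∃ v, u' = v ^ 2) → ∃ v, u * u' = v ^ 2) →
      ∀ g g' : 𝓞 F, IsCoprime g 2 → IsCoprime g' 2 →
        (∃ (u : (𝓞 F)ˣ) (s : 𝓞 F), g - u * s ^ 2 ∈ Ideal.span {(4 : 𝓞 F)}) ∨
        (∃ (u : (𝓞 F)ˣ) (s : 𝓞 F), g' - u * s ^ 2 ∈ Ideal.span {(4 : 𝓞 F)}) ∨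
        ∃ (u : (𝓞 F)ˣ) (s : 𝓞 F), g' - g * u * s ^ 2 ∈ Ideal.span {(4 : 𝓞 F)}) := by
  set I := Ideal.span {(4 : 𝓞 F)} with hI
  have hfin : Finite (𝓞 F ⧸ I) := Ideal.finiteQuotientOfFreeOfNeBot _ (by simp [hI])
  let f : (𝓞 F)ˣ →* (𝓞 F ⧸ I)ˣ := Units.map (Ideal.Quotient.mk I : 𝓞 F →* 𝓞 F ⧸ I)
  have hunit : ∀ g : 𝓞 F, IsCoprime g 2 → IsUnit (Ideal.Quotient.mk I g) := fun g hg ↦ by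
    obtain ⟨a, b, hab⟩ : IsCoprime g (2 * 2) := hg.mul_right hg
    refine .of_mul_eq_one_right (Ideal.Quotient.mk I a) ?_
    rw [← map_mul, ← map_one (Ideal.Quotient.mk I), Ideal.Quotient.eq]
    exact Ideal.mem_span_singleton'.mpr ⟨-b, by linear_combination -hab⟩
  have hmk : ∀ {g w : 𝓞 F} {s : (𝓞 F ⧸ I)}, Ideal.Quotient.mk I g = Ideal.Quotient.mk I w * s ^ 2 →
      ∃ s : 𝓞 F, g - w * s ^ 2 ∈ I := fun {g w s} hs ↦ by
    obtain ⟨s, rfl⟩ := Ideal.Quotient.mk_surjective s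
    exact ⟨s, by rw [← Ideal.Quotient.eq, hs, map_mul, map_pow]⟩
  have hsq : ∀ u : (𝓞 F)ˣ, (∃ s, f u = s ^ 2) ↔ ∃ s : 𝓞 F, (u : 𝓞 F) - s ^ 2 ∈ I := fun u ↦ by
    constructor
    · rintro ⟨s, hs⟩
      obtain ⟨t, ht⟩ := hmk (g := u) (w := 1) (s := s)
        (by rw [map_one, one_mul, ← Units.val_pow_eq_pow_val, ← hs]; rfl)
      exact ⟨t, by rwa [one_mul] at ht⟩
    · rintro ⟨s, hs⟩
      rw [← Ideal.Quotient.eq, map_pow] at hs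
      obtain ⟨t, ht⟩ : IsUnit (Ideal.Quotient.mk I s) :=
        (isUnit_pow_iff two_ne_zero).mp (hs ▸ (f u).isUnit)
      exact ⟨t, Units.ext (by rw [Units.val_pow_eq_pow_val, ht, ← hs]; rfl)⟩
  obtain ⟨h1, h2⟩ := exists_eq_sq_or_forall_exists_eq_mul_sq f
    (card_sq_eq_one_le.trans (two_pow_le_index_sq_units hF).2)
  constructor
  · refine h1.imp (fun h g hg ↦ ?_) fun ⟨u, hu, hv⟩ ↦ ⟨u, (hsq u).mp hu, hv⟩
    obtain ⟨u, s, hus⟩ := h (hunit g hg).unit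
    exact ⟨u, hmk (s := s) (congrArg Units.val hus)⟩
  · intro h g g' hg hg'
    refine (h2 (fun u u' hu hu' ↦ h u u' ((hsq u).mp hu) ((hsq u').mp hu'))
      (hunit g hg).unit (hunit g' hg').unit).imp ?_ (Or.imp ?_ ?_)
    · rintro ⟨u, s, hus⟩
      exact ⟨u, hmk (s := s) (congrArg Units.val hus)⟩
    · rintro ⟨u, s, hus⟩
      exact ⟨u, hmk (s := s) (congrArg Units.val hus)⟩
    · rintro ⟨u, s, hus⟩
      exact ⟨u, hmk (s := s) ((congrArg Units.val hus).trans (by rw [map_mul]; rfl))⟩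

theorem exists_dvd_sq_sub_mul {c a b : 𝓞 F} (hc : Prime c) (ha : ¬ ∃ r, c ∣ r ^ 2 - a)
    (hb : ¬ ∃ r, c ∣ r ^ 2 - b) : ∃ r, c ∣ r ^ 2 - a * b := by
  classical
  set I := Ideal.span {c}
  have hprime : I.IsPrime := (Ideal.span_singleton_prime hc.ne_zero).mpr hc
  have hbot : I ≠ ⊥ := by simpa [I] using hc.ne_zero
  have hmax := hprime.isMaximal hbot
  let _ : Field (𝓞 F ⧸ I) := Ideal.Quotient.field I
  have : Finite (𝓞 F ⧸ I) := Ideal.finiteQuotientOfFreeOfNeBot _ hbot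
  let _ : Fintype (𝓞 F ⧸ I) := Fintype.ofFinite _
  have key : ∀ x : 𝓞 F, IsSquare (Ideal.Quotient.mk I x) ↔ ∃ r, c ∣ r ^ 2 - x := fun x ↦ by
    constructor
    · rintro ⟨s, hs⟩
      obtain ⟨r, rfl⟩ := Ideal.Quotient.mk_surjective s
      refine ⟨r, Ideal.mem_span_singleton.mp ?_⟩
      rw [← Ideal.Quotient.eq, hs, map_pow, sq]
    · rintro ⟨r, hr⟩
      refine ⟨Ideal.Quotient.mk I r, ?_⟩
      rw [← sq, ← map_pow, eq_comm, Ideal.Quotient.eq]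
      exact Ideal.mem_span_singleton.mpr hr
  rw [← key] at ha hb ⊢
  rw [← quadraticChar_neg_one_iff_not_isSquare] at ha hb
  by_contra h
  rw [← quadraticChar_neg_one_iff_not_isSquare, map_mul, map_mul, ha, hb] at h
  norm_num at h

end DyadicClasses

theorem exists_rootOfUnity_not_sq (E : Type*) [Field E] [NumberField E] :
    ∃ ζ : (𝓞 E)ˣ, IsOfFinOrder ζ ∧ ∀ ξ : (𝓞 E)ˣ, IsOfFinOrder ξ → ξ ^ 2 ≠ ζ := by
  have hfin : Finite (Units.torsion E) := inferInstance
  have hns : ¬ Function.Surjective (fun x : Units.torsion E ↦ x ^ 2) := by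
    rw [← Finite.injective_iff_surjective]
    intro hinj
    have hm : (-1 : (𝓞 E)ˣ) ∈ Units.torsion E :=
      isOfFinOrder_iff_pow_eq_one.mpr ⟨2, two_pos, by simp⟩
    have := congrArg Subtype.val
      (@hinj ⟨-1, hm⟩ 1 (Subtype.ext (by simp)))
    have h2 := congrArg (fun x : (𝓞 E)ˣ ↦ ((x : 𝓞 E) : E)) this
    norm_num at h2
  simp only [Function.Surjective, not_forall, not_exists] at hns
  obtain ⟨ζ, hζ⟩ := hns
  exact ⟨ζ, ζ.2, fun ξ hξ h ↦ hζ ⟨ξ, hξ⟩ (Subtype.ext h)⟩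

namespace IsCMConj

variable {F E : Type*} [Field E] [NumberField E] [Field F] [NumberField F] [Algebra F E]
  {σ : E ≃+* E} (h : IsCMConj F σ)
include h

theorem mul_map_eq_one {ζ : (𝓞 E)ˣ} (hζ : IsOfFinOrder ζ) :
    ((ζ : 𝓞 E) : E) * σ ((ζ : 𝓞 E) : E) = 1 := by
  obtain ⟨n, hn, hζn⟩ := isOfFinOrder_iff_pow_eq_one.mp hζ
  obtain ⟨τ⟩ : Nonempty (E →+* ℂ) := inferInstance
  apply τ.injective
  have h1 : τ ((ζ : 𝓞 E) : E) ^ n = 1 := by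
    have := congrArg (fun x : (𝓞 E)ˣ ↦ τ ((x : 𝓞 E) : E)) hζn
    simpa using this
  rw [map_mul, h.embedding_map, Complex.mul_conj, Complex.normSq_eq_norm_sq,
    Complex.norm_eq_one_of_pow_eq_one h1 hn.ne', map_one]
  norm_num

theorem exists_eq_mul_map {ζ : (𝓞 E)ˣ} (hζ : IsOfFinOrder ζ) {δ : 𝓞 E} (hδ : δ ≠ 0)
    (hσδ : σ δ = -δ) : ∃ x : 𝓞 E, x ≠ 0 ∧ (x : E) = ((ζ : 𝓞 E) : E) * σ x := by
  by_cases h1 : (ζ : 𝓞 E) = -1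
  · exact ⟨δ, hδ, by rw [h1, hσδ]; simp⟩
  · refine ⟨1 + ζ, fun h0 ↦ h1 (eq_neg_of_add_eq_zero_right h0), ?_⟩
    simp only [map_add, map_one, mul_add, mul_one, h.mul_map_eq_one hζ]
    ring

/-- An invariant ideal of `E` is extended from `F` as soon as `E / F` is unramified. -/
theorem exists_map_eq_span {x ω : 𝓞 E} {ζ δ : (𝓞 E)ˣ}
    (hx : (x : E) = ((ζ : 𝓞 E) : E) * σ x) (hω : (ω : E) - σ ω = ((δ : 𝓞 E) : E)) :
    ∃ a : Ideal (𝓞 F), a.map (algebraMap (𝓞 F) (𝓞 E)) = Ideal.span {x} := by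
  set σO := RingOfIntegers.mapRingEquiv σ
  have hx' : x = ζ * σO x := RingOfIntegers.coe_injective hx
  have hω' : ω - σO ω = δ := RingOfIntegers.coe_injective hω
  refine ⟨(Ideal.span {x}).comap (algebraMap (𝓞 F) (𝓞 E)), le_antisymm Ideal.map_comap_le ?_⟩
  have htr : ∀ y : 𝓞 E, x * y + σO (x * y) ∈
      ((Ideal.span {x}).comap (algebraMap (𝓞 F) (𝓞 E))).map (algebraMap (𝓞 F) (𝓞 E)) := by
    intro y
    obtain ⟨f, hf⟩ := h.exists_integer_eq (x := x * y + σO (x * y)) (by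
      simp only [map_add, map_mul, σO, RingOfIntegers.mapRingEquiv_apply, h.invol]
      rw [add_comm])
    rw [← hf]
    refine Ideal.mem_map_of_mem _ (Ideal.mem_comap.mpr ?_)
    rw [hf, map_mul]
    refine add_mem (Ideal.mem_span_singleton.mpr (dvd_mul_right _ _))
      (Ideal.mul_mem_right _ _ (Ideal.mem_span_singleton'.mpr ⟨((ζ⁻¹ : (𝓞 E)ˣ) : 𝓞 E), ?_⟩))
    conv_lhs => rw [hx']
    rw [Units.inv_mul_cancel_left]
  rw [Ideal.span_singleton_le_iff_mem]
  have h1 : (δ : 𝓞 E) * x = (x * ω + σO (x * ω)) - σO ω * (x * 1 + σO (x * 1)) := by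
    rw [← hω', map_mul, mul_one]
    ring
  have h2 := sub_mem (htr ω) (Ideal.mul_mem_left _ (σO ω) (htr 1))
  rw [← h1] at h2
  exact (Ideal.unit_mul_mem_iff_mem _ δ.isUnit).mp h2

end IsCMConj

/-- An ideal `a` with principal square has a representative of its class prime to the level. -/
theorem GaussData.exists_mul_eq_sq {F : Type*} [Field F] [NumberField F] (d : GaussData F)
    {n : 𝓞 F} {a : Ideal (𝓞 F)} (hn : n ≠ 0) (ha : Ideal.span {n} = a ^ 2) :
    ∃ (y z : 𝓞 F) (b : Ideal (𝓞 F)), y ^ 2 = n * z ∧ z ≠ 0 ∧ Ideal.span {z} = b ^ 2 ∧ d.Cop z := by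
  have hn' : Ideal.span {n} ≠ 0 := by simpa using hn
  have ha0 : a ≠ 0 := by
    rintro rfl
    exact hn' (by rw [ha, zero_pow two_ne_zero])
  obtain ⟨y, hy⟩ := IsDedekindDomain.exists_sup_span_eq (I := d.level * a) (J := a)
    Ideal.mul_le_right (mul_ne_zero d.level_ne ha0)
  obtain ⟨b, hb⟩ : a ∣ Ideal.span {y} := Ideal.dvd_iff_le.mpr (hy ▸ le_sup_right)
  have hcop : IsCoprime b d.level := by
    rw [Ideal.isCoprime_iff_sup_eq, sup_comm]
    refine mul_left_cancel₀ ha0 ?_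
    rw [Ideal.mul_sup, ← hb, mul_comm a, hy, Ideal.mul_top]
  obtain ⟨z, hz⟩ : n ∣ y ^ 2 := by
    rw [← Ideal.mem_span_singleton, ha, sq, sq]
    have : y ∈ a := Ideal.dvd_span_singleton.mp ⟨b, hb⟩
    exact Ideal.mul_mem_mul this this
  have hzb : Ideal.span {z} = b ^ 2 := by
    refine mul_left_cancel₀ hn' ?_
    rw [Ideal.span_singleton_mul_span_singleton, ← hz, ← Ideal.span_singleton_pow, hb, ha, mul_pow]
  have hzcop : d.Cop z := by
    refine GaussData.cop_of_sup_eq_top ?_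
    rw [hzb, ← Ideal.isCoprime_iff_sup_eq]
    exact hcop.pow_left
  refine ⟨y, z, b, hz, ?_, hzb, hzcop⟩
  rintro rfl
  have h2 : IsUnit (2 : 𝓞 F) := isCoprime_zero_left.mp hzcop.isCoprime_two
  have h3 := h2.map (Algebra.norm ℤ)
  have h4 := Algebra.norm_algebraMap (S := 𝓞 F) (2 : ℤ)
  rw [map_ofNat] at h4
  rw [h4, isUnit_pow_iff Module.finrank_pos.ne'] at h3
  exact absurd h3 (by decide)

namespace IsCMConj

variable {F E : Type*} [Field E] [NumberField E] [Field F] [NumberField F] [Algebra F E]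
  {σ : E ≃+* E} (h : IsCMConj F σ)
include h

theorem exists_antiinvariant_sqrt (hclass : classNumber E = 1) {u : (𝓞 F)ˣ}
    (hu : ∃ s : 𝓞 F, (u : 𝓞 F) - s ^ 2 ∈ Ideal.span {(4 : 𝓞 F)}) (hns : ¬ ∃ v, u = v ^ 2) :
    ∃ δ : E, algebraMap F E (u : 𝓞 F) = δ ^ 2 ∧ σ δ = -δ := by
  obtain ⟨d⟩ := exists_gaussData (F := F)
  obtain ⟨s, hs⟩ := hu
  obtain ⟨δ, hδ⟩ := h.isSquare_of_square_ideal hclass (d := d) (b := ⊤) u.ne_zero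
    (by rw [sq, Ideal.mul_top, Ideal.span_singleton_eq_top.mpr u.isUnit])
    (GaussData.cop_unit u) hs
  rw [← sq] at hδ
  refine ⟨δ, hδ, (sq_eq_sq_iff_eq_or_eq_neg.mp ?_).resolve_left fun h1 ↦ hns ?_⟩
  · rw [← map_pow, ← hδ, h.map_algebraMap]
  · obtain ⟨g, rfl⟩ := h.exists_eq_of_map_eq h1
    exact exists_unit_sq_eq ((algebraMap F E).injective (by rw [hδ, map_pow]))

theorem exists_unit_mul_eq_sq (hclass : classNumber E = 1) {d : GaussData F} {z s : 𝓞 F}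
    {b : Ideal (𝓞 F)} {η ε : (𝓞 F)ˣ} {δ : E} (hz : z ≠ 0) (hb : Ideal.span {z} = b ^ 2)
    (hzcop : d.Cop z) (hzs : z - η * s ^ 2 ∈ Ideal.span {(4 : 𝓞 F)})
    (hε : algebraMap F E (ε : 𝓞 F) = δ ^ 2) (hδ : σ δ = -δ) :
    ∃ (η' : (𝓞 F)ˣ) (g : F), (z : F) * ((η' : 𝓞 F) : F) = g ^ 2 := by
  obtain ⟨w, hw⟩ := h.isSquare_of_square_ideal hclass (d := d) (z := z * η) (s := η * s) (b := b)
    (mul_ne_zero hz η.ne_zero)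
    (by rw [← hb, Ideal.span_singleton_mul_right_unit η.isUnit])
    (hzcop.mul (GaussData.cop_unit η))
    (by
      have := Ideal.mul_mem_left _ (η : 𝓞 F) hzs
      convert this using 1
      ring)
  rw [← sq] at hw
  have hσ : σ w ^ 2 = w ^ 2 := by rw [← map_pow, ← hw, h.map_algebraMap]
  rcases sq_eq_sq_iff_eq_or_eq_neg.mp hσ with h1 | h1
  · obtain ⟨g, rfl⟩ := h.exists_eq_of_map_eq h1
    exact ⟨η, g, (algebraMap F E).injective (by rw [← map_mul, hw, map_pow])⟩
  · obtain ⟨g, hg⟩ := h.exists_eq_of_map_eq (x := w * δ) (by rw [map_mul, h1, hδ, neg_mul_neg])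
    refine ⟨η * ε, g, (algebraMap F E).injective ?_⟩
    rw [map_pow, hg, mul_pow, ← hw, ← hε]
    simp only [Units.val_mul, map_mul, mul_assoc]

/-- A root of unity that is not a square produces a nonsquare unit that is a norm. -/
theorem exists_nonsquare_eq_mul_map (d : GaussData F)
    (hZ : ∀ (z : 𝓞 F) (b : Ideal (𝓞 F)), z ≠ 0 → Ideal.span {z} = b ^ 2 → d.Cop z →
      ∃ (η : (𝓞 F)ˣ) (g : F), (z : F) * ((η : 𝓞 F) : F) = g ^ 2) {ε : (𝓞 F)ˣ} {δ₀ : E}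
    (hε : ∃ s : 𝓞 F, (ε : 𝓞 F) - s ^ 2 ∈ Ideal.span {(4 : 𝓞 F)})
    (hεδ : algebraMap F E (ε : 𝓞 F) = δ₀ ^ 2) (hδ₀ : σ δ₀ = -δ₀) :
    ∃ (η : (𝓞 F)ˣ) (u : (𝓞 E)ˣ), algebraMap F E (η : 𝓞 F) = ((u : 𝓞 E) : E) * σ ((u : 𝓞 E) : E) ∧
      ¬ ∃ v, η = v ^ 2 := by
  obtain ⟨δ, hδ⟩ := exists_unit_sq_eq
    (u := Units.map (algebraMap (𝓞 F) (𝓞 E) : 𝓞 F →* 𝓞 E) ε) (g := δ₀) hεδ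
  have hδsq : ((δ : 𝓞 E) : E) ^ 2 = algebraMap F E (ε : 𝓞 F) := by
    have := congrArg (fun w : (𝓞 E)ˣ ↦ ((w : 𝓞 E) : E)) hδ.symm
    simp only [Units.val_pow_eq_pow_val, map_pow] at this
    exact this
  have hσδ : σ ((δ : 𝓞 E) : E) = -((δ : 𝓞 E) : E) := by
    rcases sq_eq_sq_iff_eq_or_eq_neg.mp (hδsq.trans hεδ) with h1 | h1 <;> rw [h1]
    · exact hδ₀
    · rw [map_neg, hδ₀]
  obtain ⟨s, hs⟩ := hε
  obtain ⟨k, hk⟩ := Ideal.mem_span_singleton.mp hs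
  have hkE : algebraMap F E (ε : 𝓞 F) - algebraMap F E s ^ 2 = 4 * algebraMap F E k := by
    have := congrArg (fun x : 𝓞 F ↦ algebraMap F E x) hk
    simpa only [map_sub, map_mul, map_pow, map_ofNat] using this
  obtain ⟨ω, hω⟩ := (IsIntegralClosure.isIntegral_iff (R := 𝓞 F) (A := 𝓞 E)).mp
    (show IsIntegral (𝓞 F) ((algebraMap F E s + ((δ : 𝓞 E) : E)) / 2) from by
      refine ⟨Polynomial.X ^ 2 - Polynomial.C s * Polynomial.X - Polynomial.C k,
        by monicity!, ?_⟩
      simp only [Polynomial.eval₂_sub, Polynomial.eval₂_mul, Polynomial.eval₂_pow,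
        Polynomial.eval₂_X, Polynomial.eval₂_C]
      rw [IsScalarTower.algebraMap_apply (𝓞 F) F E, IsScalarTower.algebraMap_apply (𝓞 F) F E]
      linear_combination hkE / 4 + hδsq / 4)
  have hωσ : (ω : E) - σ ω = ((δ : 𝓞 E) : E) := by
    have hω' : (ω : E) = (algebraMap F E s + ((δ : 𝓞 E) : E)) / 2 := hω
    rw [hω', map_div₀, map_add, h.map_algebraMap, hσδ, map_ofNat]
    ring
  obtain ⟨ζ, hζ, hζsq⟩ := exists_rootOfUnity_not_sq E
  obtain ⟨x, hx0, hx⟩ := h.exists_eq_mul_map hζ δ.ne_zero hσδ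
  obtain ⟨a, ha⟩ := h.exists_map_eq_span hx hωσ
  obtain ⟨n, hn⟩ := h.exists_integer_eq (x := x * RingOfIntegers.mapRingEquiv σ x) (by
    simp only [map_mul, RingOfIntegers.mapRingEquiv_apply, h.invol]
    rw [mul_comm])
  have hnE : algebraMap F E n = (x : E) * σ x := by
    have := congrArg (algebraMap (𝓞 E) E) hn
    rwa [map_mul] at this
  have hxE : (x : E) ≠ 0 := RingOfIntegers.coe_ne_zero_iff.mpr hx0
  have hn0 : n ≠ 0 := by
    rintro rfl
    simp [hxE] at hnE
  have hna : Ideal.span {n} = a ^ 2 := by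
    refine Ideal.map_injective_of_faithfullyFlat (B := 𝓞 E) ?_
    rw [Ideal.map_pow, ha, Ideal.map_span, Set.image_singleton, hn, Ideal.span_singleton_pow,
      sq, ← Ideal.span_singleton_mul_left_unit ζ.isUnit]
    congr 2
    refine RingOfIntegers.coe_injective ?_
    simp only [map_mul, RingOfIntegers.mapRingEquiv_apply]
    linear_combination -(x : E) * hx
  obtain ⟨y, z, b, hyz, hz, hb, hzcop⟩ := d.exists_mul_eq_sq hn0 hna
  obtain ⟨η, g, hg⟩ := hZ z b hz hb hzcop
  have hyzE : algebraMap F E y ^ 2 = algebraMap F E n * algebraMap F E z := by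
    have := congrArg (fun x : 𝓞 F ↦ algebraMap F E x) hyz
    simpa only [map_mul, map_pow] using this
  have hgE : algebraMap F E z * algebraMap F E (η : 𝓞 F) = algebraMap F E g ^ 2 := by
    rw [← map_mul, hg, map_pow]
  have hy0 : algebraMap F E y ≠ 0 := by
    intro h0
    rw [h0, zero_pow two_ne_zero, eq_comm, mul_eq_zero] at hyzE
    simp [hn0, hz] at hyzE
  have hnorm : algebraMap F E (η : 𝓞 F) =
      (x * algebraMap F E g / algebraMap F E y) * σ (x * algebraMap F E g / algebraMap F E y) := by
    rw [map_div₀, map_mul, h.map_algebraMap, h.map_algebraMap, div_mul_div_comm,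
      eq_div_iff (mul_ne_zero hy0 hy0)]
    linear_combination algebraMap F E (η : 𝓞 F) * hyzE + algebraMap F E n * hgE +
      algebraMap F E g ^ 2 * hnE
  have hsq : ((ζ : 𝓞 E) : E) * algebraMap F E (η : 𝓞 F) =
      (x * algebraMap F E g / algebraMap F E y) ^ 2 := by
    rw [hnorm, map_div₀, map_mul, h.map_algebraMap, h.map_algebraMap]
    field_simp
    linear_combination -(algebraMap F E g) ^ 2 * hx
  obtain ⟨u, hu⟩ := exists_unit_sq_eq
    (u := ζ * Units.map (algebraMap (𝓞 F) (𝓞 E) : 𝓞 F →* 𝓞 E) η) (by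
      refine Eq.trans ?_ hsq
      simp only [Units.val_mul, map_mul]
      rfl)
  have hu' : ((u : 𝓞 E) : E) ^ 2 = (x * algebraMap F E g / algebraMap F E y) ^ 2 := by
    rw [← hsq]
    have := congrArg (fun w : (𝓞 E)ˣ ↦ ((w : 𝓞 E) : E)) hu.symm
    simp only [Units.val_pow_eq_pow_val, Units.val_mul, map_pow, map_mul] at this
    exact this
  refine ⟨η, u, ?_, ?_⟩
  · rcases sq_eq_sq_iff_eq_or_eq_neg.mp hu' with h1 | h1
    · rw [h1, hnorm]
    · rw [h1, hnorm, map_neg, neg_mul_neg]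
  rintro ⟨v, rfl⟩
  have hv : algebraMap F E (v : 𝓞 F) ≠ 0 := by simp
  have hηv : algebraMap F E ((v ^ 2 : (𝓞 F)ˣ) : 𝓞 F) = algebraMap F E (v : 𝓞 F) ^ 2 := by
    simp only [Units.val_pow_eq_pow_val, map_pow]
  obtain ⟨ξ, hξ⟩ := exists_unit_sq_eq (u := ζ)
    (g := x * algebraMap F E g / algebraMap F E y / algebraMap F E (v : 𝓞 F)) (by
      rw [div_pow, eq_div_iff (pow_ne_zero _ hv), ← hsq, hηv])
  refine hζsq ξ ?_ hξ.symm
  rw [hξ] at hζ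
  exact hζ.of_pow two_ne_zero

/-- In a CM field of class number one all totally positive units are norms of units. -/
theorem exists_eq_mul_map_of_totallyPositive (hclass : classNumber E = 1) {γ : (𝓞 F)ˣ}
    (hγ : ∀ τ : F →+* ℝ, 0 < τ (γ : 𝓞 F)) :
    ∃ u : (𝓞 E)ˣ, algebraMap F E (γ : 𝓞 F) = ((u : 𝓞 E) : E) * σ ((u : 𝓞 E) : E) := by
  obtain ⟨d⟩ := exists_gaussData (F := F)
  by_contra hcon
  have hns : ¬ ∃ v, γ = v ^ 2 := by
    rintro ⟨v, rfl⟩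
    refine hcon ⟨Units.map (algebraMap (𝓞 F) (𝓞 E) : 𝓞 F →* 𝓞 E) v, ?_⟩
    change _ = algebraMap F E (v : 𝓞 F) * σ (algebraMap F E (v : 𝓞 F))
    rw [h.map_algebraMap, ← sq]
    simp only [Units.val_pow_eq_pow_val, map_pow]
  have hsplit : ∀ γ' : (𝓞 F)ˣ, (∀ τ : F →+* ℝ, 0 < τ (γ' : 𝓞 F)) → ∀ c : 𝓞 F, Prime c →
      d.Cop c → (∃ (u : (𝓞 F)ˣ) (s : 𝓞 F), c - u * s ^ 2 ∈ Ideal.span {(4 : 𝓞 F)}) →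
      ∃ r, c ∣ r ^ 2 - (γ' : 𝓞 F) := by
    rintro γ' hγ' c hc hcop ⟨u, s, hs⟩
    exact d.exists_dvd_sq_sub_of_square_ideal h.real hγ' u.ne_zero (b := ⊤)
      (by rw [sq, Ideal.mul_top, Ideal.span_singleton_eq_top.mpr u.isUnit])
      (GaussData.cop_unit u) hc hcop hs
  have hinert : ∀ γ' : (𝓞 F)ˣ, (∀ τ : F →+* ℝ, 0 < τ (γ' : 𝓞 F)) → (¬ ∃ v, γ' = v ^ 2) →
      ∃ c : 𝓞 F, Prime c ∧ d.Cop c ∧ ¬ ∃ r, c ∣ r ^ 2 - (γ' : 𝓞 F) := by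
    intro γ' hγ' hns'
    by_contra! hall
    exact hns' (h.exists_eq_sq_of_forall_dvd hclass hγ' hall)
  obtain ⟨hA, hC⟩ := units_classes_mod_four h.real
  obtain ⟨ε, hε, hεns⟩ := hA.resolve_left fun hall ↦ by
    obtain ⟨c, hc, hcop, hcr⟩ := hinert γ hγ hns
    exact hcr (hsplit γ hγ c hc hcop (hall c hcop.isCoprime_two))
  obtain ⟨δ, hδ, hσδ⟩ := h.exists_antiinvariant_sqrt hclass hε hεns
  replace hC := hC fun u u' hu hu' hun hun' ↦ by
    obtain ⟨δ, hδ, hσδ⟩ := h.exists_antiinvariant_sqrt hclass hu hun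
    obtain ⟨δ', hδ', hσδ'⟩ := h.exists_antiinvariant_sqrt hclass hu' hun'
    obtain ⟨g, hg⟩ := h.exists_eq_of_map_eq (x := δ * δ') (by rw [map_mul, hσδ, hσδ', neg_mul_neg])
    refine exists_unit_sq_eq (g := g) ((algebraMap F E).injective ?_)
    rw [map_pow, hg, mul_pow, ← hδ, ← hδ']
    simp only [Units.val_mul, map_mul]
  have hZ : ∀ (z : 𝓞 F) (b : Ideal (𝓞 F)), z ≠ 0 → Ideal.span {z} = b ^ 2 → d.Cop z →
      ∃ (η : (𝓞 F)ˣ) (g : F), (z : F) * ((η : 𝓞 F) : F) = g ^ 2 := by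
    intro z b hz hb hzcop
    obtain ⟨c, hc, hcop, hcr⟩ := hinert γ hγ hns
    rcases hC z c hzcop.isCoprime_two hcop.isCoprime_two with ⟨u, s, hs⟩ | hs | ⟨u, s, hs⟩
    · exact h.exists_unit_mul_eq_sq hclass hz hb hzcop hs hδ hσδ
    · exact absurd (hsplit γ hγ c hc hcop hs) hcr
    · refine absurd (d.exists_dvd_sq_sub_of_square_ideal h.real hγ (z := z * u)
        (mul_ne_zero hz u.ne_zero) (by rw [← hb, Ideal.span_singleton_mul_right_unit u.isUnit])
        (hzcop.mul (GaussData.cop_unit u)) hc hcop hs) hcr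
  obtain ⟨η, u, hη, hηns⟩ := h.exists_nonsquare_eq_mul_map d hZ hε hδ hσδ
  have hηpos : ∀ τ : F →+* ℝ, 0 < τ (η : 𝓞 F) :=
    h.pos_of_algebraMap_eq_mul (RingOfIntegers.coe_ne_zero_iff.mpr u.ne_zero) hη
  have hprod : ¬ ∃ v, γ * η = v ^ 2 := by
    rintro ⟨v, hv⟩
    refine hcon ⟨Units.map (algebraMap (𝓞 F) (𝓞 E) : 𝓞 F →* 𝓞 E) v * u⁻¹, ?_⟩
    have huu : ((u : 𝓞 E) : E) * (((u⁻¹ : (𝓞 E)ˣ) : 𝓞 E) : E) = 1 := by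
      rw [← map_mul, Units.mul_inv, map_one]
    have hσu : σ ((u : 𝓞 E) : E) * σ (((u⁻¹ : (𝓞 E)ˣ) : 𝓞 E) : E) = 1 := by
      rw [← map_mul, huu, map_one]
    have h1 : algebraMap F E (γ : 𝓞 F) * (((u : 𝓞 E) : E) * σ ((u : 𝓞 E) : E)) =
        algebraMap F E (v : 𝓞 F) ^ 2 := by
      have := congrArg (fun w : (𝓞 F)ˣ ↦ algebraMap F E (w : 𝓞 F)) hv
      simp only [Units.val_mul, Units.val_pow_eq_pow_val, map_mul, map_pow] at this
      rw [← hη]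
      exact this
    simp only [Units.val_mul, map_mul]
    set p : E := ((u : 𝓞 E) : E)
    set q : E := (((u⁻¹ : (𝓞 E)ˣ) : 𝓞 E) : E)
    change _ = algebraMap F E (v : 𝓞 F) * q * (σ (algebraMap F E (v : 𝓞 F)) * σ q)
    rw [h.map_algebraMap]
    linear_combination q * σ q * h1 - algebraMap F E (γ : 𝓞 F) * (hσu + σ p * σ q * huu)
  have hprodpos : ∀ τ : F →+* ℝ, 0 < τ ((γ * η : (𝓞 F)ˣ) : 𝓞 F) := fun τ ↦ by
    simp only [Units.val_mul, map_mul]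
    exact mul_pos (hγ τ) (hηpos τ)
  obtain ⟨c₃, hc₃, hcop₃, hr₃⟩ := hinert _ hprodpos hprod
  have hcommon : ∀ γ' : (𝓞 F)ˣ, (∀ τ : F →+* ℝ, 0 < τ (γ' : 𝓞 F)) → (¬ ∃ v, γ' = v ^ 2) →
      ¬ ∃ r, c₃ ∣ r ^ 2 - (γ' : 𝓞 F) := by
    intro γ' hγ' hns' hr
    obtain ⟨c, hc, hcop, hcr⟩ := hinert γ' hγ' hns'
    rcases hC c₃ c hcop₃.isCoprime_two hcop.isCoprime_two with hs | hs | ⟨u, s, hs⟩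
    · exact hr₃ (hsplit _ hprodpos c₃ hc₃ hcop₃ hs)
    · exact hcr (hsplit γ' hγ' c hc hcop hs)
    · exact hcr (d.exists_dvd_sq_sub_of_congr h.real hγ' u hc₃ hcop₃ hc hcop hs hr)
  exact hr₃ (by
    rw [Units.val_mul]
    exact exists_dvd_sq_sub_mul hc₃ (hcommon γ hγ hns) (hcommon η hηpos hηns))

end IsCMConj

theorem FractionalIdeal.eq_spanSingleton_mul_of_mem_iff {E : Type*} [Field E] [NumberField E]
    {σ : E ≃+* E} {I J Iσ Jσ : FractionalIdeal (𝓞 E)⁰ E}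
    (hIσ : ∀ x : E, x ∈ Iσ ↔ ∃ y ∈ I, σ y = x) (hJσ : ∀ x : E, x ∈ Jσ ↔ ∃ y ∈ J, σ y = x)
    {e : E} (hJ : J = spanSingleton (𝓞 E)⁰ e * I) :
    Jσ = spanSingleton (𝓞 E)⁰ (σ e) * Iσ := by
  ext x
  rw [hJσ, hJ, mem_singleton_mul]
  constructor
  · rintro ⟨y, hy, rfl⟩
    obtain ⟨z, hz, rfl⟩ := mem_singleton_mul.mp hy
    exact ⟨σ z, (hIσ _).mpr ⟨z, hz, rfl⟩, map_mul ..⟩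
  · rintro ⟨y, hy, rfl⟩
    obtain ⟨z, hz, rfl⟩ := (hIσ y).mp hy
    exact ⟨e * z, mem_singleton_mul.mpr ⟨z, hz, rfl⟩, map_mul ..⟩

theorem FractionalIdeal.mem_one_iff_exists_map {E : Type*} [Field E] [NumberField E]
    (σ : E ≃+* E) (x : E) :
    x ∈ (1 : FractionalIdeal (𝓞 E)⁰ E) ↔ ∃ y ∈ (1 : FractionalIdeal (𝓞 E)⁰ E), σ y = x := by
  have key : ∀ (s : E ≃+* E) (y : E), y ∈ (1 : FractionalIdeal (𝓞 E)⁰ E) →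
      s y ∈ (1 : FractionalIdeal (𝓞 E)⁰ E) := by
    intro s y hy
    obtain ⟨z, rfl⟩ := (mem_one_iff _).mp hy
    exact (mem_one_iff _).mpr ⟨RingOfIntegers.mapRingEquiv s z, rfl⟩
  constructor
  · exact fun hx ↦ ⟨σ.symm x, key σ.symm x hx, σ.apply_symm_apply x⟩
  · rintro ⟨y, hy, rfl⟩
    exact key σ y hy

theorem FractionalIdeal.exists_eq_spanSingleton_of_classNumber_one {E : Type*} [Field E]
    [NumberField E] (hclass : classNumber E = 1) {I : FractionalIdeal (𝓞 E)⁰ E} (hI : I ≠ 0) :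
    ∃ i : E, i ≠ 0 ∧ I = spanSingleton (𝓞 E)⁰ i := by
  have := classNumber_eq_one_iff.mp hclass
  obtain ⟨i, hi⟩ := (isPrincipal_iff I).mp inferInstance
  refine ⟨i, ?_, hi⟩
  rintro rfl
  exact hI (by rw [hi, spanSingleton_zero])

namespace IsCMConj

variable {F E : Type*} [Field E] [NumberField E] [Field F] [NumberField F] [Algebra F E]
  {σ : E ≃+* E} (h : IsCMConj F σ)
include h

theorem exists_unit_eq_of_map_eq {w : (𝓞 E)ˣ} (hw : σ ((w : 𝓞 E) : E) = ((w : 𝓞 E) : E)) :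
    ∃ γ : (𝓞 F)ˣ, algebraMap F E (γ : 𝓞 F) = ((w : 𝓞 E) : E) := by
  have hinv : ((w : 𝓞 E) : E) * (((w⁻¹ : (𝓞 E)ˣ) : 𝓞 E) : E) = 1 := by
    rw [← map_mul, Units.mul_inv, map_one]
  have hw' : σ (((w⁻¹ : (𝓞 E)ˣ) : 𝓞 E) : E) = (((w⁻¹ : (𝓞 E)ˣ) : 𝓞 E) : E) := by
    have h1 := congrArg σ hinv
    rw [map_mul, map_one, hw, ← hinv] at h1
    exact mul_left_cancel₀ (RingOfIntegers.coe_ne_zero_iff.mpr w.ne_zero) h1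
  obtain ⟨a, ha⟩ := h.exists_integer_eq hw
  obtain ⟨b, hb⟩ := h.exists_integer_eq hw'
  have hab : a * b = 1 := by
    refine RingOfIntegers.coe_injective ((algebraMap F E).injective ?_)
    have ha' : algebraMap F E (a : F) = ((w : 𝓞 E) : E) :=
      congrArg (fun t : 𝓞 E ↦ (t : E)) ha
    have hb' : algebraMap F E (b : F) = (((w⁻¹ : (𝓞 E)ˣ) : 𝓞 E) : E) :=
      congrArg (fun t : 𝓞 E ↦ (t : E)) hb
    simp only [map_mul, map_one, ha', hb', hinv]
  exact ⟨Units.mkOfMulEqOne a b hab, congrArg (fun t : 𝓞 E ↦ (t : E)) ha⟩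

end IsCMConj

/-- Let `E` be a CM field with maximal totally real subfield `F` and
complex conjugation `σ`, with class number 1.  Two `O_E`-lattices `(I, α)` and `(J, β)` of
the same signature are isomorphic (there is `e ∈ Eˣ` with `J = eI` and `α = e·σ(e)·β`) if
and only if their discriminant ideals coincide. -/
theorem lattices_isomorphic_iff_discriminantIdeals_eq_of_classNumber_one
    (E F : Type*) [Field E] [NumberField E] [Field F] [NumberField F] [Algebra F E]
    (hquad : Module.finrank F E = 2)
    (hFreal : ∀ τ : F →+* ℂ, NumberField.ComplexEmbedding.IsReal τ)
    (hEimag : ∀ τ : E →+* ℂ, ¬NumberField.ComplexEmbedding.IsReal τ)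
    (σ : E ≃+* E)
    (hσ2 : ∀ x, σ (σ x) = x)
    (hσne : σ ≠ RingEquiv.refl E)
    (hfix : ∀ x : E, σ x = x ↔ x ∈ (algebraMap F E).range)
    (hclass : NumberField.classNumber E = 1)
    (I : FractionalIdeal (𝓞 E)⁰ E) (hI : I ≠ 0)
    (Iσ : FractionalIdeal (𝓞 E)⁰ E)
    (hIσ : ∀ x : E, x ∈ Iσ ↔ ∃ y ∈ I, σ y = x)
    (α : F) (hα : α ≠ 0)
    (hlatI : ∀ x ∈ I, ∀ y ∈ I,
      ∃ n : ℤ, Algebra.trace ℚ E (algebraMap F E α * x * σ y) = (n : ℚ))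
    (J : FractionalIdeal (𝓞 E)⁰ E) (hJ : J ≠ 0)
    (Jσ : FractionalIdeal (𝓞 E)⁰ E)
    (hJσ : ∀ x : E, x ∈ Jσ ↔ ∃ y ∈ J, σ y = x)
    (β : F) (hβ : β ≠ 0)
    (hlatJ : ∀ x ∈ J, ∀ y ∈ J,
      ∃ n : ℤ, Algebra.trace ℚ E (algebraMap F E β * x * σ y) = (n : ℚ))
    -- the two lattices have the same signature: `τ(αβ) > 0` for every real embedding of `F`
    (hsig : ∀ τ : F →+* ℝ, 0 < τ α * τ β) :
    (∃ e : E, e ≠ 0 ∧ J = spanSingleton (𝓞 E)⁰ e * I ∧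
        algebraMap F E α = e * σ e * algebraMap F E β)
      ↔ spanSingleton (𝓞 E)⁰ (algebraMap F E α) * I * Iσ
            * (differentIdeal ℤ (𝓞 E) : FractionalIdeal (𝓞 E)⁰ E)
          = spanSingleton (𝓞 E)⁰ (algebraMap F E β) * J * Jσ
            * (differentIdeal ℤ (𝓞 E) : FractionalIdeal (𝓞 E)⁰ E) := by
  have h : IsCMConj F σ := ⟨hquad, hFreal, hEimag, hσ2, hσne, hfix⟩
  constructor
  · rintro ⟨e, -, hJe, hα'⟩
    rw [eq_spanSingleton_mul_of_mem_iff hIσ hJσ hJe, hJe, hα',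
      ← spanSingleton_mul_spanSingleton, ← spanSingleton_mul_spanSingleton]
    ring
  · intro hdisc
    have hD : (differentIdeal ℤ (𝓞 E) : FractionalIdeal (𝓞 E)⁰ E) ≠ 0 :=
      coeIdeal_ne_zero.mpr differentIdeal_ne_bot
    replace hdisc := mul_right_cancel₀ hD hdisc
    obtain ⟨i, hi, rfl⟩ := exists_eq_spanSingleton_of_classNumber_one hclass hI
    obtain ⟨j, hj, rfl⟩ := exists_eq_spanSingleton_of_classNumber_one hclass hJ
    have hone := mem_one_iff_exists_map σ
    rw [eq_spanSingleton_mul_of_mem_iff hone hIσ (mul_one _).symm,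
      eq_spanSingleton_mul_of_mem_iff hone hJσ (mul_one _).symm, mul_one, mul_one,
      spanSingleton_mul_spanSingleton, spanSingleton_mul_spanSingleton,
      spanSingleton_mul_spanSingleton, spanSingleton_mul_spanSingleton,
      spanSingleton_eq_spanSingleton] at hdisc
    obtain ⟨w, hw⟩ := hdisc
    replace hw : ((w : 𝓞 E) : E) * (algebraMap F E α * i * σ i) =
        algebraMap F E β * j * σ j := by
      rw [← hw, Units.smul_def, Algebra.smul_def]
    have hα' : algebraMap F E α ≠ 0 := (_root_.map_ne_zero _).mpr hα
    have hβ' : algebraMap F E β ≠ 0 := (_root_.map_ne_zero _).mpr hβ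
    have hσi : σ i ≠ 0 := (_root_.map_ne_zero _).mpr hi
    have hσj : σ j ≠ 0 := (_root_.map_ne_zero _).mpr hj
    have hwσ : σ ((w : 𝓞 E) : E) = ((w : 𝓞 E) : E) := by
      have h1 := congrArg σ hw
      simp only [map_mul, h.map_algebraMap, hσ2] at h1
      refine mul_right_cancel₀ (mul_ne_zero (mul_ne_zero hα' hi) hσi) ?_
      linear_combination h1 - hw
    obtain ⟨γ, hγ⟩ := h.exists_unit_eq_of_map_eq hwσ
    have hpos : ∀ τ : F →+* ℝ, 0 < τ (γ : 𝓞 F) := by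
      intro τ
      have h1 : 0 < τ ((γ : 𝓞 F) * α * β) := by
        refine h.pos_of_algebraMap_eq_mul (x := algebraMap F E β * j / i)
          (div_ne_zero (mul_ne_zero hβ' hj) hi) ?_ τ
        simp only [map_mul, map_div₀, h.map_algebraMap, hγ]
        field_simp
        linear_combination hw
      rw [mul_assoc, map_mul, map_mul] at h1
      exact pos_of_mul_pos_left h1 (hsig τ).le
    obtain ⟨u, hu⟩ := h.exists_eq_mul_map_of_totallyPositive hclass hpos
    rw [hγ] at hu
    have hu0 : ((u : 𝓞 E) : E) ≠ 0 := RingOfIntegers.coe_ne_zero_iff.mpr u.ne_zero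
    have hσu0 : σ ((u : 𝓞 E) : E) ≠ 0 := (_root_.map_ne_zero _).mpr hu0
    refine ⟨j / (i * ((u : 𝓞 E) : E)), div_ne_zero hj (mul_ne_zero hi hu0), ?_, ?_⟩
    · rw [spanSingleton_mul_spanSingleton, spanSingleton_eq_spanSingleton]
      refine ⟨u⁻¹, ?_⟩
      have huu : ((u : 𝓞 E) : E) * (((u⁻¹ : (𝓞 E)ˣ) : 𝓞 E) : E) = 1 := by
        rw [← map_mul, Units.mul_inv, map_one]
      rw [Units.smul_def, Algebra.smul_def]
      field_simp
      linear_combination huu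
    · rw [map_div₀, map_mul]
      field_simp
      linear_combination hw - algebraMap F E α * i * σ i * hu
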